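/- There exist absolute constants 𝒦₄, 𝒦₅, 𝒦₆ > 0 such that: for every n ≥ 2, every n×n real matrix A with σ_A > 0, and all constants 𝒞₂, 𝒞₃ > 0, if (i) |F_B(x) − P_{E_A}²(x;z,F_B)| ≤ 𝒞₂·(E_A³ + (x−z)³) for all z ∈ ℝ, all z ≤ x ≤ z + 3E_A, and all B ∈ N(16, Â), and (ii) (|z|+1)·|Δ_y² F_B(z)| ≤ 𝒞₃·(E_A² + y²) for all z ∈ ℝ, all 0 ≤ y ≤ E_A, and all B ∈ N(16, Â), then ‖ℱ_A − e_{2,A}‖ ≤ (𝒦₄·𝒞₂ + 𝒦₅·𝒞₃ + 𝒦₆)·E_A³. -/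

import Mathlib

open Finset MeasureTheory

/-- Density of the standard normal distribution. -/
noncomputable def gaussD (x : ℝ) : ℝ := (Real.sqrt (2 * Real.pi))⁻¹ * Real.exp (-(x ^ 2) / 2)

/-- Distribution function of the standard normal distribution. -/
noncomputable def gaussCDF (x : ℝ) : ℝ := ∫ t in Set.Iic x, gaussD t

section RankDefs

variable {m : ℕ}

/-- Row mean `a_{i·}`. -/
noncomputable def rowMean (A : Matrix (Fin m) (Fin m) ℝ) (i : Fin m) : ℝ := (∑ j, A i j) / (m : ℝ)

/-- Column mean `a_{·j}`. -/
noncomputable def colMean (A : Matrix (Fin m) (Fin m) ℝ) (j : Fin m) : ℝ := (∑ i, A i j) / (m : ℝ)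

/-- Grand mean `a_{··}`. -/
noncomputable def totMean (A : Matrix (Fin m) (Fin m) ℝ) : ℝ := (∑ i, ∑ j, A i j) / (m : ℝ) ^ 2

/-- Centered entries `a_{ij} − a_{i·} − a_{·j} + a_{··}`. -/
noncomputable def ctr (A : Matrix (Fin m) (Fin m) ℝ) (i j : Fin m) : ℝ :=
  A i j - rowMean A i - colMean A j + totMean A

/-- `σ_A²`. -/
noncomputable def sigma2 (A : Matrix (Fin m) (Fin m) ℝ) : ℝ :=
  (∑ i, ∑ j, ctr A i j ^ 2) / ((m : ℝ) - 1)

/-- `σ_A`. -/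
noncomputable def sdev (A : Matrix (Fin m) (Fin m) ℝ) : ℝ := Real.sqrt (sigma2 A)

/-- Standardized matrix `Â = (â_{ij})`. -/
noncomputable def hatM (A : Matrix (Fin m) (Fin m) ℝ) : Matrix (Fin m) (Fin m) ℝ :=
  fun i j => ctr A i j / sdev A

/-- `μ_A = n·a_{··}`. -/
noncomputable def muM (A : Matrix (Fin m) (Fin m) ℝ) : ℝ := (m : ℝ) * totMean A

/-- The linear rank statistic `T_A(π) = Σ_i a_{iπ(i)}`. -/
noncomputable def rankT (A : Matrix (Fin m) (Fin m) ℝ) (π : Equiv.Perm (Fin m)) : ℝ :=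
  ∑ i, A i (π i)

/-- Expectation with respect to the uniform distribution on permutations. -/
noncomputable def permExp (f : Equiv.Perm (Fin m) → ℝ) : ℝ :=
  (∑ π : Equiv.Perm (Fin m), f π) / (Nat.factorial m : ℝ)

/-- The standardized rank statistic `𝒯_A = (T_A − μ_A)/σ_A`. -/
noncomputable def rankTstd (A : Matrix (Fin m) (Fin m) ℝ) (π : Equiv.Perm (Fin m)) : ℝ :=
  (rankT A π - muM A) / sdev A

/-- `F_A`, the distribution function of `T_A`. -/
noncomputable def Fr (A : Matrix (Fin m) (Fin m) ℝ) (z : ℝ) : ℝ :=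
  permExp (fun π => if rankT A π ≤ z then (1 : ℝ) else 0)

/-- `ℱ_A`, the distribution function of `𝒯_A`. -/
noncomputable def Fstd (A : Matrix (Fin m) (Fin m) ℝ) (z : ℝ) : ℝ :=
  permExp (fun π => if rankTstd A π ≤ z then (1 : ℝ) else 0)

/-- `β_A = Σ_{i,j} |â_{ij}|³`. -/
noncomputable def betaM (A : Matrix (Fin m) (Fin m) ℝ) : ℝ := ∑ i, ∑ j, |hatM A i j| ^ 3

/-- `δ_A = Σ_{i,j} |â_{ij}|⁴`. -/
noncomputable def deltaM (A : Matrix (Fin m) (Fin m) ℝ) : ℝ := ∑ i, ∑ j, |hatM A i j| ^ 4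

/-- `η_A = Σ_{i,j} |â_{ij}|⁵`. -/
noncomputable def etaM (A : Matrix (Fin m) (Fin m) ℝ) : ℝ := ∑ i, ∑ j, |hatM A i j| ^ 5

/-- `D_A = (δ_A/n)^{1/2}`. -/
noncomputable def DM (A : Matrix (Fin m) (Fin m) ℝ) : ℝ := Real.sqrt (deltaM A / (m : ℝ))

/-- `E_A = (η_A/n)^{1/3}`. -/
noncomputable def EM (A : Matrix (Fin m) (Fin m) ℝ) : ℝ := (etaM A / (m : ℝ)) ^ ((1 : ℝ) / 3)

/-- `λ_{1,A} = (1/n)Σ_{i,j} â_{ij}³`. -/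
noncomputable def lam1 (A : Matrix (Fin m) (Fin m) ℝ) : ℝ := (∑ i, ∑ j, hatM A i j ^ 3) / (m : ℝ)

/-- `λ_{2,A}`. -/
noncomputable def lam2 (A : Matrix (Fin m) (Fin m) ℝ) : ℝ :=
  (∑ i, ∑ j, hatM A i j ^ 4) / (m : ℝ) + 3 / (m : ℝ)
    - 3 / (m : ℝ) ^ 2 *
        ∑ i, ∑ j, ∑ k, (hatM A i j ^ 2 * hatM A i k ^ 2 + hatM A i j ^ 2 * hatM A k j ^ 2)

/-- First-order Edgeworth expansion `e_{1,A}`. -/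
noncomputable def edge1 (A : Matrix (Fin m) (Fin m) ℝ) (x : ℝ) : ℝ :=
  gaussCDF x - gaussD x * (lam1 A / 6) * (x ^ 2 - 1)

/-- Second-order Edgeworth expansion `e_{2,A}`. -/
noncomputable def edge2 (A : Matrix (Fin m) (Fin m) ℝ) (x : ℝ) : ℝ :=
  gaussCDF x - gaussD x *
    (lam1 A / 6 * (x ^ 2 - 1) + lam2 A / 24 * (x ^ 3 - 3 * x)
      + lam1 A ^ 2 / 72 * (x ^ 5 - 10 * x ^ 3 + 15 * x))

/-- `k`-th iterated difference `Δ_y^k G`. -/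
noncomputable def Δiter (y : ℝ) (k : ℕ) (G : ℝ → ℝ) : ℝ → ℝ :=
  (fun (G : ℝ → ℝ) (z : ℝ) => G (z + y) - G z)^[k] G

/-- The interpolating polynomial `P_y^k(x; z, F)` of `F` at the points `z, z+y, …, z+ky`. -/
noncomputable def interp (y : ℝ) (k : ℕ) (z : ℝ) (F : ℝ → ℝ) (x : ℝ) : ℝ :=
  F z + ∑ s ∈ Finset.Icc 1 k,
    Δiter y s F z * ∏ i ∈ Finset.Icc 1 s, (x - z - ((i : ℝ) - 1) * y) / ((i : ℝ) * y)

end RankDefs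

section Part1

/-- The permutation built from an image of `p` and a permutation of the rest. -/
def RSglue {m : ℕ} (p q : Fin (m+1)) (σ : Equiv.Perm (Fin m)) : Equiv.Perm (Fin (m+1)) :=
  (finSuccEquiv' p).trans ((Equiv.optionCongr σ).trans (finSuccEquiv' q).symm)

lemma RSglue_self {m : ℕ} (p q : Fin (m+1)) (σ : Equiv.Perm (Fin m)) : RSglue p q σ p = q := by
  simp [RSglue]

lemma RSglue_succAbove {m : ℕ} (p q : Fin (m+1)) (σ : Equiv.Perm (Fin m)) (i : Fin m) :
    RSglue p q σ (p.succAbove i) = q.succAbove (σ i) := by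
  simp [RSglue]

lemma RSglue_bij {m : ℕ} (p : Fin (m+1)) :
    Function.Bijective (fun x : Fin (m+1) × Equiv.Perm (Fin m) => RSglue p x.1 x.2) := by
  rw [Fintype.bijective_iff_injective_and_card]
  constructor
  · rintro ⟨q, σ⟩ ⟨q', σ'⟩ h
    simp only at h
    have h1 : q = q' := by
      have := congrArg (fun e : Equiv.Perm (Fin (m+1)) => e p) h
      simpa [RSglue_self] using this
    subst h1
    have h2 : σ = σ' := by
      ext i
      have := congrArg (fun e : Equiv.Perm (Fin (m+1)) => e (p.succAbove i)) h
      simp only [RSglue_succAbove] at this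
      rw [Fin.succAbove_right_injective this]
    rw [h2]
  · simp [Fintype.card_perm, Nat.factorial_succ]

lemma RS_sum_row {m : ℕ} (M : Fin (m+1) → Fin (m+1) → ℝ) (g : Fin (m+1) → ℝ → ℝ) (p : Fin (m+1)) :
    ∑ π : Equiv.Perm (Fin (m+1)), g (π p) (∑ i, M i (π i))
      = ∑ q, ∑ σ : Equiv.Perm (Fin m),
          g q (M p q + ∑ i, M (p.succAbove i) (q.succAbove (σ i))) := by
  rw [← Fintype.sum_prod_type']
  rw [← (RSglue_bij p).sum_comp]
  refine Finset.sum_congr rfl fun x _ => ?_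
  rw [Fin.sum_univ_succAbove _ p]
  simp [RSglue_self, RSglue_succAbove]

lemma RS_sum_inv {m : ℕ} (M : Fin m → Fin m → ℝ) (f : ℝ → ℝ) :
    ∑ π : Equiv.Perm (Fin m), f (∑ i, M i (π i)) = ∑ π : Equiv.Perm (Fin m), f (∑ i, M (π i) i) := by
  rw [← Equiv.sum_comp (Equiv.inv (Equiv.Perm (Fin m)))]
  refine Finset.sum_congr rfl fun π _ => ?_
  congr 1
  rw [← Equiv.sum_comp π]
  simp

/-- Expectation of `φ (x - T)` over the submatrix with rows `ρ` and columns `γ`. -/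
noncomputable def GG {n m : ℕ} (a : Fin n → Fin n → ℝ) (φ : ℝ → ℝ) (ρ γ : Fin m → Fin n) (x : ℝ) : ℝ :=
  permExp (fun π : Equiv.Perm (Fin m) => φ (x - ∑ i, a (ρ i) (γ (π i))))

lemma GG_row {n m : ℕ} (a : Fin n → Fin n → ℝ) (φ : ℝ → ℝ) (ρ γ : Fin (m+1) → Fin n) (x : ℝ)
    (p : Fin (m+1)) :
    GG a φ ρ γ x = (∑ q, GG a φ (ρ ∘ p.succAbove) (γ ∘ q.succAbove) (x - a (ρ p) (γ q))) / (m+1) := by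
  unfold GG permExp
  rw [RS_sum_row (fun i j => a (ρ i) (γ j)) (fun _ t => φ (x - t)) p, ← Finset.sum_div, Nat.factorial_succ]
  push_cast
  rw [div_div, mul_comm]
  simp [sub_sub]

lemma GG_col {n m : ℕ} (a : Fin n → Fin n → ℝ) (φ : ℝ → ℝ) (ρ γ : Fin (m+1) → Fin n) (x : ℝ)
    (q : Fin (m+1)) :
    GG a φ ρ γ x = (∑ p, GG a φ (ρ ∘ p.succAbove) (γ ∘ q.succAbove) (x - a (ρ p) (γ q))) / (m+1) := by
  unfold GG permExp
  rw [RS_sum_inv (fun i j => a (ρ i) (γ j)) (fun t => φ (x - t)),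
    RS_sum_row (fun j i => a (ρ i) (γ j)) (fun _ t => φ (x - t)) q, ← Finset.sum_div, Nat.factorial_succ]
  push_cast
  rw [div_div, mul_comm]
  congr 1
  refine Finset.sum_congr rfl fun p _ => ?_
  have h := RS_sum_inv (fun i j => a (ρ (p.succAbove i)) (γ (q.succAbove j)))
    (fun t => φ (x - a (ρ p) (γ q) - t))
  simp only [sub_sub, Function.comp] at h ⊢
  exact h.symm

/-- Weighted version. -/
lemma GG_Tweighted {n : ℕ} (a : Fin (n+1) → Fin (n+1) → ℝ) (φ : ℝ → ℝ) (x : ℝ) :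
    permExp (fun π : Equiv.Perm (Fin (n+1)) => (∑ i, a i (π i)) * φ (x - ∑ i, a i (π i)))
     = (∑ p, ∑ q, a p q * GG a φ p.succAbove q.succAbove (x - a p q)) / (n+1) := by
  unfold GG permExp
  simp_rw [Finset.sum_mul]
  rw [Finset.sum_comm]
  have : ∀ p, ∑ π : Equiv.Perm (Fin (n+1)), a p (π p) * φ (x - ∑ i, a i (π i)) =
     ∑ q, ∑ σ : Equiv.Perm (Fin n),
          a p q * φ (x - (a p q + ∑ i, a (p.succAbove i) (q.succAbove (σ i)))) := fun p =>
    RS_sum_row a (fun q t => a p q * φ (x - t)) p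
  simp_rw [this, Nat.factorial_succ]
  push_cast
  simp_rw [sub_sub, mul_div_assoc', Finset.mul_sum, ← Finset.sum_div]
  rw [div_div, mul_comm]

/-- Double row/column expansion of `D` along row `p`, column `q`. -/
lemma GG_CI {n m : ℕ} (a : Fin n → Fin n → ℝ) (φ : ℝ → ℝ) (ρ γ : Fin (m+2) → Fin n) (x : ℝ)
    (p q : Fin (m+2)) :
    GG a φ ρ γ x = GG a φ (ρ ∘ p.succAbove) (γ ∘ q.succAbove) (x - a (ρ p) (γ q)) / (m+2)
      + (∑ i : Fin (m+1), ∑ c : Fin (m+1),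
          GG a φ (ρ ∘ p.succAbove ∘ i.succAbove) (γ ∘ q.succAbove ∘ c.succAbove)
            (x - a (ρ p) (γ (q.succAbove c)) - a (ρ (p.succAbove i)) (γ q))) / ((m+2) * (m+1)) := by
  rw [GG_row a φ ρ γ x p, Fin.sum_univ_succAbove _ q, add_div]
  push_cast
  have e2 : (m:ℝ) + 1 + 1 = m + 2 := by ring
  rw [e2]
  congr 1
  rw [Finset.sum_comm, mul_comm, ← div_div]
  congr 1
  rw [Finset.sum_div]
  refine Finset.sum_congr rfl fun c _ => ?_
  rw [GG_col a φ _ _ _ (c.predAbove q)]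
  congr 1
  refine Finset.sum_congr rfl fun i _ => ?_
  have h1 : (q.succAbove c).succAbove (c.predAbove q) = q := by
    exact Fin.succAbove_succAbove_predAbove q c
  have h2 : (γ ∘ (q.succAbove c).succAbove) ∘ (c.predAbove q).succAbove = γ ∘ q.succAbove ∘ c.succAbove := by
    funext k
    simp only [Function.comp]
    rw [Fin.succAbove_succAbove_succAbove_predAbove]
  rw [h2]
  simp only [Function.comp, h1]
  rfl

lemma GG_CI' {n m : ℕ} (a : Fin n → Fin n → ℝ) (φ : ℝ → ℝ) (ρ γ : Fin (m+1) → Fin n) (x : ℝ) :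
    GG a φ ρ γ x = (∑ i : Fin (m+1), ∑ c : Fin (m+1),
          GG a φ (ρ ∘ i.succAbove) (γ ∘ c.succAbove) (x - a (ρ i) (γ c))) / ((m+1) * (m+1)) := by
  have h : ∀ i : Fin (m+1), ∑ c : Fin (m+1),
          GG a φ (ρ ∘ i.succAbove) (γ ∘ c.succAbove) (x - a (ρ i) (γ c)) = (m+1) * GG a φ ρ γ x := by
    intro i
    rw [GG_row a φ ρ γ x i]
    field_simp
  rw [Finset.sum_congr rfl (fun i _ => h i)]
  have : (m:ℝ)+1 ≠ 0 := by positivity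
  simp
  field_simp

end Part1

section Part2

lemma GG_hasDerivAt {n m : ℕ} (a : Fin n → Fin n → ℝ) {φ φ' : ℝ → ℝ}
    (h : ∀ x, HasDerivAt φ (φ' x) x) (ρ γ : Fin m → Fin n) (x : ℝ) :
    HasDerivAt (GG a φ ρ γ) (GG a φ' ρ γ x) x := by
  unfold GG permExp
  apply HasDerivAt.div_const
  apply HasDerivAt.fun_sum
  intro π _
  exact (h _).comp_sub_const x _

/-- The step from order `k` to order `k+1` in Taylor estimates. -/
lemma RS_mv {h h' : ℝ → ℝ} (hd : ∀ s, HasDerivAt h (h' s) s) (h0 : h 0 = 0) {M : ℝ} (hM : 0 ≤ M) (k : ℕ)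
    (hb : ∀ s, |h' s| ≤ M * |s| ^ k) (y : ℝ) : |h y| ≤ M * |y| ^ (k+1) := by
  have hs : ∀ s ∈ Set.uIcc 0 y, |s| ≤ |y| := by
    intro s hs
    rcases le_total 0 y with h | h
    · rw [Set.uIcc_of_le h] at hs
      rw [abs_of_nonneg hs.1, abs_of_nonneg h]; exact hs.2
    · rw [Set.uIcc_of_ge h] at hs
      rw [abs_of_nonpos hs.2, abs_of_nonpos h]; linarith [hs.1]
  have := (convex_uIcc (0:ℝ) y).norm_image_sub_le_of_norm_hasDerivWithin_le
    (f := h) (f' := h') (C := M * |y| ^ k) (x := 0) (y := y)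
    (fun s _ => (hd s).hasDerivWithinAt)
    (fun s hs' => by
      rw [Real.norm_eq_abs]
      refine (hb s).trans ?_
      exact mul_le_mul_of_nonneg_left (pow_le_pow_left₀ (abs_nonneg _) (hs s hs') k) hM) Set.left_mem_uIcc Set.right_mem_uIcc
  simp only [h0, sub_zero, Real.norm_eq_abs] at this
  rw [pow_succ, ← mul_assoc]; exact this

section taylor
variable {g0 g1 g2 g3 g4 : ℝ → ℝ} {M : ℝ}

lemma RS_T1 (h0 : ∀ x, HasDerivAt g0 (g1 x) x) (hM : ∀ x, |g1 x| ≤ M) (x y : ℝ) :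
    |g0 (x - y) - g0 x| ≤ M * |y| := by
  have hM0 : 0 ≤ M := (abs_nonneg _).trans (hM 0)
  have := RS_mv (h := fun s => g0 (x - s) - g0 x) (h' := fun s => - g1 (x - s))
    (fun s => by simpa using ((h0 (x - s)).comp_const_sub x s).sub_const (g0 x)) (by simp) hM0 0
    (fun s => by simpa using hM _) y
  simpa using this

lemma RS_T2 (h0 : ∀ x, HasDerivAt g0 (g1 x) x) (h1 : ∀ x, HasDerivAt g1 (g2 x) x)
    (hM : ∀ x, |g2 x| ≤ M) (x y : ℝ) :
    |g0 (x - y) - g0 x + y * g1 x| ≤ M * |y| ^ 2 := by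
  have hM0 : 0 ≤ M := (abs_nonneg _).trans (hM 0)
  have := RS_mv (h := fun s => g0 (x - s) - g0 x + s * g1 x) (h' := fun s => - (g1 (x - s) - g1 x))
    (fun s => by
      refine ((((h0 (x - s)).comp_const_sub x s).sub_const (g0 x)).fun_add
        ((hasDerivAt_id' s).mul_const (g1 x))).congr_deriv ?_
      ring) (by simp) hM0 1
    (fun s => by rw [abs_neg, pow_one]; exact RS_T1 h1 hM x s) y
  simpa using this

lemma RS_T3 (h0 : ∀ x, HasDerivAt g0 (g1 x) x) (h1 : ∀ x, HasDerivAt g1 (g2 x) x)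
    (h2 : ∀ x, HasDerivAt g2 (g3 x) x)
    (hM : ∀ x, |g3 x| ≤ M) (x y : ℝ) :
    |g0 (x - y) - g0 x + y * g1 x - y ^ 2 / 2 * g2 x| ≤ M * |y| ^ 3 := by
  have hM0 : 0 ≤ M := (abs_nonneg _).trans (hM 0)
  have := RS_mv (h := fun s => g0 (x - s) - g0 x + s * g1 x - s ^ 2 / 2 * g2 x)
    (h' := fun s => - (g1 (x - s) - g1 x + s * g2 x))
    (fun s => by
      refine (((((h0 (x - s)).comp_const_sub x s).sub_const (g0 x)).fun_add
        ((hasDerivAt_id' s).mul_const (g1 x))).fun_sub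
        ((((hasDerivAt_id' s).fun_pow 2).div_const 2).mul_const (g2 x))).congr_deriv ?_
      simp
      ring) (by simp) hM0 2
    (fun s => by rw [abs_neg]; exact RS_T2 h1 h2 hM x s) y
  simpa using this

lemma RS_T4 (h0 : ∀ x, HasDerivAt g0 (g1 x) x) (h1 : ∀ x, HasDerivAt g1 (g2 x) x)
    (h2 : ∀ x, HasDerivAt g2 (g3 x) x) (h3 : ∀ x, HasDerivAt g3 (g4 x) x)
    (hM : ∀ x, |g4 x| ≤ M) (x y : ℝ) :
    |g0 (x - y) - g0 x + y * g1 x - y ^ 2 / 2 * g2 x + y ^ 3 / 6 * g3 x| ≤ M * |y| ^ 4 := by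
  have hM0 : 0 ≤ M := (abs_nonneg _).trans (hM 0)
  have := RS_mv (h := fun s => g0 (x - s) - g0 x + s * g1 x - s ^ 2 / 2 * g2 x + s ^ 3 / 6 * g3 x)
    (h' := fun s => - (g1 (x - s) - g1 x + s * g2 x - s ^ 2 / 2 * g3 x))
    (fun s => by
      refine ((((((h0 (x - s)).comp_const_sub x s).sub_const (g0 x)).fun_add
        ((hasDerivAt_id' s).mul_const (g1 x))).fun_sub
        ((((hasDerivAt_id' s).fun_pow 2).div_const 2).mul_const (g2 x))).fun_add
        ((((hasDerivAt_id' s).fun_pow 3).div_const 6).mul_const (g3 x))).congr_deriv ?_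
      simp
      ring) (by simp) hM0 3
    (fun s => by rw [abs_neg]; exact RS_T3 h1 h2 h3 hM x s) y
  simpa using this
end taylor

/-- sums along injective maps -/
lemma RS_sum_inj {n m : ℕ} {ρ : Fin m → Fin n} (hρ : Function.Injective ρ) {g : Fin n → ℝ}
    (hg : ∀ u, 0 ≤ g u) : ∑ i, g (ρ i) ≤ ∑ u, g u := by
  classical
  rw [← Finset.sum_image (s := Finset.univ) (g := ρ) (f := g) (fun x _ y _ h => hρ h)]
  exact Finset.sum_le_sum_of_subset_of_nonneg (Finset.subset_univ _) (fun u _ _ => hg u)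

lemma RS_sum_inj2 {n m : ℕ} {ρ γ : Fin m → Fin n} (hρ : Function.Injective ρ) (hγ : Function.Injective γ)
    {g : Fin n → Fin n → ℝ}
    (hg : ∀ u v, 0 ≤ g u v) : ∑ i, ∑ c, g (ρ i) (γ c) ≤ ∑ u, ∑ v, g u v := by
  refine le_trans (Finset.sum_le_sum fun i _ => RS_sum_inj hγ (fun v => hg (ρ i) v)) ?_
  exact RS_sum_inj (g := fun u => ∑ v, g u v) hρ (fun u => Finset.sum_nonneg fun v _ => hg u v)

/-- gauge of degree `t` -/
noncomputable def ep {n : ℕ} (b : Fin n → Fin n → ℝ) (t : ℕ) (p q : Fin n) : ℝ :=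
  (∑ u, ∑ v, (b p v ^ t + b u q ^ t + b u v ^ t + b p q ^ t)) / (n:ℝ) ^ 2

/-- total `t`-th power mean -/
noncomputable def Sm {n : ℕ} (b : Fin n → Fin n → ℝ) (t : ℕ) : ℝ := (∑ u, ∑ v, b u v ^ t) / (n:ℝ) ^ 2

lemma ep_eq {n : ℕ} (hn : 0 < n) (b : Fin n → Fin n → ℝ) (t : ℕ) (p q : Fin n) :
    ep b t p q = (∑ v, b p v ^ t) / n + (∑ u, b u q ^ t) / n + Sm b t + b p q ^ t := by
  have : (n:ℝ) ≠ 0 := by positivity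
  simp only [ep, Sm, Finset.sum_add_distrib, Finset.sum_const, Finset.card_univ, Fintype.card_fin, nsmul_eq_mul, ← Finset.mul_sum]
  field_simp

section gauge
variable {n : ℕ} {b : Fin n → Fin n → ℝ}

lemma Sm_nonneg (hb : ∀ i j, 0 ≤ b i j) (t : ℕ) : 0 ≤ Sm b t := by
  unfold Sm
  exact div_nonneg (Finset.sum_nonneg fun i _ => Finset.sum_nonneg fun j _ => pow_nonneg (hb i j) t) (by positivity)

lemma RS_rowm_nonneg (hb : ∀ i j, 0 ≤ b i j) (t : ℕ) (p : Fin n) : 0 ≤ (∑ v, b p v ^ t) / (n:ℝ) :=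
  div_nonneg (Finset.sum_nonneg fun j _ => pow_nonneg (hb p j) t) (by positivity)

lemma RS_colm_nonneg (hb : ∀ i j, 0 ≤ b i j) (t : ℕ) (q : Fin n) : 0 ≤ (∑ u, b u q ^ t) / (n:ℝ) :=
  div_nonneg (Finset.sum_nonneg fun j _ => pow_nonneg (hb j q) t) (by positivity)

lemma ep_nonneg (hb : ∀ i j, 0 ≤ b i j) (t : ℕ) (p q : Fin n) : 0 ≤ ep b t p q := by
  unfold ep
  refine div_nonneg (Finset.sum_nonneg fun i _ => Finset.sum_nonneg fun j _ => ?_) (by positivity)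
  have := pow_nonneg (hb p j) t
  have := pow_nonneg (hb i q) t
  have := pow_nonneg (hb i j) t
  have := pow_nonneg (hb p q) t
  positivity

lemma b_le_ep (hn : 0 < n) (hb : ∀ i j, 0 ≤ b i j) (t : ℕ) (p q : Fin n) : b p q ^ t ≤ ep b t p q := by
  rw [ep_eq hn]
  linarith [Sm_nonneg hb t, RS_rowm_nonneg hb t p, RS_colm_nonneg hb t q]

lemma pow_mul_pow_le {x y : ℝ} (hx : 0 ≤ x) (hy : 0 ≤ y) (s t : ℕ) :
    x ^ s * y ^ t ≤ x ^ (s+t) + y ^ (s+t) := by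
  rcases le_total x y with h | h
  · have : x ^ s * y ^ t ≤ y ^ s * y ^ t := by gcongr
    rw [← pow_add] at this
    linarith [pow_nonneg hx (s+t)]
  · have : x ^ s * y ^ t ≤ x ^ s * x ^ t := by gcongr
    rw [← pow_add] at this
    linarith [pow_nonneg hy (s+t)]

lemma RS_gauge_mul {ι : Type*} [Fintype ι] (w w' : ι → ℝ) (hw : ∀ z, 0 ≤ w z) (hw' : ∀ z, 0 ≤ w' z) (s t : ℕ) :
    (∑ z, w z ^ s) * (∑ z, w' z ^ t) ≤ (Fintype.card ι) * (∑ z, w z ^ (s+t) + ∑ z, w' z ^ (s+t)) := by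
  rw [Finset.sum_mul_sum]
  calc ∑ z, ∑ z', w z ^ s * w' z' ^ t ≤ ∑ z, ∑ z', (w z ^ (s+t) + w' z' ^ (s+t)) := by
        refine Finset.sum_le_sum fun z _ => Finset.sum_le_sum fun z' _ => ?_
        exact pow_mul_pow_le (hw z) (hw' z') s t
    _ = _ := by
        simp only [Finset.sum_add_distrib, Finset.sum_const, Finset.card_univ, nsmul_eq_mul, ← Finset.mul_sum]
        ring

lemma ep_repr (b : Fin n → Fin n → ℝ) (t : ℕ) (p q : Fin n) :
    ep b t p q = (∑ z : (Fin n × Fin n) × Fin 4,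
      (![b p z.1.2, b z.1.1 q, b z.1.1 z.1.2, b p q] z.2) ^ t) / (n:ℝ)^2 := by
  unfold ep
  congr 1
  rw [Fintype.sum_prod_type, Fintype.sum_prod_type]
  refine Finset.sum_congr rfl fun u _ => Finset.sum_congr rfl fun v _ => ?_
  simp [Fin.sum_univ_four]

lemma ep_mul (hn : 0 < n) (hb : ∀ i j, 0 ≤ b i j) (s t : ℕ) (p q p' q' : Fin n) :
    ep b s p q * ep b t p' q' ≤ 4 * (ep b (s+t) p q + ep b (s+t) p' q') := by
  have key : ∀ p q (z : (Fin n × Fin n) × Fin 4), 0 ≤ (![b p z.1.2, b z.1.1 q, b z.1.1 z.1.2, b p q] z.2) := by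
    intro p q z
    obtain ⟨⟨u, v⟩, k⟩ := z
    fin_cases k <;> simp [hb]
  have h := RS_gauge_mul _ _ (key p q) (key p' q') s t
  rw [ep_repr b s, ep_repr b t, ep_repr b (s+t), ep_repr b (s+t) p' q']
  have hn' : (0:ℝ) < n := by positivity
  rw [div_mul_div_comm, ← add_div, mul_div_assoc', div_le_div_iff₀ (by positivity) (by positivity)]
  simp only [Fintype.card_prod, Fintype.card_fin] at h
  push_cast at h
  have h2 := mul_le_mul_of_nonneg_right h (show (0:ℝ) ≤ (n:ℝ)^2 by positivity)
  refine h2.trans (le_of_eq ?_)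
  ring

/-- gauge with four indices -/
noncomputable def Zg (b : Fin n → Fin n → ℝ) (t : ℕ) (p q u v : Fin n) : ℝ :=
  ep b t p q + ep b t u v + ep b t p v + ep b t u q

lemma Zg_nonneg (hb : ∀ i j, 0 ≤ b i j) (t : ℕ) (p q u v : Fin n) : 0 ≤ Zg b t p q u v := by
  unfold Zg
  have := ep_nonneg hb t p q
  have := ep_nonneg hb t u v
  have := ep_nonneg hb t p v
  have := ep_nonneg hb t u q
  positivity

lemma Zg_mul (hn : 0 < n) (hb : ∀ i j, 0 ≤ b i j) (s t : ℕ) (p q u v : Fin n) :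
    Zg b s p q u v * Zg b t p q u v ≤ 32 * Zg b (s+t) p q u v := by
  unfold Zg
  have h1 := ep_mul hn hb s t
  have := h1 p q p q
  have := h1 p q u v
  have := h1 p q p v
  have := h1 p q u q
  have := h1 u v p q
  have := h1 u v u v
  have := h1 u v p v
  have := h1 u v u q
  have := h1 p v p q
  have := h1 p v u v
  have := h1 p v p v
  have := h1 p v u q
  have := h1 u q p q
  have := h1 u q u v
  have := h1 u q p v
  have := h1 u q u q
  nlinarith

lemma RS_avg_ep (hn : 0 < n) (b : Fin n → Fin n → ℝ) (t : ℕ) :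
    (∑ u, ∑ v, ep b t u v) = 4 * (n:ℝ)^2 * Sm b t := by
  have hn' : (n:ℝ) ≠ 0 := by positivity
  have h : (∑ u, ∑ v, b v u ^ t) = ∑ u, ∑ v, b u v ^ t := Finset.sum_comm
  simp_rw [ep_eq hn]
  simp only [Finset.sum_add_distrib, Finset.sum_const, Finset.card_univ, Fintype.card_fin, nsmul_eq_mul,
    ← Finset.sum_div, ← Finset.mul_sum, h, Sm]
  field_simp
  ring

lemma RS_avg_Zg (hn : 0 < n) (hb : ∀ i j, 0 ≤ b i j) (t : ℕ) (p q : Fin n) :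
    (∑ u, ∑ v, Zg b t p q u v) / (n:ℝ)^2 ≤ 9 * ep b t p q := by
  have hn' : (n:ℝ) ≠ 0 := by positivity
  have hn0 : (0:ℝ) < n := by positivity
  unfold Zg
  simp only [Finset.sum_add_distrib, RS_avg_ep hn]
  rw [div_le_iff₀ (by positivity)]
  have e1 : ∑ u : Fin n, ∑ v : Fin n, ep b t p q = (n:ℝ)^2 * ep b t p q := by
    simp; ring
  have e2 : ∑ u : Fin n, ∑ v : Fin n, ep b t p v = (n:ℝ)^2 * (2 * ((∑ v, b p v ^ t) / n) + 2 * Sm b t) := by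
    simp_rw [ep_eq hn]
    simp only [Finset.sum_add_distrib, Finset.sum_const, Finset.card_univ, Fintype.card_fin, nsmul_eq_mul, ← Finset.sum_div]
    rw [Finset.sum_comm (f := fun u v => b v u ^ t)]
    simp only [Sm]
    field_simp
    ring
  have e3 : ∑ u : Fin n, ∑ v : Fin n, ep b t u q = (n:ℝ)^2 * (2 * ((∑ u, b u q ^ t) / n) + 2 * Sm b t) := by
    simp_rw [ep_eq hn]
    simp only [Finset.sum_add_distrib, Finset.sum_const, Finset.card_univ, Fintype.card_fin, nsmul_eq_mul, ← Finset.sum_div, ← Finset.mul_sum]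
    simp only [Sm]
    field_simp
    ring
  rw [e1, e2, e3, ep_eq hn]
  have h1 := Sm_nonneg hb t
  have h2 := RS_rowm_nonneg hb t p
  have h3 := RS_colm_nonneg hb t q
  have h4 := pow_nonneg (hb p q) t
  have h5 : (0:ℝ) < (n:ℝ)^2 := by positivity
  nlinarith [mul_nonneg h5.le h1, mul_nonneg h5.le h2, mul_nonneg h5.le h3, mul_nonneg h5.le h4]

end gauge

end Part2

section Part3

/-- uniform bound on all submatrices with at most 16 deletions -/
def Bd {n : ℕ} (a : Fin n → Fin n → ℝ) (φ : ℝ → ℝ) (M : ℝ) : Prop :=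
  ∀ m : ℕ, n ≤ m + 16 → ∀ ρ γ : Fin m → Fin n, StrictMono ρ → StrictMono γ → ∀ x, |GG a φ ρ γ x| ≤ M

section diff
variable {n m : ℕ} {a b : Fin n → Fin n → ℝ}

/-- the difference identity -/
lemma GG_diff (a : Fin n → Fin n → ℝ) (φ : ℝ → ℝ) (ρ γ : Fin (m+2) → Fin n) (x : ℝ) (p q : Fin (m+2)) :
    GG a φ (ρ ∘ p.succAbove) (γ ∘ q.succAbove) x - GG a φ ρ γ x =
    (GG a φ (ρ ∘ p.succAbove) (γ ∘ q.succAbove) x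
      - GG a φ (ρ ∘ p.succAbove) (γ ∘ q.succAbove) (x - a (ρ p) (γ q))) / ((m:ℝ)+2)
    + (∑ i, ∑ c, (GG a φ (ρ ∘ p.succAbove ∘ i.succAbove) (γ ∘ q.succAbove ∘ c.succAbove)
        (x - a (ρ (p.succAbove i)) (γ (q.succAbove c)))
      - GG a φ (ρ ∘ p.succAbove ∘ i.succAbove) (γ ∘ q.succAbove ∘ c.succAbove)
        (x - (a (ρ p) (γ (q.succAbove c)) + a (ρ (p.succAbove i)) (γ q))))) / (((m:ℝ)+2)*((m:ℝ)+1)) := by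
  have h1 := GG_CI a φ ρ γ x p q
  have h2 := GG_CI' a φ (ρ ∘ p.succAbove) (γ ∘ q.succAbove) x
  simp only [Function.comp_assoc, Function.comp_apply] at h2
  simp only [Finset.sum_sub_distrib, sub_sub] at h1 ⊢
  rw [h1]
  generalize (∑ i, ∑ c, GG a φ (ρ ∘ p.succAbove ∘ i.succAbove) (γ ∘ q.succAbove ∘ c.succAbove)
        (x - a (ρ (p.succAbove i)) (γ (q.succAbove c)))) = S at *
  rw [h2]
  have : (m:ℝ) + 1 ≠ 0 := by positivity
  have : (m:ℝ) + 2 ≠ 0 := by positivity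
  field_simp
  ring

lemma RS_avg (hnm : n ≤ 2 * (m+1)) (hn : 0 < n) {ρ γ : Fin (m+2) → Fin n} (hρ : StrictMono ρ) (hγ : StrictMono γ)
    (hb : ∀ i j, 0 ≤ b i j) (t : ℕ) (p q : Fin (m+2)) :
    (∑ i, ∑ c, Zg b t (ρ p) (γ q) (ρ (p.succAbove i)) (γ (q.succAbove c))) / (((m:ℝ)+2)*((m:ℝ)+1)) ≤
      36 * ep b t (ρ p) (γ q) := by
  have h1 := RS_sum_inj2 (hρ.comp (Fin.strictMono_succAbove p)).injective
    (hγ.comp (Fin.strictMono_succAbove q)).injective (g := fun u v => Zg b t (ρ p) (γ q) u v)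
    (fun u v => Zg_nonneg hb t _ _ _ _)
  have h2 := RS_avg_Zg hn hb t (ρ p) (γ q)
  have hn' : (0:ℝ) < n := by positivity
  rw [div_le_iff₀ (by positivity)] at h2 ⊢
  refine h1.trans (h2.trans ?_)
  have h3 := ep_nonneg hb t (ρ p) (γ q)
  have h4 : (n:ℝ) ≤ 2 * (m+1) := by exact_mod_cast hnm
  have h5 : (n:ℝ)^2 ≤ 4 * (((m:ℝ)+2)*((m:ℝ)+1)) := by nlinarith
  nlinarith [mul_le_mul_of_nonneg_left h5 h3]

lemma RS_avg_bound (hnm : n ≤ 2 * (m+1)) (hn : 0 < n) {ρ γ : Fin (m+2) → Fin n} (hρ : StrictMono ρ) (hγ : StrictMono γ)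
    (hb : ∀ i j, 0 ≤ b i j) (t : ℕ) (p q : Fin (m+2)) {K : ℝ} (hK : 0 ≤ K) (f : Fin (m+1) → Fin (m+1) → ℝ)
    (hf : ∀ i c, |f i c| ≤ K * Zg b t (ρ p) (γ q) (ρ (p.succAbove i)) (γ (q.succAbove c))) :
    |(∑ i, ∑ c, f i c) / (((m:ℝ)+2)*((m:ℝ)+1))| ≤ K * (36 * ep b t (ρ p) (γ q)) := by
  have h := RS_avg hnm hn hρ hγ hb t p q
  rw [abs_div, abs_of_pos (show (0:ℝ) < ((m:ℝ)+2)*((m:ℝ)+1) by positivity)]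
  refine le_trans ?_ (mul_le_mul_of_nonneg_left h hK)
  rw [mul_div_assoc']
  gcongr
  rw [Finset.mul_sum]
  refine (Finset.abs_sum_le_sum_abs _ _).trans (Finset.sum_le_sum fun i _ => ?_)
  rw [Finset.mul_sum]
  refine (Finset.abs_sum_le_sum_abs _ _).trans (Finset.sum_le_sum fun c _ => hf i c)

lemma RS_small_Z (hn : 0 < n) (hb : ∀ i j, 0 ≤ b i j) (hab : ∀ i j, |a i j| ≤ b i j) (p q u v : Fin n) :
    |a u v| + |a p v| + |a u q| + |a p q| ≤ Zg b 1 p q u v := by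
  have h := fun p q => (hab p q).trans (by simpa using b_le_ep hn hb 1 p q)
  unfold Zg
  linarith [h u v, h p v, h u q, h p q]

lemma RS_master (hnm : n ≤ 2 * (m+1)) (hn : 0 < n) {ρ γ : Fin (m+2) → Fin n} (hρ : StrictMono ρ) (hγ : StrictMono γ)
    (hb : ∀ i j, 0 ≤ b i j) (t : ℕ) (p q : Fin (m+2)) {K : ℝ} (hK : 0 ≤ K) (φ : ℝ → ℝ) (x : ℝ)
    (v : ℝ) (f : Fin (m+1) → Fin (m+1) → ℝ)
    (hv : |GG a φ (ρ ∘ p.succAbove) (γ ∘ q.succAbove) x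
      - GG a φ (ρ ∘ p.succAbove) (γ ∘ q.succAbove) (x - a (ρ p) (γ q)) - v| ≤ K * ep b t (ρ p) (γ q))
    (hf : ∀ i c, |GG a φ (ρ ∘ p.succAbove ∘ i.succAbove) (γ ∘ q.succAbove ∘ c.succAbove)
        (x - a (ρ (p.succAbove i)) (γ (q.succAbove c)))
      - GG a φ (ρ ∘ p.succAbove ∘ i.succAbove) (γ ∘ q.succAbove ∘ c.succAbove)
        (x - (a (ρ p) (γ (q.succAbove c)) + a (ρ (p.succAbove i)) (γ q))) - f i c|
        ≤ K * Zg b t (ρ p) (γ q) (ρ (p.succAbove i)) (γ (q.succAbove c))) :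
    |GG a φ (ρ ∘ p.succAbove) (γ ∘ q.succAbove) x - GG a φ ρ γ x
      - (v / ((m:ℝ)+2) + (∑ i, ∑ c, f i c) / (((m:ℝ)+2)*((m:ℝ)+1)))| ≤ K * (37 * ep b t (ρ p) (γ q)) := by
  have h := RS_avg_bound hnm hn hρ hγ hb t p q hK _ hf
  rw [GG_diff a φ ρ γ x p q]
  simp only [Finset.sum_sub_distrib] at h ⊢
  have e2 : |(GG a φ (ρ ∘ p.succAbove) (γ ∘ q.succAbove) x
      - GG a φ (ρ ∘ p.succAbove) (γ ∘ q.succAbove) (x - a (ρ p) (γ q)) - v) / ((m:ℝ)+2)| ≤ K * ep b t (ρ p) (γ q) := by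
    rw [abs_div, abs_of_pos (show (0:ℝ) < (m:ℝ)+2 by positivity)]
    exact (div_le_self (abs_nonneg _) (by linarith [show (0:ℝ) ≤ m by positivity])).trans hv
  refine (le_of_eq ?_).trans ((abs_add_le _ _).trans ((add_le_add e2 h).trans (le_of_eq (by ring))))
  congr 1
  ring

lemma L1 (hn : 100 ≤ n) (hb : ∀ i j, 0 ≤ b i j) (hab : ∀ i j, |a i j| ≤ b i j) (hm : n ≤ m + 16)
    {φ0 φ1 : ℝ → ℝ} (h0 : ∀ x, HasDerivAt φ0 (φ1 x) x) {M : ℝ} (hM : Bd a φ1 M)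
    {ρ γ : Fin (m+2) → Fin n} (hρ : StrictMono ρ) (hγ : StrictMono γ) (p q : Fin (m+2)) (x : ℝ) :
    |GG a φ0 (ρ ∘ p.succAbove) (γ ∘ q.succAbove) x - GG a φ0 ρ γ x| ≤ M * (37 * ep b 1 (ρ p) (γ q)) := by
  have hn0 : 0 < n := by omega
  have hM0 : 0 ≤ M := (abs_nonneg _).trans (hM (m+2) (by omega) ρ γ hρ hγ 0)
  have hB := hM (m+1) (by omega) _ _ (hρ.comp (Fin.strictMono_succAbove p)) (hγ.comp (Fin.strictMono_succAbove q))
  have hC := fun i c => hM m hm _ _ (hρ.comp ((Fin.strictMono_succAbove p).comp (Fin.strictMono_succAbove i)))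
    (hγ.comp ((Fin.strictMono_succAbove q).comp (Fin.strictMono_succAbove c)))
  have := RS_master (a := a) (b := b) (by omega) hn0 hρ hγ hb 1 p q hM0 φ0 x 0 (fun _ _ => 0) (by
    have e1 := RS_T1 (GG_hasDerivAt a h0 _ _) hB x (a (ρ p) (γ q))
    rw [abs_sub_comm] at e1
    rw [sub_zero]
    refine e1.trans ?_
    gcongr
    exact (hab _ _).trans (by simpa using b_le_ep hn0 hb 1 (ρ p) (γ q))) (by
    intro i c
    rw [sub_zero]
    have t1 := RS_T1 (GG_hasDerivAt a h0 _ _) (hC i c) x (a (ρ (p.succAbove i)) (γ (q.succAbove c)))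
    have t2 := RS_T1 (GG_hasDerivAt a h0 _ _) (hC i c) x (a (ρ p) (γ (q.succAbove c)) + a (ρ (p.succAbove i)) (γ q))
    have t3 := RS_small_Z hn0 hb hab (ρ p) (γ q) (ρ (p.succAbove i)) (γ (q.succAbove c))
    have t4 := abs_add_le (a (ρ p) (γ (q.succAbove c))) (a (ρ (p.succAbove i)) (γ q))
    refine le_trans ?_ (mul_le_mul_of_nonneg_left t3 hM0)
    refine (abs_sub_le _ (GG a φ0 (ρ ∘ p.succAbove ∘ i.succAbove) (γ ∘ q.succAbove ∘ c.succAbove) x) _).trans ?_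
    rw [abs_sub_comm (GG a φ0 (ρ ∘ p.succAbove ∘ i.succAbove) (γ ∘ q.succAbove ∘ c.succAbove) x)]
    have t5 := mul_le_mul_of_nonneg_left t4 hM0
    have t6 := mul_nonneg hM0 (abs_nonneg (a (ρ p) (γ q)))
    linarith)
  simpa using this

/-- first-order coefficient -/
noncomputable def kap (a : Fin n → Fin n → ℝ) (ρ γ : Fin (m+2) → Fin n) (p q : Fin (m+2)) : ℝ :=
  a (ρ p) (γ q) / ((m:ℝ)+2) + (∑ i, ∑ c, -(a (ρ (p.succAbove i)) (γ (q.succAbove c))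
    - (a (ρ p) (γ (q.succAbove c)) + a (ρ (p.succAbove i)) (γ q)))) / (((m:ℝ)+2)*((m:ℝ)+1))

/-- second-order coefficient -/
noncomputable def bet (a : Fin n → Fin n → ℝ) (ρ γ : Fin (m+2) → Fin n) (p q : Fin (m+2)) : ℝ :=
  -(a (ρ p) (γ q)^2/2) / ((m:ℝ)+2) + (∑ i, ∑ c, (a (ρ (p.succAbove i)) (γ (q.succAbove c)) ^ 2
    - (a (ρ p) (γ (q.succAbove c)) + a (ρ (p.succAbove i)) (γ q))^2)/2) / (((m:ℝ)+2)*((m:ℝ)+1))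

lemma kap_eq (a : Fin n → Fin n → ℝ) (ρ γ : Fin (m+2) → Fin n) (p q : Fin (m+2)) :
    kap a ρ γ p q = (∑ i, ∑ c, a (ρ i) (γ c)) / ((m:ℝ)+2)
      - (∑ i, ∑ c, a (ρ (p.succAbove i)) (γ (q.succAbove c))) / ((m:ℝ)+1) := by
  unfold kap
  rw [Fin.sum_univ_succAbove _ p]
  simp_rw [Fin.sum_univ_succAbove _ q]
  simp only [Finset.sum_add_distrib, Finset.sum_neg_distrib, Finset.sum_sub_distrib, Finset.sum_const,
    Finset.card_univ, Fintype.card_fin, nsmul_eq_mul, ← Finset.mul_sum]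
  have : (m:ℝ) + 1 ≠ 0 := by positivity
  have : (m:ℝ) + 2 ≠ 0 := by positivity
  push_cast
  field_simp
  ring

lemma L2 (hn : 100 ≤ n) (hb : ∀ i j, 0 ≤ b i j) (hab : ∀ i j, |a i j| ≤ b i j) (hm : n ≤ m + 16)
    {φ0 φ1 φ2 : ℝ → ℝ} (h0 : ∀ x, HasDerivAt φ0 (φ1 x) x) (h1 : ∀ x, HasDerivAt φ1 (φ2 x) x)
    {M : ℝ} (hM : Bd a φ2 M)
    {ρ γ : Fin (m+2) → Fin n} (hρ : StrictMono ρ) (hγ : StrictMono γ) (hm' : n + 1 ≤ m + 16)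
    (p q : Fin (m+2)) (x : ℝ) :
    |GG a φ0 (ρ ∘ p.succAbove) (γ ∘ q.succAbove) x - GG a φ0 ρ γ x - kap a ρ γ p q * GG a φ1 ρ γ x|
      ≤ M * (10^5 * ep b 2 (ρ p) (γ q)) := by
  have hn0 : 0 < n := by omega
  have hM0 : 0 ≤ M := (abs_nonneg _).trans (hM (m+2) (by omega) ρ γ hρ hγ 0)
  have hB := hM (m+1) (by omega) _ _ (hρ.comp (Fin.strictMono_succAbove p)) (hγ.comp (Fin.strictMono_succAbove q))
  have hC := fun i c => hM m hm _ _ (hρ.comp ((Fin.strictMono_succAbove p).comp (Fin.strictMono_succAbove i)))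
    (hγ.comp ((Fin.strictMono_succAbove q).comp (Fin.strictMono_succAbove c)))
  have hBD := L1 hn hb hab hm h1 hM hρ hγ p q x
  have hepq := ep_nonneg hb 1 (ρ p) (γ q)
  have hapq : |a (ρ p) (γ q)| ≤ ep b 1 (ρ p) (γ q) :=
    (hab _ _).trans (by simpa using b_le_ep hn0 hb 1 (ρ p) (γ q))
  have := RS_master (a := a) (b := b) (K := 2000 * M) (by omega) hn0 hρ hγ hb 2 p q (by positivity) φ0 x
    (a (ρ p) (γ q) * GG a φ1 ρ γ x)
    (fun i c => -(a (ρ (p.succAbove i)) (γ (q.succAbove c))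
    - (a (ρ p) (γ (q.succAbove c)) + a (ρ (p.succAbove i)) (γ q))) * GG a φ1 ρ γ x) (by
    have e1 := RS_T2 (GG_hasDerivAt a h0 _ _) (GG_hasDerivAt a h1 _ _) hB x (a (ρ p) (γ q))
    have e2 := ep_mul hn0 hb 1 1 (ρ p) (γ q) (ρ p) (γ q)
    have e3 : |a (ρ p) (γ q)| ^ 2 ≤ ep b 1 (ρ p) (γ q) * ep b 1 (ρ p) (γ q) := by
      rw [sq]; gcongr
    have e4 : |a (ρ p) (γ q) * (GG a φ1 (ρ ∘ p.succAbove) (γ ∘ q.succAbove) x - GG a φ1 ρ γ x)| ≤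
       ep b 1 (ρ p) (γ q) * (M * (37 * ep b 1 (ρ p) (γ q))) := by
      rw [abs_mul]; gcongr
    have e5 := mul_le_mul_of_nonneg_left e3 hM0
    have e6 := mul_le_mul_of_nonneg_left e2 hM0
    have e7 := ep_nonneg hb 2 (ρ p) (γ q)
    have e8 := mul_nonneg hM0 e7
    norm_num at e6
    rw [abs_le] at *
    constructor <;> nlinarith) (by
    intro i c
    set d1 := a (ρ (p.succAbove i)) (γ (q.succAbove c)) with hd1
    set s := (a (ρ p) (γ (q.succAbove c)) + a (ρ (p.succAbove i)) (γ q)) with hs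
    have t1 := RS_T2 (GG_hasDerivAt a h0 _ _) (GG_hasDerivAt a h1 _ _) (hC i c) x d1
    have t2 := RS_T2 (GG_hasDerivAt a h0 _ _) (GG_hasDerivAt a h1 _ _) (hC i c) x s
    have t3 := RS_small_Z hn0 hb hab (ρ p) (γ q) (ρ (p.succAbove i)) (γ (q.succAbove c))
    have t4 := abs_add_le (a (ρ p) (γ (q.succAbove c))) (a (ρ (p.succAbove i)) (γ q))
    rw [← hs] at t4
    rw [← hd1] at t3
    have t5 := Zg_mul hn0 hb 1 1 (ρ p) (γ q) (ρ (p.succAbove i)) (γ (q.succAbove c))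
    have hCB : |GG a φ1 (ρ ∘ p.succAbove ∘ i.succAbove) (γ ∘ q.succAbove ∘ c.succAbove) x
        - GG a φ1 (ρ ∘ p.succAbove) (γ ∘ q.succAbove) x| ≤ M * (37 * ep b 1 (ρ (p.succAbove i)) (γ (q.succAbove c))) := by
      obtain ⟨m, rfl⟩ : ∃ k, m = k + 1 := ⟨m - 1, by omega⟩
      exact L1 hn hb hab (m := m) (by omega) h1 hM (hρ.comp (Fin.strictMono_succAbove p))
        (hγ.comp (Fin.strictMono_succAbove q)) i c x
    have hZ1 : ep b 1 (ρ p) (γ q) + ep b 1 (ρ (p.succAbove i)) (γ (q.succAbove c)) ≤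
        Zg b 1 (ρ p) (γ q) (ρ (p.succAbove i)) (γ (q.succAbove c)) := by
      unfold Zg
      linarith [ep_nonneg hb 1 (ρ p) (γ (q.succAbove c)), ep_nonneg hb 1 (ρ (p.succAbove i)) (γ q)]
    set Z := Zg b 1 (ρ p) (γ q) (ρ (p.succAbove i)) (γ (q.succAbove c))
    have hd : |d1| ≤ Z := by linarith [abs_nonneg (a (ρ p) (γ q)), abs_nonneg (a (ρ p) (γ (q.succAbove c))), abs_nonneg (a (ρ (p.succAbove i)) (γ q))]
    have hss : |s| ≤ Z := by linarith [abs_nonneg (a (ρ p) (γ q)), abs_nonneg d1]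
    have hds : |-(d1 - s)| ≤ Z := by
      rw [abs_neg]
      linarith [abs_nonneg (a (ρ p) (γ q)), abs_sub d1 s]
    have hCD : |GG a φ1 (ρ ∘ p.succAbove ∘ i.succAbove) (γ ∘ q.succAbove ∘ c.succAbove) x
        - GG a φ1 ρ γ x| ≤ M * (37 * Z) := by
      refine (abs_sub_le _ _ _).trans ((add_le_add hCB hBD).trans ?_)
      nlinarith
    have hZ0 : 0 ≤ Z := (abs_nonneg _).trans hd
    have e4 : |-(d1 - s) * (GG a φ1 (ρ ∘ p.succAbove ∘ i.succAbove) (γ ∘ q.succAbove ∘ c.succAbove) x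
        - GG a φ1 ρ γ x)| ≤ Z * (M * (37 * Z)) := by
      rw [abs_mul]; gcongr
    have e5 : M * |d1|^2 ≤ M * (Z * Z) := by rw [← sq]; gcongr
    have e5' : M * |s|^2 ≤ M * (Z * Z) := by rw [← sq]; gcongr
    have e6 := mul_le_mul_of_nonneg_left t5 hM0
    have e8 := mul_nonneg hM0 (Zg_nonneg hb 2 (ρ p) (γ q) (ρ (p.succAbove i)) (γ (q.succAbove c)))
    norm_num at e6
    clear hBD hCB hCD t3 t4
    rw [abs_le] at e4 t1 t2 ⊢
    constructor <;> nlinarith)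
  have hk : a (ρ p) (γ q) * GG a φ1 ρ γ x / ((m:ℝ)+2) + (∑ i, ∑ c, -(a (ρ (p.succAbove i)) (γ (q.succAbove c))
    - (a (ρ p) (γ (q.succAbove c)) + a (ρ (p.succAbove i)) (γ q))) * GG a φ1 ρ γ x)/ (((m:ℝ)+2)*((m:ℝ)+1)) =
      kap a ρ γ p q * GG a φ1 ρ γ x := by
    unfold kap
    simp only [← Finset.sum_mul]
    ring
  rw [hk] at this
  refine this.trans ?_
  nlinarith [mul_nonneg hM0 (ep_nonneg hb 2 (ρ p) (γ q))]

/-- uniform bound on normalized sums -/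
def TauB {n : ℕ} (a : Fin n → Fin n → ℝ) (τ : ℝ) : Prop :=
  ∀ m : ℕ, n ≤ m + 16 → ∀ ρ γ : Fin m → Fin n, StrictMono ρ → StrictMono γ →
    |(∑ i, ∑ c, a (ρ i) (γ c)) / (m:ℝ)| ≤ τ

lemma kap_le {τ : ℝ} (hτ : TauB a τ) (hm : n ≤ m + 16) {ρ γ : Fin (m+2) → Fin n} (hρ : StrictMono ρ) (hγ : StrictMono γ)
    (p q : Fin (m+2)) : |kap a ρ γ p q| ≤ 2 * τ := by
  rw [kap_eq]
  have h1 := hτ (m+2) (by omega) ρ γ hρ hγ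
  have h2 := hτ (m+1) (by omega) _ _ (hρ.comp (Fin.strictMono_succAbove p)) (hγ.comp (Fin.strictMono_succAbove q))
  push_cast at h1 h2
  refine (abs_sub _ _).trans ?_
  simp only [Function.comp_apply] at h2
  linarith

set_option maxHeartbeats 1000000 in
lemma L3 (hn : 100 ≤ n) (hb : ∀ i j, 0 ≤ b i j) (hab : ∀ i j, |a i j| ≤ b i j) (hm : n + 2 ≤ m + 16)
    {φ0 φ1 φ2 φ3 : ℝ → ℝ} (h0 : ∀ x, HasDerivAt φ0 (φ1 x) x) (h1 : ∀ x, HasDerivAt φ1 (φ2 x) x)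
    (h2 : ∀ x, HasDerivAt φ2 (φ3 x) x) {τ : ℝ} (hτ : TauB a τ)
    {M2 M : ℝ} (hM2 : Bd a φ2 M2) (hM : Bd a φ3 M)
    {ρ γ : Fin (m+2) → Fin n} (hρ : StrictMono ρ) (hγ : StrictMono γ)
    (p q : Fin (m+2)) (x : ℝ) :
    |GG a φ0 (ρ ∘ p.succAbove) (γ ∘ q.succAbove) x - GG a φ0 ρ γ x - kap a ρ γ p q * GG a φ1 ρ γ x
      - bet a ρ γ p q * GG a φ2 ρ γ x|
      ≤ 10^9 * (M * ep b 3 (ρ p) (γ q) + τ * M2 * ep b 1 (ρ p) (γ q)) := by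
  have hn0 : 0 < n := by omega
  have hM0 : 0 ≤ M := (abs_nonneg _).trans (hM (m+2) (by omega) ρ γ hρ hγ 0)
  have hM20 : 0 ≤ M2 := (abs_nonneg _).trans (hM2 (m+2) (by omega) ρ γ hρ hγ 0)
  have hτ0 : 0 ≤ τ := (abs_nonneg _).trans (hτ (m+2) (by omega) ρ γ hρ hγ)
  have hρB := hρ.comp (Fin.strictMono_succAbove p)
  have hγB := hγ.comp (Fin.strictMono_succAbove q)
  have hB := hM (m+1) (by omega) _ _ (hρ.comp (Fin.strictMono_succAbove p)) (hγ.comp (Fin.strictMono_succAbove q))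
  have hB2 := hM2 (m+1) (by omega) _ _ (hρ.comp (Fin.strictMono_succAbove p)) (hγ.comp (Fin.strictMono_succAbove q)) x
  have hD2 := hM2 (m+2) (by omega) _ _ hρ hγ x
  have hC := fun i c => hM m (by omega) _ _ (hρ.comp ((Fin.strictMono_succAbove p).comp (Fin.strictMono_succAbove i)))
    (hγ.comp ((Fin.strictMono_succAbove q).comp (Fin.strictMono_succAbove c)))
  have hBD2 := L1 hn hb hab (by omega) h2 hM hρ hγ p q x
  have hBD1' := L2 hn hb hab (by omega) h1 h2 hM hρ hγ (by omega) p q x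
  have hκ := kap_le hτ (by omega) hρ hγ p q
  have hBD1 : |GG a φ1 (ρ ∘ p.succAbove) (γ ∘ q.succAbove) x - GG a φ1 ρ γ x| ≤
      2 * τ * M2 + M * (10^5 * ep b 2 (ρ p) (γ q)) := by
    have : |kap a ρ γ p q * GG a φ2 ρ γ x| ≤ 2 * τ * M2 := by rw [abs_mul]; gcongr
    rw [abs_le] at *
    constructor <;> linarith
  have hepq := ep_nonneg hb 1 (ρ p) (γ q)
  have hapq : |a (ρ p) (γ q)| ≤ ep b 1 (ρ p) (γ q) :=
    (hab _ _).trans (by simpa using b_le_ep hn0 hb 1 (ρ p) (γ q))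
  -- combined gauge
  obtain ⟨K, hK⟩ : ∃ K : ℝ, K = 10 ^ 7 := ⟨_, rfl⟩
  -- the two error types are treated separately
  have key : ∀ i c, |GG a φ0 (ρ ∘ p.succAbove ∘ i.succAbove) (γ ∘ q.succAbove ∘ c.succAbove)
        (x - a (ρ (p.succAbove i)) (γ (q.succAbove c)))
      - GG a φ0 (ρ ∘ p.succAbove ∘ i.succAbove) (γ ∘ q.succAbove ∘ c.succAbove)
        (x - (a (ρ p) (γ (q.succAbove c)) + a (ρ (p.succAbove i)) (γ q))) -
        (-(a (ρ (p.succAbove i)) (γ (q.succAbove c))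
    - (a (ρ p) (γ (q.succAbove c)) + a (ρ (p.succAbove i)) (γ q))) * GG a φ1 ρ γ x
      + (a (ρ (p.succAbove i)) (γ (q.succAbove c)) ^ 2
    - (a (ρ p) (γ (q.succAbove c)) + a (ρ (p.succAbove i)) (γ q))^2)/2 * GG a φ2 ρ γ x)|
      ≤ 10^7 * M * Zg b 3 (ρ p) (γ q) (ρ (p.succAbove i)) (γ (q.succAbove c))
        + 4 * τ * M2 * Zg b 1 (ρ p) (γ q) (ρ (p.succAbove i)) (γ (q.succAbove c)) := by
    intro i c
    set d1 := a (ρ (p.succAbove i)) (γ (q.succAbove c)) with hd1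
    set s := (a (ρ p) (γ (q.succAbove c)) + a (ρ (p.succAbove i)) (γ q)) with hs
    have t1 := RS_T3 (GG_hasDerivAt a h0 _ _) (GG_hasDerivAt a h1 _ _) (GG_hasDerivAt a h2 _ _) (hC i c) x d1
    have t2 := RS_T3 (GG_hasDerivAt a h0 _ _) (GG_hasDerivAt a h1 _ _) (GG_hasDerivAt a h2 _ _) (hC i c) x s
    have t3 := RS_small_Z hn0 hb hab (ρ p) (γ q) (ρ (p.succAbove i)) (γ (q.succAbove c))
    have t4 := abs_add_le (a (ρ p) (γ (q.succAbove c))) (a (ρ (p.succAbove i)) (γ q))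
    rw [← hs] at t4
    rw [← hd1] at t3
    have t5 := Zg_mul hn0 hb 1 1 (ρ p) (γ q) (ρ (p.succAbove i)) (γ (q.succAbove c))
    have t6 := Zg_mul hn0 hb 1 2 (ρ p) (γ q) (ρ (p.succAbove i)) (γ (q.succAbove c))
    have hCB2 : |GG a φ2 (ρ ∘ p.succAbove ∘ i.succAbove) (γ ∘ q.succAbove ∘ c.succAbove) x
        - GG a φ2 (ρ ∘ p.succAbove) (γ ∘ q.succAbove) x| ≤ M * (37 * ep b 1 (ρ (p.succAbove i)) (γ (q.succAbove c))) := by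
      obtain ⟨m, rfl⟩ : ∃ k, m = k + 1 := ⟨m - 1, by omega⟩
      exact L1 hn hb hab (m := m) (by omega) h2 hM hρB hγB i c x
    have hCB1 : |GG a φ1 (ρ ∘ p.succAbove ∘ i.succAbove) (γ ∘ q.succAbove ∘ c.succAbove) x
        - GG a φ1 (ρ ∘ p.succAbove) (γ ∘ q.succAbove) x| ≤
        2 * τ * M2 + M * (10^5 * ep b 2 (ρ (p.succAbove i)) (γ (q.succAbove c))) := by
      obtain ⟨m, rfl⟩ : ∃ k, m = k + 1 := ⟨m - 1, by omega⟩
      have h3 := L2 hn hb hab (m := m) (by omega) h1 h2 hM hρB hγB (by omega) i c x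
      have h4 := kap_le hτ (m := m) (by omega) hρB hγB i c
      have h5 : |kap a (ρ ∘ p.succAbove) (γ ∘ q.succAbove) i c * GG a φ2 (ρ ∘ p.succAbove) (γ ∘ q.succAbove) x| ≤ 2 * τ * M2 := by
        rw [abs_mul]; gcongr
      simp only [Function.comp_assoc, Function.comp_apply] at h3
      clear hBD2 hBD1' hκ hBD1 t1 t2 t3 t4 hB2 hD2
      rw [abs_le] at *
      constructor <;> linarith
    have hZ1 : ep b 1 (ρ p) (γ q) + ep b 1 (ρ (p.succAbove i)) (γ (q.succAbove c)) ≤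
        Zg b 1 (ρ p) (γ q) (ρ (p.succAbove i)) (γ (q.succAbove c)) := by
      unfold Zg
      linarith [ep_nonneg hb 1 (ρ p) (γ (q.succAbove c)), ep_nonneg hb 1 (ρ (p.succAbove i)) (γ q)]
    have hZ2 : ep b 2 (ρ p) (γ q) + ep b 2 (ρ (p.succAbove i)) (γ (q.succAbove c)) ≤
        Zg b 2 (ρ p) (γ q) (ρ (p.succAbove i)) (γ (q.succAbove c)) := by
      unfold Zg
      linarith [ep_nonneg hb 2 (ρ p) (γ (q.succAbove c)), ep_nonneg hb 2 (ρ (p.succAbove i)) (γ q)]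
    have hZ30 := Zg_nonneg hb 3 (ρ p) (γ q) (ρ (p.succAbove i)) (γ (q.succAbove c))
    have hZ20 := Zg_nonneg hb 2 (ρ p) (γ q) (ρ (p.succAbove i)) (γ (q.succAbove c))
    norm_num at t5 t6
    set Z := Zg b 1 (ρ p) (γ q) (ρ (p.succAbove i)) (γ (q.succAbove c))
    set Z2 := Zg b 2 (ρ p) (γ q) (ρ (p.succAbove i)) (γ (q.succAbove c))
    set Z3 := Zg b 3 (ρ p) (γ q) (ρ (p.succAbove i)) (γ (q.succAbove c))
    have hd : |d1| ≤ Z := by linarith [abs_nonneg (a (ρ p) (γ q)), abs_nonneg (a (ρ p) (γ (q.succAbove c))), abs_nonneg (a (ρ (p.succAbove i)) (γ q))]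
    have hss : |s| ≤ Z := by linarith [abs_nonneg (a (ρ p) (γ q)), abs_nonneg d1]
    have hds : |-(d1 - s)| ≤ Z := by
      rw [abs_neg]
      linarith [abs_nonneg (a (ρ p) (γ q)), abs_sub d1 s]
    have hZ0 : 0 ≤ Z := (abs_nonneg _).trans hd
    have hCD2 : |GG a φ2 (ρ ∘ p.succAbove ∘ i.succAbove) (γ ∘ q.succAbove ∘ c.succAbove) x
        - GG a φ2 ρ γ x| ≤ M * (37 * Z) := by
      refine (abs_sub_le _ _ _).trans ((add_le_add hCB2 hBD2).trans ?_)
      nlinarith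
    have hCD1 : |GG a φ1 (ρ ∘ p.succAbove ∘ i.succAbove) (γ ∘ q.succAbove ∘ c.succAbove) x
        - GG a φ1 ρ γ x| ≤ 4 * τ * M2 + M * (10^5 * Z2) := by
      refine (abs_sub_le _ _ _).trans ((add_le_add hCB1 hBD1).trans ?_)
      nlinarith
    have e4 : |-(d1 - s) * (GG a φ1 (ρ ∘ p.succAbove ∘ i.succAbove) (γ ∘ q.succAbove ∘ c.succAbove) x
        - GG a φ1 ρ γ x)| ≤ Z * (4 * τ * M2 + M * (10^5 * Z2)) := by
      rw [abs_mul]; gcongr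
    have e4' : |(d1^2 - s^2)/2 * (GG a φ2 (ρ ∘ p.succAbove ∘ i.succAbove) (γ ∘ q.succAbove ∘ c.succAbove) x
        - GG a φ2 ρ γ x)| ≤ (Z*Z) * (M * (37 * Z)) := by
      rw [abs_mul]
      have : |(d1^2 - s^2)/2| ≤ Z * Z := by
        have f1 : d1^2 ≤ Z*Z := by rw [← sq_abs, ← sq]; gcongr
        have f2 : s^2 ≤ Z*Z := by rw [← sq_abs, ← sq]; gcongr
        rw [abs_le]; constructor <;> nlinarith [sq_nonneg d1, sq_nonneg s]
      gcongr
    have e5 : M * |d1|^3 ≤ M * (Z * (Z * Z)) := by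
      rw [show Z * (Z*Z) = Z^3 by ring]; gcongr
    have e5' : M * |s|^3 ≤ M * (Z * (Z * Z)) := by
      rw [show Z * (Z*Z) = Z^3 by ring]; gcongr
    have e6 : M * (Z * (Z * Z)) ≤ 1024 * (M * Z3) := by
      have : Z * (Z * Z) ≤ 1024 * Z3 := by linarith [mul_le_mul_of_nonneg_left t5 hZ0]
      linarith [mul_le_mul_of_nonneg_left this hM0]
    have e7 : M * (Z * Z2) ≤ 32 * (M * Z3) := by linarith [mul_le_mul_of_nonneg_left t6 hM0]
    have e8 := mul_nonneg hM0 hZ30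
    have e9 : |GG a φ0 (ρ ∘ p.succAbove ∘ i.succAbove) (γ ∘ q.succAbove ∘ c.succAbove) (x - d1)
      - GG a φ0 (ρ ∘ p.succAbove ∘ i.succAbove) (γ ∘ q.succAbove ∘ c.succAbove) (x - s) -
        (-(d1 - s) * GG a φ1 ρ γ x + (d1 ^ 2 - s^2)/2 * GG a φ2 ρ γ x)| ≤
        Z * (4 * τ * M2 + M * (10^5 * Z2)) + (Z*Z) * (M * (37 * Z)) + M * (Z * (Z * Z)) + M * (Z * (Z * Z)) := by
      clear hBD2 hBD1' hκ hBD1 t3 t4 hB2 hD2 hd hss hds hCD2 hCD1 hCB2 hCB1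
      rw [abs_le] at *
      constructor <;> linarith
    refine e9.trans ?_
    linarith
  have key0 : |GG a φ0 (ρ ∘ p.succAbove) (γ ∘ q.succAbove) x
      - GG a φ0 (ρ ∘ p.succAbove) (γ ∘ q.succAbove) (x - a (ρ p) (γ q)) -
      (a (ρ p) (γ q) * GG a φ1 ρ γ x + (-(a (ρ p) (γ q)^2/2)) * GG a φ2 ρ γ x)| ≤
      10^7 * M * ep b 3 (ρ p) (γ q) + 4 * τ * M2 * ep b 1 (ρ p) (γ q) := by
    have t1 := RS_T3 (GG_hasDerivAt a h0 _ _) (GG_hasDerivAt a h1 _ _) (GG_hasDerivAt a h2 _ _) hB x (a (ρ p) (γ q))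
    have t5 := ep_mul hn0 hb 1 1 (ρ p) (γ q) (ρ p) (γ q)
    have t6 := ep_mul hn0 hb 1 2 (ρ p) (γ q) (ρ p) (γ q)
    have hZ30 := ep_nonneg hb 3 (ρ p) (γ q)
    have hZ20 := ep_nonneg hb 2 (ρ p) (γ q)
    norm_num at t5 t6
    set d1 := a (ρ p) (γ q)
    set Z := ep b 1 (ρ p) (γ q)
    set Z2 := ep b 2 (ρ p) (γ q)
    set Z3 := ep b 3 (ρ p) (γ q)
    have e4 : |d1 * (GG a φ1 (ρ ∘ p.succAbove) (γ ∘ q.succAbove) x - GG a φ1 ρ γ x)| ≤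
        Z * (2 * τ * M2 + M * (10^5 * Z2)) := by
      rw [abs_mul]; gcongr
    have e4' : |d1^2/2 * (GG a φ2 (ρ ∘ p.succAbove) (γ ∘ q.succAbove) x - GG a φ2 ρ γ x)| ≤ (Z*Z) * (M * (37 * Z)) := by
      rw [abs_mul]
      have : |d1^2/2| ≤ Z * Z := by
        have f1 : d1^2 ≤ Z*Z := by rw [← sq_abs, ← sq]; gcongr
        rw [abs_le]; constructor <;> nlinarith [sq_nonneg d1]
      gcongr
    have e5 : M * |d1|^3 ≤ M * (Z * (Z * Z)) := by
      rw [show Z * (Z*Z) = Z^3 by ring]; gcongr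
    have e6 : M * (Z * (Z * Z)) ≤ 64 * (M * Z3) := by
      have : Z * (Z * Z) ≤ 64 * Z3 := by linarith [mul_le_mul_of_nonneg_left t5 hepq]
      linarith [mul_le_mul_of_nonneg_left this hM0]
    have e7 : M * (Z * Z2) ≤ 8 * (M * Z3) := by linarith [mul_le_mul_of_nonneg_left t6 hM0]
    have e8 := mul_nonneg hM0 hZ30
    have e10 : 0 ≤ τ * M2 * Z := by positivity
    have e9 : |GG a φ0 (ρ ∘ p.succAbove) (γ ∘ q.succAbove) x
      - GG a φ0 (ρ ∘ p.succAbove) (γ ∘ q.succAbove) (x - d1) -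
      (d1 * GG a φ1 ρ γ x + (-(d1^2/2)) * GG a φ2 ρ γ x)| ≤
        Z * (2 * τ * M2 + M * (10^5 * Z2)) + (Z*Z) * (M * (37 * Z)) + M * (Z * (Z * Z)) := by
      clear hBD2 hBD1' hκ hBD1 hB2 hD2 key hB
      rw [abs_le] at *
      constructor <;> linarith
    refine e9.trans ?_
    linarith
  rw [GG_diff a φ0 ρ γ x p q]
  have hkb : kap a ρ γ p q * GG a φ1 ρ γ x + bet a ρ γ p q * GG a φ2 ρ γ x =
     (a (ρ p) (γ q) * GG a φ1 ρ γ x + (-(a (ρ p) (γ q)^2/2)) * GG a φ2 ρ γ x) / ((m:ℝ)+2)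
     + (∑ i, ∑ c, (-(a (ρ (p.succAbove i)) (γ (q.succAbove c))
    - (a (ρ p) (γ (q.succAbove c)) + a (ρ (p.succAbove i)) (γ q))) * GG a φ1 ρ γ x
      + (a (ρ (p.succAbove i)) (γ (q.succAbove c)) ^ 2
    - (a (ρ p) (γ (q.succAbove c)) + a (ρ (p.succAbove i)) (γ q))^2)/2 * GG a φ2 ρ γ x)) / (((m:ℝ)+2)*((m:ℝ)+1)) := by
    unfold kap bet
    simp only [Finset.sum_add_distrib, ← Finset.sum_mul]
    ring
  rw [sub_sub _ (kap a ρ γ p q * GG a φ1 ρ γ x), hkb]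
  have e2 := div_le_div_of_nonneg_right key0 (show (0:ℝ) ≤ (m:ℝ)+2 by positivity)
  rw [← abs_of_nonneg (show (0:ℝ) ≤ (m:ℝ)+2 by positivity), ← abs_div, abs_of_nonneg (show (0:ℝ) ≤ (m:ℝ)+2 by positivity)] at e2
  have hZ30 := ep_nonneg hb 3 (ρ p) (γ q)
  have hr0 : 0 ≤ 10^7 * M * ep b 3 (ρ p) (γ q) + 4 * τ * M2 * ep b 1 (ρ p) (γ q) := by positivity
  have e2' := e2.trans (div_le_self hr0 (by linarith [show (0:ℝ) ≤ m by positivity]))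
  have hsum : |(∑ i, ∑ c, (GG a φ0 (ρ ∘ p.succAbove ∘ i.succAbove) (γ ∘ q.succAbove ∘ c.succAbove)
        (x - a (ρ (p.succAbove i)) (γ (q.succAbove c)))
      - GG a φ0 (ρ ∘ p.succAbove ∘ i.succAbove) (γ ∘ q.succAbove ∘ c.succAbove)
        (x - (a (ρ p) (γ (q.succAbove c)) + a (ρ (p.succAbove i)) (γ q))) -
        (-(a (ρ (p.succAbove i)) (γ (q.succAbove c))
    - (a (ρ p) (γ (q.succAbove c)) + a (ρ (p.succAbove i)) (γ q))) * GG a φ1 ρ γ x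
      + (a (ρ (p.succAbove i)) (γ (q.succAbove c)) ^ 2
    - (a (ρ p) (γ (q.succAbove c)) + a (ρ (p.succAbove i)) (γ q))^2)/2 * GG a φ2 ρ γ x))) / (((m:ℝ)+2)*((m:ℝ)+1))|
      ≤ 10^7 * M * (36 * ep b 3 (ρ p) (γ q)) + 4 * τ * M2 * (36 * ep b 1 (ρ p) (γ q)) := by
    have a3 := mul_le_mul_of_nonneg_left (RS_avg (by omega) hn0 hρ hγ hb 3 p q) (show 0 ≤ 10^7 * M by positivity)
    have a1 := mul_le_mul_of_nonneg_left (RS_avg (by omega) hn0 hρ hγ hb 1 p q) (show 0 ≤ 4 * τ * M2 by positivity)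
    refine le_trans ?_ (add_le_add a3 a1)
    rw [abs_div, abs_of_pos (show (0:ℝ) < ((m:ℝ)+2)*((m:ℝ)+1) by positivity), mul_div_assoc', mul_div_assoc', ← add_div]
    gcongr
    simp only [Finset.mul_sum, ← Finset.sum_add_distrib]
    refine (Finset.abs_sum_le_sum_abs _ _).trans (Finset.sum_le_sum fun i _ => ?_)
    refine (Finset.abs_sum_le_sum_abs _ _).trans (Finset.sum_le_sum fun c _ => ?_)
    exact key i c
  have fin := (abs_add_le _ _).trans (add_le_add e2' hsum)
  refine (le_of_eq ?_).trans (fin.trans ?_)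
  · congr 1
    simp only [Finset.sum_sub_distrib]
    ring
  · have : 0 ≤ M * ep b 3 (ρ p) (γ q) := by positivity
    have : 0 ≤ τ * M2 * ep b 1 (ρ p) (γ q) := by positivity
    nlinarith

end diff

end Part3

section Part4

lemma sum_sA {m : ℕ} (f : Fin (m+1) → ℝ) (p : Fin (m+1)) : ∑ i, f (p.succAbove i) = ∑ u, f u - f p := by
  rw [Fin.sum_univ_succAbove f p]; ring

section coef
variable {N : ℕ} {a b : Fin (N+3) → Fin (N+3) → ℝ}

/-- row sums of squares -/
noncomputable def rsq {n : ℕ} (a : Fin n → Fin n → ℝ) (i : Fin n) : ℝ := ∑ v, a i v ^ 2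
/-- column sums of squares -/
noncomputable def csq {n : ℕ} (a : Fin n → Fin n → ℝ) (j : Fin n) : ℝ := ∑ u, a u j ^ 2

/-- Standing assumptions on the matrix and its majorant. -/
structure Std {n : ℕ} (a b : Fin n → Fin n → ℝ) : Prop where
  row : ∀ i, ∑ j, a i j = 0
  col : ∀ j, ∑ i, a i j = 0
  sq : ∑ i, ∑ j, a i j ^ 2 = (n:ℝ) - 1
  hb : ∀ i j, 0 ≤ b i j
  hab : ∀ i j, |a i j| ≤ b i j
  hν : ∀ i j, 1 / (n:ℝ) ≤ b i j ^ 2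
  hn : 100 ≤ n

lemma rsq_le {n : ℕ} {a b : Fin n → Fin n → ℝ} (h : Std a b) (i j : Fin n) :
    rsq a i + csq a j ≤ n * ep b 2 i j := by
  have hn0 : 0 < n := by have := h.hn; omega
  rw [ep_eq hn0]
  have hn' : (0:ℝ) < n := by positivity
  have e1 : rsq a i ≤ ∑ v, b i v ^ 2 := Finset.sum_le_sum fun v _ => by
    rw [← sq_abs]; exact pow_le_pow_left₀ (abs_nonneg _) (h.hab i v) 2
  have e2 : csq a j ≤ ∑ u, b u j ^ 2 := Finset.sum_le_sum fun v _ => by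
    rw [← sq_abs]; exact pow_le_pow_left₀ (abs_nonneg _) (h.hab v j) 2
  have h1 := Sm_nonneg h.hb 2
  have h2 := pow_nonneg (h.hb i j) 2
  have : (n:ℝ) * ((∑ v, b i v ^ 2) / n + (∑ u, b u j ^ 2) / n + Sm b 2 + b i j ^ 2) =
    (∑ v, b i v ^ 2) + (∑ u, b u j ^ 2) + n * (Sm b 2 + b i j ^ 2) := by field_simp; ring
  rw [this]
  have : 0 ≤ n * (Sm b 2 + b i j ^ 2) := by positivity
  linarith

lemma Std.sq_le {n : ℕ} {a b : Fin n → Fin n → ℝ} (h : Std a b) (i j : Fin n) : a i j ^ 2 ≤ ep b 2 i j := by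
  have hn0 : 0 < n := by have := h.hn; omega
  refine le_trans ?_ (b_le_ep hn0 h.hb 2 i j)
  rw [← sq_abs]; exact pow_le_pow_left₀ (abs_nonneg _) (h.hab i j) 2

lemma Std.inv_le {n : ℕ} {a b : Fin n → Fin n → ℝ} (h : Std a b) (i j : Fin n) : 1 / (n:ℝ) ≤ ep b 2 i j := by
  have hn0 : 0 < n := by have := h.hn; omega
  exact (h.hν i j).trans (b_le_ep hn0 h.hb 2 i j)

lemma kapAB (h : Std a b) (p q : Fin (N+3)) : kap (m := N+1) a id id p q = - a p q / ((N:ℝ)+2) := by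
  rw [kap_eq]
  simp only [id]
  have e : ∀ i, ∑ c, a i (q.succAbove c) = 0 - a i q := fun i => by rw [sum_sA (fun c => a i c), h.row]
  simp only [e, h.row]
  rw [sum_sA (fun u => 0 - a u q)]
  simp [h.col]
  ring

lemma kapBC (h : Std a b) (p q : Fin (N+3)) (k l : Fin (N+2)) :
    kap (m := N) a (p.succAbove) (q.succAbove) k l = a p q / ((N:ℝ)+2) -
      (a p q + a (p.succAbove k) (q.succAbove l) + a p (q.succAbove l) + a (p.succAbove k) q) / ((N:ℝ)+1) := by
  rw [kap_eq]
  have e : ∀ i, ∑ c, a i (q.succAbove c) = 0 - a i q := fun i => by rw [sum_sA (fun c => a i c), h.row]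
  have e' : ∀ i, ∑ c, a i (q.succAbove (l.succAbove c)) = 0 - a i q - a i (q.succAbove l) := fun i => by
    rw [sum_sA (fun c => a i (q.succAbove c)), e]
  simp only [e, e']
  rw [sum_sA (fun u => 0 - a u q), sum_sA (fun u => 0 - a (p.succAbove u) q - a (p.succAbove u) (q.succAbove l)),
    sum_sA (fun u => 0 - a u q - a u (q.succAbove l))]
  simp [h.col]
  ring

lemma betAB (h : Std a b) (p q : Fin (N+3)) :
    2 * bet (m := N+1) a id id p q = 1 / ((N:ℝ)+3) - (rsq a p + csq a q) / ((N:ℝ)+2)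
      + a p q ^ 2 * ((N:ℝ)+1) / (((N:ℝ)+3)*((N:ℝ)+2)) := by
  unfold bet
  have e0 : ∀ i, ∑ c, a i (q.succAbove c) = 0 - a i q := fun i => by rw [sum_sA (fun c => a i c), h.row]
  have e1 : ∀ j, ∑ c, a (p.succAbove c) j = 0 - a p j := fun i => by rw [sum_sA (fun c => a c i), h.col]
  have e2 : ∀ i, ∑ c, a i (q.succAbove c) ^ 2 = rsq a i - a i q ^ 2 := fun i => by rw [sum_sA (fun c => a i c ^ 2), rsq]
  have e3 : ∀ j, ∑ c, a (p.succAbove c) j ^ 2 = csq a j - a p j ^ 2 := fun i => by rw [sum_sA (fun c => a c i ^ 2), csq]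
  have e4 : ∑ i, rsq a i = (N:ℝ) + 2 := by
    unfold rsq; rw [h.sq]; push_cast; ring
  have e5 : ∑ i : Fin (N+2), rsq a (p.succAbove i) = (N:ℝ) + 2 - rsq a p := by
    rw [sum_sA (fun c => rsq a c), e4]
  simp only [id, add_sq, sub_div, add_div, Finset.sum_sub_distrib, Finset.sum_add_distrib, ← Finset.sum_div, e2, e3, e5,
    Finset.sum_const, Finset.card_univ, Fintype.card_fin, nsmul_eq_mul, ← Finset.mul_sum, ← Finset.sum_mul, e0, e1]
  push_cast
  have : (N:ℝ)+1+2 ≠ 0 := by positivity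
  have : (N:ℝ)+3 ≠ 0 := by positivity
  have : (N:ℝ)+1+1 ≠ 0 := by positivity
  have : (N:ℝ)+2 ≠ 0 := by positivity
  field_simp
  ring

lemma betBC (h : Std a b) (p q : Fin (N+3)) (k l : Fin (N+2)) :
    2 * bet (m := N) a (p.succAbove) (q.succAbove) k l = 1 / ((N:ℝ)+1) -
      (rsq a (p.succAbove k) + csq a (q.succAbove l)) / ((N:ℝ)+2)
      + (a p (q.succAbove l) ^ 2 + a (p.succAbove k) q ^ 2 + a (p.succAbove k) (q.succAbove l) ^ 2) / ((N:ℝ)+2)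
      + (- (rsq a p + rsq a (p.succAbove k) + csq a q + csq a (q.succAbove l))
        + a p q ^ 2 + a p (q.succAbove l) ^ 2 + a (p.succAbove k) q ^ 2 + a (p.succAbove k) (q.succAbove l) ^ 2
        - 2 * (a (p.succAbove k) q + a (p.succAbove k) (q.succAbove l))
          * (a p (q.succAbove l) + a (p.succAbove k) (q.succAbove l))) / (((N:ℝ)+2)*((N:ℝ)+1)) := by
  unfold bet
  have e0 : ∀ i, ∑ c, a i (q.succAbove (l.succAbove c)) = 0 - a i q - a i (q.succAbove l) := fun i => by
    rw [sum_sA (fun c => a i (q.succAbove c)), sum_sA (fun c => a i c), h.row]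
  have e1 : ∀ j, ∑ c, a (p.succAbove (k.succAbove c)) j = 0 - a p j - a (p.succAbove k) j := fun i => by
    rw [sum_sA (fun c => a (p.succAbove c) i), sum_sA (fun c => a c i), h.col]
  have e2 : ∀ i, ∑ c, a i (q.succAbove (l.succAbove c)) ^ 2 = rsq a i - a i q ^ 2 - a i (q.succAbove l) ^ 2 := fun i => by
    rw [sum_sA (fun c => a i (q.succAbove c) ^ 2), sum_sA (fun c => a i c ^ 2), rsq]
  have e3 : ∀ j, ∑ c, a (p.succAbove (k.succAbove c)) j ^ 2 = csq a j - a p j ^ 2 - a (p.succAbove k) j ^ 2 := fun i => by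
    rw [sum_sA (fun c => a (p.succAbove c) i ^ 2), sum_sA (fun c => a c i ^ 2), csq]
  have e4 : ∑ i, rsq a i = (N:ℝ) + 2 := by
    unfold rsq; rw [h.sq]; push_cast; ring
  have e5 : ∑ i : Fin (N+1), rsq a (p.succAbove (k.succAbove i)) = (N:ℝ) + 2 - rsq a p - rsq a (p.succAbove k) := by
    rw [sum_sA (fun c => rsq a (p.succAbove c)), sum_sA (fun c => rsq a c), e4]
  simp only [add_sq, sub_div, add_div, Finset.sum_sub_distrib, Finset.sum_add_distrib, ← Finset.sum_div, e2, e3, e5,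
    Finset.sum_const, Finset.card_univ, Fintype.card_fin, nsmul_eq_mul, ← Finset.mul_sum, ← Finset.sum_mul, e0, e1]
  push_cast
  have : (N:ℝ)+1 ≠ 0 := by positivity
  have : (N:ℝ)+2 ≠ 0 := by positivity
  field_simp
  ring

end coef

end Part4

section Part5

section coef2
variable {N : ℕ} {a b : Fin (N+3) → Fin (N+3) → ℝ}

lemma rsq_nonneg {n : ℕ} (a : Fin n → Fin n → ℝ) (i : Fin n) : 0 ≤ rsq a i := Finset.sum_nonneg fun _ _ => sq_nonneg _
lemma csq_nonneg {n : ℕ} (a : Fin n → Fin n → ℝ) (i : Fin n) : 0 ≤ csq a i := Finset.sum_nonneg fun _ _ => sq_nonneg _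

set_option maxHeartbeats 1000000 in
lemma bet_est (h : Std a b) (p q : Fin (N+3)) (k l : Fin (N+2)) :
    |bet (m := N+1) a id id p q + bet (m := N) a (p.succAbove) (q.succAbove) k l -
      (1 / ((N:ℝ)+3) - (rsq a p + csq a q + rsq a (p.succAbove k) + csq a (q.succAbove l)) / (2 * ((N:ℝ)+3)))|
     ≤ 20 * Zg b 2 p q (p.succAbove k) (q.succAbove l) / ((N:ℝ)+3)
    ∧ |bet (m := N) a (p.succAbove) (q.succAbove) k l| ≤ 20 * Zg b 2 p q (p.succAbove k) (q.succAbove l) := by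
  have h1 := betAB h p q
  have h2 := betBC h p q k l
  have n1 := h.hn
  have n2 : (97:ℝ) ≤ N := by
    have : 97 ≤ N := by omega
    exact_mod_cast this
  have r1 := rsq_le h p q
  have r2 := rsq_le h (p.succAbove k) (q.succAbove l)
  have s1 := h.sq_le p q
  have s2 := h.sq_le (p.succAbove k) (q.succAbove l)
  have s3 := h.sq_le p (q.succAbove l)
  have s4 := h.sq_le (p.succAbove k) q
  have v := h.inv_le p q
  have p1 := ep_nonneg h.hb 2 p q
  have p2 := ep_nonneg h.hb 2 (p.succAbove k) (q.succAbove l)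
  have p3 := ep_nonneg h.hb 2 p (q.succAbove l)
  have p4 := ep_nonneg h.hb 2 (p.succAbove k) q
  have t1 := rsq_nonneg a p
  have t2 := csq_nonneg a q
  have t3 := rsq_nonneg a (p.succAbove k)
  have t4 := csq_nonneg a (q.succAbove l)
  have hT : Zg b 2 p q (p.succAbove k) (q.succAbove l) = ep b 2 p q + ep b 2 (p.succAbove k) (q.succAbove l) +
    ep b 2 p (q.succAbove l) + ep b 2 (p.succAbove k) q := rfl
  set T := Zg b 2 p q (p.succAbove k) (q.succAbove l)
  push_cast at r1 r2 v
  generalize bet (m := N+1) a id id p q = B1 at *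
  generalize bet (m := N) a (p.succAbove) (q.succAbove) k l = B2 at *
  generalize rsq a p = rp at *
  generalize csq a q = cq at *
  generalize rsq a (p.succAbove k) = rk at *
  generalize csq a (q.succAbove l) = cl at *
  generalize ep b 2 p q = e1 at *
  generalize ep b 2 (p.succAbove k) (q.succAbove l) = e2 at *
  generalize ep b 2 p (q.succAbove l) = e3 at *
  generalize ep b 2 (p.succAbove k) q = e4 at *
  generalize a p q = x1 at *
  generalize a (p.succAbove k) (q.succAbove l) = x2 at *
  generalize a p (q.succAbove l) = x3 at *
  generalize a (p.succAbove k) q = x4 at *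
  generalize (N:ℝ) = M at *
  clear_value T
  obtain ⟨u1, hu1⟩ : ∃ u, u = 1 / (M+1) := ⟨_, rfl⟩
  obtain ⟨u2, hu2⟩ : ∃ u, u = 1 / (M+2) := ⟨_, rfl⟩
  obtain ⟨u3, hu3⟩ : ∃ u, u = 1 / (M+3) := ⟨_, rfl⟩
  have w1 : u1 * (M+1) = 1 := by rw [hu1]; field_simp
  have w2 : u2 * (M+2) = 1 := by rw [hu2]; field_simp
  have w3 : u3 * (M+3) = 1 := by rw [hu3]; field_simp
  have g3 : 0 < u3 := by rw [hu3]; positivity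
  have g1 : 0 < u1 := by rw [hu1]; positivity
  have g2 : 0 < u2 := by rw [hu2]; positivity
  have d1 : u1 - u3 = 2 * u1 * u3 := by
    rw [hu1, hu3]; field_simp; ring
  have d2 : u2 - u3 = u2 * u3 := by
    rw [hu2, hu3]; field_simp; ring
  have l1 : u1 ≤ 2 * u3 := by rw [hu1, hu3, mul_one_div, div_le_div_iff₀ (by positivity) (by positivity)]; linarith
  have l2 : u2 ≤ 2 * u3 := by rw [hu2, hu3, mul_one_div, div_le_div_iff₀ (by positivity) (by positivity)]; linarith
  have l3 : u3 ≤ 1 / 100 := by rw [hu3]; exact one_div_le_one_div_of_le (by norm_num) (by linarith)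
  have hT0 : 0 ≤ T := by linarith
  -- formulas
  have f1 : 2 * B1 = u3 - (rp + cq) * u2 + x1 ^ 2 * (M+1) * (u3 * u2) := by
    rw [h1, hu3, hu2]; field_simp
  set R := (- (rp + rk + cq + cl) + x1 ^ 2 + x3 ^ 2 + x4 ^ 2 + x2 ^ 2 - 2 * (x4 + x2) * (x3 + x2)) with hR
  have f2 : 2 * B2 = u1 - (rk + cl) * u2 + (x3 ^2 + x4 ^2 + x2 ^2) * u2 + R * (u2 * u1) := by
    rw [h2, hu1, hu2]; field_simp
  clear h1 h2
  have k1 : (rp + cq) * u3 ≤ T := by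
    have : (rp + cq) * u3 ≤ (M + 3) * e1 * u3 := by gcongr
    nlinarith
  have k2 : (rk + cl) * u3 ≤ T := by
    have : (rk + cl) * u3 ≤ (M + 3) * e2 * u3 := by gcongr
    nlinarith
  have k3 : |R| ≤ 2 * (M+3) * T := by
    have c1 : |2 * (x4 + x2) * (x3 + x2)| ≤ 4 * T := by
      have y1 := sq_nonneg (x4 + x2 + (x3+x2))
      have y2 := sq_nonneg (x4 + x2 - (x3+x2))
      have y3 := sq_nonneg (x4 - x2)
      have y4 := sq_nonneg (x3 - x2)
      rw [abs_le]
      constructor <;> linarith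
    have c2 : (rp + cq) + (rk + cl) ≤ (M+3) * T := by
      have z1 : 0 ≤ (M+3) * e3 := by positivity
      have z2 : 0 ≤ (M+3) * e4 := by positivity
      rw [hT]; linarith
    have c3 : 0 ≤ (M - 97) * T := mul_nonneg (by linarith) hT0
    rw [abs_le] at c1 ⊢
    rw [hR]
    constructor <;> linarith [sq_nonneg x1, sq_nonneg x2, sq_nonneg x3, sq_nonneg x4]
  have k4 : |R * (u2 * u1)| ≤ 8 * (T * u3) := by
    rw [abs_mul, abs_of_pos (mul_pos g2 g1)]
    calc |R| * (u2 * u1) ≤ 2 * (M+3) * T * (u2 * (2 * u3)) := by gcongr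
      _ = 4 * T * u2 * (u3 * (M+3)) := by ring
      _ = 4 * T * u2 := by rw [w3]; ring
      _ ≤ 4 * T * (2 * u3) := by gcongr
      _ = _ := by ring
  have k5 : u1 - u3 ≤ 4 * (T * u3) := by
    rw [d1]
    have : u3 ≤ T := by rw [hu3]; linarith
    nlinarith
  have k5' : 0 ≤ u1 - u3 := by rw [d1]; positivity
  have k6 : (rp + cq) * (u2 - u3) ≤ 2 * (T * u3) := by
    rw [d2]
    calc (rp + cq) * (u2 * u3) = (rp + cq) * u3 * u2 := by ring
      _ ≤ T * (2 * u3) := by gcongr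
      _ = _ := by ring
  have k6' : 0 ≤ (rp + cq) * (u2 - u3) := by rw [d2]; positivity
  have k7 : (rk + cl) * (u2 - u3) ≤ 2 * (T * u3) := by
    rw [d2]
    calc (rk + cl) * (u2 * u3) = (rk + cl) * u3 * u2 := by ring
      _ ≤ T * (2 * u3) := by gcongr
      _ = _ := by ring
  have k7' : 0 ≤ (rk + cl) * (u2 - u3) := by rw [d2]; positivity
  have k8 : (x3 ^2 + x4 ^2 + x2 ^2) * u2 ≤ 2 * (T * u3) := by
    calc (x3 ^2 + x4 ^2 + x2 ^2) * u2 ≤ T * (2 * u3) := by gcongr; linarith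
      _ = _ := by ring
  have k8' : 0 ≤ (x3 ^2 + x4 ^2 + x2 ^2) * u2 := by positivity
  have k9 : x1 ^ 2 * (M+1) * (u3 * u2) ≤ T * u3 := by
    calc x1 ^ 2 * (M+1) * (u3 * u2) ≤ T * (M+2) * (u3 * u2) := by gcongr <;> linarith
      _ = T * u3 * (u2 * (M+2)) := by ring
      _ = _ := by rw [w2, mul_one]
  have k9' : 0 ≤ x1 ^ 2 * (M+1) * (u3 * u2) := by positivity
  have hb : (1 / (M+3) - (rp + cq + rk + cl) / (2 * (M+3))) = u3 - (rp + cq + rk + cl) * u3 / 2 := by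
    rw [hu3]; field_simp
  have hc : 20 * T / (M+3) = 20 * (T * u3) := by rw [hu3]; field_simp
  rw [hb, hc]
  have k10 : 0 ≤ T * u3 := by positivity
  constructor
  · rw [abs_le] at k4 ⊢
    constructor <;> linarith
  · have : T * u3 ≤ T := by nlinarith
    have : u3 ≤ T := by rw [hu3]; linarith
    have : 0 ≤ (rk + cl) * u3 := by positivity
    rw [abs_le] at k4 ⊢
    constructor <;> linarith

lemma kap_est (h : Std a b) (p q : Fin (N+3)) (k l : Fin (N+2)) :
    |kap (m := N+1) a id id p q| ≤ 6 * Zg b 1 p q (p.succAbove k) (q.succAbove l) / ((N:ℝ)+3) ∧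
    |kap (m := N) a (p.succAbove) (q.succAbove) k l| ≤ 6 * Zg b 1 p q (p.succAbove k) (q.succAbove l) / ((N:ℝ)+3) := by
  rw [kapAB h, kapBC h]
  have n1 := h.hn
  have n2 : (97:ℝ) ≤ N := by
    have : 97 ≤ N := by omega
    exact_mod_cast this
  have t3 := RS_small_Z (by omega) h.hb h.hab p q (p.succAbove k) (q.succAbove l)
  set Z := Zg b 1 p q (p.succAbove k) (q.succAbove l)
  generalize a p q = x1 at *
  generalize a (p.succAbove k) (q.succAbove l) = x2 at *
  generalize a p (q.succAbove l) = x3 at *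
  generalize a (p.succAbove k) q = x4 at *
  generalize (N:ℝ) = M at *
  have hs : |x1 + x2 + x3 + x4| ≤ Z := by
    have := abs_add_three (x1 + x2) x3 x4
    have := abs_add_le x1 x2
    linarith
  have hx1 : |x1| ≤ Z := by linarith [abs_nonneg x2, abs_nonneg x3, abs_nonneg x4]
  have hZ : 0 ≤ Z := (abs_nonneg _).trans hx1
  have g1 : |x1| / (M+2) ≤ 2 * Z / (M+3) := by
    rw [div_le_div_iff₀ (by positivity) (by positivity)]; nlinarith [abs_nonneg x1]
  have g2 : |x1 + x2 + x3 + x4| / (M+1) ≤ 2 * Z / (M+3) := by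
    rw [div_le_div_iff₀ (by positivity) (by positivity)]; nlinarith [abs_nonneg (x1 + x2 + x3 + x4)]
  have g3 : 0 ≤ Z / (M+3) := by positivity
  have g4 : ∀ c, c * Z / (M+3) = c * (Z / (M+3)) := fun c => by ring
  rw [g4] at *
  constructor
  · rw [abs_div, abs_neg, abs_of_pos (show 0 < M+2 by positivity)]; linarith
  · refine (abs_sub _ _).trans ?_
    rw [abs_div, abs_div, abs_of_pos (show 0 < M+2 by positivity), abs_of_pos (show 0 < M+1 by positivity)]; linarith

end coef2

end Part5

section Part6

lemma abs_mul_le {x y X Y : ℝ} (hx : |x| ≤ X) (hy : |y| ≤ Y) : |x * y| ≤ X * Y := by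
  rw [abs_mul]; exact mul_le_mul hx hy (abs_nonneg _) ((abs_nonneg _).trans hx)

lemma E1_real {x x' u A1 A2 A3 B1 B2 B3 C1 C2 C3 C0x C0x' C0 k1 k2 b1 b2 bs Z1 Z2 Z3 Z4 M2 M3 M4 τ : ℝ}
    (hu : 0 ≤ u) (hM2 : 0 ≤ M2) (hM3 : 0 ≤ M3) (hM4 : 0 ≤ M4) (hτ : 0 ≤ τ)
    (z1 : 0 ≤ Z1) (z2 : 0 ≤ Z2) (z3 : 0 ≤ Z3) (z4 : 0 ≤ Z4)
    (z11 : Z1 * Z1 ≤ 32 * Z2) (z12 : Z1 * Z2 ≤ 32 * Z3) (z13 : Z1 * Z3 ≤ 32 * Z4)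
    (hx : |x| ≤ Z1) (hx' : |x'| ≤ Z1) (hxx : |x - x'| ≤ Z1)
    (t : |C0x - C0 + x * C1 - x ^ 2 / 2 * C2 + x ^ 3 / 6 * C3| ≤ M4 * |x| ^ 4)
    (t' : |C0x' - C0 + x' * C1 - x' ^ 2 / 2 * C2 + x' ^ 3 / 6 * C3| ≤ M4 * |x'| ^ 4)
    (f1 : |B3 - A3| ≤ M4 * (37 * Z1)) (f2 : |C3 - B3| ≤ M4 * (37 * Z1))
    (hA2 : |A2| ≤ M2) (hB2 : |B2| ≤ M2) (hA3 : |A3| ≤ M3) (hB3 : |B3| ≤ M3)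
    (hk1 : |k1| ≤ 2 * τ) (hk2 : |k2| ≤ 2 * τ)
    (hk1' : |k1| ≤ 6 * Z1 * u) (hk2' : |k2| ≤ 6 * Z1 * u)
    (f3 : |B2 - A2 - k1 * A3| ≤ M4 * (10^5 * Z2)) (f4 : |C2 - B2 - k2 * B3| ≤ M4 * (10^5 * Z2))
    (f5 : |B1 - A1 - k1 * A2 - b1 * A3| ≤ 10^9 * (M4 * Z3 + τ * M3 * Z1))
    (f6 : |C1 - B1 - k2 * B2 - b2 * B3| ≤ 10^9 * (M4 * Z3 + τ * M3 * Z1))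
    (hb1 : |b1 + b2 - bs| ≤ 20 * Z2 * u) (hb2 : |b2| ≤ 20 * Z2) :
    |C0x - C0x' - (-(x - x') * (A1 + bs * A3) + (x ^ 2 - x' ^ 2) / 2 * A2 - (x ^ 3 - x' ^ 3) / 6 * A3)| ≤
      10 ^ 12 * (M4 * Z4 + τ * M3 * Z2 + M2 * Z2 * u + M3 * Z3 * u) := by
  have g3 : |C3 - A3| ≤ 74 * (M4 * Z1) := by
    have := abs_sub_le C3 B3 A3; linarith
  have g2 : |C2 - A2| ≤ 4 * (τ * M3) + 2 * 10^5 * (M4 * Z2) := by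
    have h1 := abs_mul_le hk1 hA3
    have h2 := abs_mul_le hk2 hB3
    rw [abs_le] at *
    constructor <;> linarith
  have g1 : |C1 - A1 - bs * A3| ≤ 12 * (Z1 * u * M2) + 23680 * (M4 * Z3) + 20 * (Z2 * u * M3)
      + 2 * 10^9 * (M4 * Z3 + τ * M3 * Z1) := by
    have h1 := abs_mul_le hk1' hA2
    have h2 := abs_mul_le hk2' hB2
    have h3 := abs_mul_le hb1 hA3
    have h4 := abs_mul_le hb2 f1
    have h5 := mul_le_mul_of_nonneg_left z12 hM4
    rw [abs_le] at h1 h2 h3 h4 f5 f6 ⊢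
    constructor <;> linarith
  have s2 : |(x^2 - x'^2)/2| ≤ Z1 * Z1 := by
    have e1 : |x^2| ≤ Z1*Z1 := by rw [sq]; exact abs_mul_le hx hx
    have e2 : |x'^2| ≤ Z1*Z1 := by rw [sq]; exact abs_mul_le hx' hx'
    rw [abs_le] at *; constructor <;> linarith
  have s3 : |(x^3 - x'^3)/6| ≤ Z1 * (Z1 * Z1) := by
    have e1 : |x^3| ≤ Z1*(Z1*Z1) := by rw [show x^3 = x * (x * x) by ring]; exact abs_mul_le hx (abs_mul_le hx hx)
    have e2 : |x'^3| ≤ Z1*(Z1*Z1) := by rw [show x'^3 = x' * (x' * x') by ring]; exact abs_mul_le hx' (abs_mul_le hx' hx')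
    have e3 : 0 ≤ Z1 * (Z1*Z1) := by positivity
    rw [abs_le] at *; constructor <;> linarith
  have w2 : Z1 * (Z1 * Z2) ≤ 1024 * Z4 := by linarith [mul_le_mul_of_nonneg_left z12 z1]
  have w4 : Z1 * (Z1 * (Z1 * Z1)) ≤ 32768 * Z4 := by
    have := mul_le_mul_of_nonneg_left (mul_le_mul_of_nonneg_left z11 z1) z1
    linarith
  have s4 : |x|^4 ≤ Z1 * (Z1 * (Z1 * Z1)) := by
    rw [show Z1 * (Z1 * (Z1 * Z1)) = Z1^4 by ring]; gcongr
  have s4' : |x'|^4 ≤ Z1 * (Z1 * (Z1 * Z1)) := by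
    rw [show Z1 * (Z1 * (Z1 * Z1)) = Z1^4 by ring]; gcongr
  have m1 := abs_mul_le hxx g1
  have m2 := abs_mul_le s2 g2
  have m3 := abs_mul_le s3 g3
  have tt := t.trans (mul_le_mul_of_nonneg_left (s4.trans w4) hM4)
  have tt' := t'.trans (mul_le_mul_of_nonneg_left (s4'.trans w4) hM4)
  have main : |C0x - C0x' - (-(x - x') * (A1 + bs * A3) + (x ^ 2 - x' ^ 2) / 2 * A2 - (x ^ 3 - x' ^ 3) / 6 * A3)| ≤
     Z1 * (12 * (Z1 * u * M2) + 23680 * (M4 * Z3) + 20 * (Z2 * u * M3)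
      + 2 * 10^9 * (M4 * Z3 + τ * M3 * Z1)) + Z1 * Z1 * (4 * (τ * M3) + 2 * 10^5 * (M4 * Z2)) +
      Z1 * (Z1 * Z1) * (74 * (M4 * Z1)) + 2 * (M4 * (32768 * Z4)) := by
    clear t t' f1 f2 hA2 hB2 hA3 hB3 hk1 hk2 hk1' hk2' f3 f4 f5 f6 hb1 hb2 hx hx' hxx s2 s3 g1 g2 g3
    rw [abs_le] at *
    constructor <;> linarith
  refine main.trans ?_
  have v1 := mul_le_mul_of_nonneg_left z11 (mul_nonneg hu hM2)
  have v2 := mul_le_mul_of_nonneg_left z12 (mul_nonneg hu hM3)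
  have v3 := mul_le_mul_of_nonneg_left z13 hM4
  have v4 := mul_le_mul_of_nonneg_left z11 (mul_nonneg hτ hM3)
  have v5 := mul_le_mul_of_nonneg_left w2 hM4
  have v6 := mul_le_mul_of_nonneg_left w4 hM4
  have y1 : 0 ≤ M4 * Z4 := by positivity
  have y2 : 0 ≤ τ * M3 * Z2 := by positivity
  have y3 : 0 ≤ M2 * Z2 * u := by positivity
  have y4 : 0 ≤ M3 * Z3 * u := by positivity
  linarith

section E1
variable {N : ℕ} {a b : Fin (N+3) → Fin (N+3) → ℝ}

set_option maxHeartbeats 1000000 in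
lemma E1 (h : Std a b) {φ0 φ1 φ2 φ3 φ4 : ℝ → ℝ} (h0 : ∀ x, HasDerivAt φ0 (φ1 x) x)
    (h1 : ∀ x, HasDerivAt φ1 (φ2 x) x) (h2 : ∀ x, HasDerivAt φ2 (φ3 x) x) (h3 : ∀ x, HasDerivAt φ3 (φ4 x) x)
    {τ : ℝ} (hτ : TauB a τ) {M2 M3 M4 : ℝ} (hM2 : Bd a φ2 M2) (hM3 : Bd a φ3 M3) (hM4 : Bd a φ4 M4)
    (X : ℝ) (p q : Fin (N+3)) (k l : Fin (N+2)) (x x' : ℝ)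
    (hx : x = a p q + a (p.succAbove k) (q.succAbove l)) (hx' : x' = a p (q.succAbove l) + a (p.succAbove k) q) :
    |GG a φ0 (p.succAbove ∘ k.succAbove) (q.succAbove ∘ l.succAbove) (X - x)
      - GG a φ0 (p.succAbove ∘ k.succAbove) (q.succAbove ∘ l.succAbove) (X - x')
      - (-(x - x') * (GG a φ1 id id X +
          (1 / ((N:ℝ)+3) - (rsq a p + csq a q + rsq a (p.succAbove k) + csq a (q.succAbove l)) / (2 * ((N:ℝ)+3)))
            * GG a φ3 id id X)
        + (x ^ 2 - x' ^ 2) / 2 * GG a φ2 id id X - (x ^ 3 - x' ^ 3) / 6 * GG a φ3 id id X)| ≤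
      10 ^ 12 * (M4 * Zg b 4 p q (p.succAbove k) (q.succAbove l)
        + τ * M3 * Zg b 2 p q (p.succAbove k) (q.succAbove l)
        + M2 * Zg b 2 p q (p.succAbove k) (q.succAbove l) * (1 / ((N:ℝ)+3))
        + M3 * Zg b 3 p q (p.succAbove k) (q.succAbove l) * (1 / ((N:ℝ)+3))) := by
  have hn := h.hn
  have hb := h.hb
  have hab := h.hab
  have hn0 : 0 < N + 3 := by omega
  have sp := Fin.strictMono_succAbove p
  have sq := Fin.strictMono_succAbove q
  have sk := sp.comp (Fin.strictMono_succAbove k)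
  have sl := sq.comp (Fin.strictMono_succAbove l)
  have sid : StrictMono (id : Fin (N+3) → Fin (N+3)) := strictMono_id
  have hM20 : 0 ≤ M2 := (abs_nonneg _).trans (hM2 (N+3) (by omega) id id sid sid 0)
  have hM30 : 0 ≤ M3 := (abs_nonneg _).trans (hM3 (N+3) (by omega) id id sid sid 0)
  have hM40 : 0 ≤ M4 := (abs_nonneg _).trans (hM4 (N+3) (by omega) id id sid sid 0)
  have hτ0 : 0 ≤ τ := (abs_nonneg _).trans (hτ (N+3) (by omega) id id sid sid)
  have hC := hM4 (N+1) (by omega) _ _ sk sl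
  have t1 := RS_T4 (GG_hasDerivAt a h0 _ _) (GG_hasDerivAt a h1 _ _) (GG_hasDerivAt a h2 _ _) (GG_hasDerivAt a h3 _ _) hC X x
  have t2 := RS_T4 (GG_hasDerivAt a h0 _ _) (GG_hasDerivAt a h1 _ _) (GG_hasDerivAt a h2 _ _) (GG_hasDerivAt a h3 _ _) hC X x'
  have t3 := RS_small_Z hn0 hb hab p q (p.succAbove k) (q.succAbove l)
  have hZ : ∀ t, ep b t p q ≤ Zg b t p q (p.succAbove k) (q.succAbove l) ∧
      ep b t (p.succAbove k) (q.succAbove l) ≤ Zg b t p q (p.succAbove k) (q.succAbove l) := by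
    intro t
    unfold Zg
    have := ep_nonneg hb t p q
    have := ep_nonneg hb t (p.succAbove k) (q.succAbove l)
    have := ep_nonneg hb t p (q.succAbove l)
    have := ep_nonneg hb t (p.succAbove k) q
    constructor <;> linarith
  have c1 := L1 (m := N+1) hn hb hab (by omega) h3 hM4 sid sid p q X
  have c2 := L1 (m := N) hn hb hab (by omega) h3 hM4 sp sq k l X
  have c3 := L2 (m := N+1) hn hb hab (by omega) h2 h3 hM4 sid sid (by omega) p q X
  have c4 := L2 (m := N) hn hb hab (by omega) h2 h3 hM4 sp sq (by omega) k l X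
  have c5 := L3 (m := N+1) hn hb hab (by omega) h1 h2 h3 hτ hM3 hM4 sid sid p q X
  have c6 := L3 (m := N) hn hb hab (by omega) h1 h2 h3 hτ hM3 hM4 sp sq k l X
  simp only [Function.id_comp, id] at c1 c3 c5
  have be := bet_est h p q k l
  have ke := kap_est h p q k l
  rw [div_eq_mul_one_div (20 * Zg b 2 p q (p.succAbove k) (q.succAbove l)) ((N:ℝ)+3)] at be
  rw [div_eq_mul_one_div (6 * Zg b 1 p q (p.succAbove k) (q.succAbove l)) ((N:ℝ)+3)] at ke
  have w11 := Zg_mul hn0 hb 1 1 p q (p.succAbove k) (q.succAbove l)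
  have w12 := Zg_mul hn0 hb 1 2 p q (p.succAbove k) (q.succAbove l)
  have w13 := Zg_mul hn0 hb 1 3 p q (p.succAbove k) (q.succAbove l)
  have z := fun t => Zg_nonneg hb t p q (p.succAbove k) (q.succAbove l)
  have xx1 : |x| ≤ |a p q| + |a (p.succAbove k) (q.succAbove l)| := by rw [hx]; exact abs_add_le _ _
  have xx2 : |x'| ≤ |a p (q.succAbove l)| + |a (p.succAbove k) q| := by rw [hx']; exact abs_add_le _ _
  have y1 := abs_nonneg (a p q)
  have y2 := abs_nonneg (a p (q.succAbove l))
  have y3 := abs_nonneg (a (p.succAbove k) q)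
  have y4 := abs_nonneg (a (p.succAbove k) (q.succAbove l))
  refine E1_real (C0 := GG a φ0 (p.succAbove ∘ k.succAbove) (q.succAbove ∘ l.succAbove) X)
    (by positivity) hM20 hM30 hM40 hτ0 (z 1) (z 2) (z 3) (z 4) w11 w12 w13 (by linarith) (by linarith)
    (by have := abs_sub x x'; linarith) t1 t2
    (c1.trans ?_) (c2.trans ?_) (hM2 _ (by omega) _ _ sid sid _) (hM2 _ (by omega) _ _ sp sq _)
    (hM3 _ (by omega) _ _ sid sid _) (hM3 _ (by omega) _ _ sp sq _)
    (kap_le hτ (m := N+1) (by omega) sid sid p q) (kap_le hτ (m := N) (by omega) sp sq k l) ke.1 ke.2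
    (c3.trans ?_) (c4.trans ?_) (c5.trans ?_) (c6.trans ?_) be.1 be.2
  · gcongr; exact (hZ 1).1
  · gcongr; exact (hZ 1).2
  · gcongr; exact (hZ 2).1
  · gcongr; exact (hZ 2).2
  · have u3 := (hZ 3).1
    have u1 := (hZ 1).1
    gcongr
  · have u3 := (hZ 3).2
    have u1 := (hZ 1).2
    gcongr

end E1

end Part6

section Part7

section E7
variable {N : ℕ} {a b : Fin (N+3) → Fin (N+3) → ℝ}

lemma E0_id (h : Std a b) (φ : ℝ → ℝ) (X : ℝ) :
    permExp (fun π : Equiv.Perm (Fin (N+3)) => (∑ i, a i (π i)) * φ (X - ∑ i, a i (π i)))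
    = (∑ p, ∑ q, ∑ k : Fin (N+2), ∑ l : Fin (N+2), a p q *
      (GG a φ (p.succAbove ∘ k.succAbove) (q.succAbove ∘ l.succAbove) (X - (a p q + a (p.succAbove k) (q.succAbove l)))
      - GG a φ (p.succAbove ∘ k.succAbove) (q.succAbove ∘ l.succAbove) (X - (a p (q.succAbove l) + a (p.succAbove k) q))))
      / (((N:ℝ)+3)^2 * ((N:ℝ)+2)) := by
  rw [GG_Tweighted (n := N+2)]
  have key : ∀ p q, GG a φ p.succAbove q.succAbove (X - a p q) - GG a φ id id X =
      (∑ k : Fin (N+2), ∑ l : Fin (N+2), 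
      (GG a φ (p.succAbove ∘ k.succAbove) (q.succAbove ∘ l.succAbove) (X - (a p q + a (p.succAbove k) (q.succAbove l)))
      - GG a φ (p.succAbove ∘ k.succAbove) (q.succAbove ∘ l.succAbove) (X - (a p (q.succAbove l) + a (p.succAbove k) q))))
      / (((N:ℝ)+3) * ((N:ℝ)+2)) := by
    intro p q
    have h1 := GG_CI (m := N+1) a φ id id X p q
    have h2 := GG_CI' (m := N+1) a φ p.succAbove q.succAbove (X - a p q)
    simp only [Function.id_comp, id] at h1
    simp only [sub_sub] at h1 h2
    simp only [Finset.sum_sub_distrib]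
    set S1 := ∑ k : Fin (N+2), ∑ l : Fin (N+2), GG a φ (p.succAbove ∘ k.succAbove) (q.succAbove ∘ l.succAbove) (X - (a p q + a (p.succAbove k) (q.succAbove l)))
    set S2 := ∑ k : Fin (N+2), ∑ l : Fin (N+2), GG a φ (p.succAbove ∘ k.succAbove) (q.succAbove ∘ l.succAbove) (X - (a p (q.succAbove l) + a (p.succAbove k) q))
    rw [h1, h2]
    push_cast
    field_simp
    ring
  have h0 : ∑ p, ∑ q, a p q * GG a φ id id X = 0 := by
    simp only [← Finset.sum_mul, h.row]; simp
  have e : ∑ p, ∑ q, a p q * GG a φ p.succAbove q.succAbove (X - a p q) =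
     ∑ p, ∑ q, a p q * (GG a φ p.succAbove q.succAbove (X - a p q) - GG a φ id id X) := by
    simp only [mul_sub, Finset.sum_sub_distrib, h0, sub_zero]
  rw [e]
  simp_rw [key]
  simp only [← Finset.mul_sum, mul_div_assoc', ← Finset.sum_div]
  push_cast
  rw [div_div]
  congr 1
  ring

/-- the main polynomial -/
noncomputable def DD (a : Fin (N+3) → Fin (N+3) → ℝ) (A1 A2 A3 : ℝ) (p q u v : Fin (N+3)) : ℝ :=
  (-((a p q + a u v) - (a p v + a u q)) * (A1 +
          (1 / ((N:ℝ)+3) - (rsq a p + csq a q + rsq a u + csq a v) / (2 * ((N:ℝ)+3)))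
            * A3)
        + ((a p q + a u v) ^ 2 - (a p v + a u q) ^ 2) / 2 * A2 - ((a p q + a u v) ^ 3 - (a p v + a u q) ^ 3) / 6 * A3)

lemma DD_zero (a : Fin (N+3) → Fin (N+3) → ℝ) (A1 A2 A3 : ℝ) (p q u : Fin (N+3)) : DD a A1 A2 A3 p q u q = 0 := by
  unfold DD; ring
lemma DD_zero' (a : Fin (N+3) → Fin (N+3) → ℝ) (A1 A2 A3 : ℝ) (p q v : Fin (N+3)) : DD a A1 A2 A3 p q p v = 0 := by
  unfold DD; ring

lemma DD_ext (a : Fin (N+3) → Fin (N+3) → ℝ) (A1 A2 A3 : ℝ) (p q : Fin (N+3)) :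
    ∑ k : Fin (N+2), ∑ l : Fin (N+2), DD a A1 A2 A3 p q (p.succAbove k) (q.succAbove l) = ∑ u, ∑ v, DD a A1 A2 A3 p q u v := by
  have : ∀ k : Fin (N+2), ∑ l : Fin (N+2), DD a A1 A2 A3 p q (p.succAbove k) (q.succAbove l) = ∑ v, DD a A1 A2 A3 p q (p.succAbove k) v := by
    intro k
    rw [sum_sA (m := N+2) (fun v => DD a A1 A2 A3 p q (p.succAbove k) v) q, DD_zero, sub_zero]
  simp_rw [this]
  rw [sum_sA (m := N+2) (fun u => ∑ v, DD a A1 A2 A3 p q u v) p]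
  simp [DD_zero']

set_option maxHeartbeats 1000000 in
lemma DD_inner (h : Std a b) (A1 A2 A3 : ℝ) (p q : Fin (N+3)) :
    ∑ u, ∑ v, DD a A1 A2 A3 p q u v =
      -(((N:ℝ)+3)^2 * a p q) * A1
      - (((N:ℝ)+3) * a p q - (((N:ℝ)+3)^2 * a p q * (rsq a p + csq a q) + 2 * ((N:ℝ)+3) * ((N:ℝ)+2) * a p q
          - ((N:ℝ)+3) * (∑ u, a u q * rsq a u) - ((N:ℝ)+3) * (∑ v, a p v * csq a v)) / (2 * ((N:ℝ)+3))) * A3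
      + (((N:ℝ)+3)^2 * a p q ^ 2 + ((N:ℝ)+2) - ((N:ℝ)+3) * rsq a p - ((N:ℝ)+3) * csq a q)/2 * A2
      - (((N:ℝ)+3)^2 * a p q ^ 3 + 3 * a p q * ((N:ℝ)+2) + (∑ u, ∑ v, a u v ^ 3) - ((N:ℝ)+3) * (∑ v, a p v ^ 3)
         - ((N:ℝ)+3) * (∑ u, a u q ^ 3))/6 * A3 := by
  have hr : ∑ u, rsq a u = (N:ℝ)+2 := by
    unfold rsq; rw [h.sq]; push_cast; ring
  have hc : ∑ u, csq a u = (N:ℝ)+2 := by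
    unfold csq; rw [Finset.sum_comm, h.sq]; push_cast; ring
  have hn : (N:ℝ)+3 ≠ 0 := by positivity
  have hrow := h.row
  have hcol := h.col
  have ac : ∀ u, ∑ v, a u v * csq a v = ∑ v, a u v * csq a v := fun _ => rfl
  have in_v : ∀ u, ∑ v, DD a A1 A2 A3 p q u v =
     -(((N:ℝ)+3) * a p q - ((N:ℝ)+3) * a u q) * (A1 + A3 / ((N:ℝ)+3))
     + ((((N:ℝ)+3) * a p q - ((N:ℝ)+3) * a u q) * (rsq a p + csq a q + rsq a u)
         + a p q * ((N:ℝ)+2) - a u q * ((N:ℝ)+2) + (∑ v, a u v * csq a v) - (∑ v, a p v * csq a v)) * (A3 / (2 * ((N:ℝ)+3)))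
     + (((N:ℝ)+3) * a p q^2 + rsq a u - rsq a p - ((N:ℝ)+3) * a u q ^ 2) * (A2/2)
     - (((N:ℝ)+3) * a p q ^ 3 + 3 * a p q * rsq a u + (∑ v, a u v ^ 3) - (∑ v, a p v ^ 3) - 3 * rsq a p * a u q
         - ((N:ℝ)+3) * a u q ^ 3) * (A3/6) := by
    intro u
    have e : ∀ v, DD a A1 A2 A3 p q u v =
      (-(a p q - a u q) * (A1 + A3 / ((N:ℝ)+3)) + (a p q - a u q) * (rsq a p + csq a q + rsq a u) * (A3 / (2 * ((N:ℝ)+3)))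
        + (a p q ^ 2 - a u q ^ 2) * (A2 / 2) - (a p q ^ 3 - a u q ^ 3) * (A3/6))
      + (-(A1 + A3 / ((N:ℝ)+3)) + (rsq a p + csq a q + rsq a u) * (A3 / (2 * ((N:ℝ)+3))) + a p q * A2 - a p q ^ 2 * (A3/2)) * a u v
      + ((A1 + A3 / ((N:ℝ)+3)) - (rsq a p + csq a q + rsq a u) * (A3 / (2 * ((N:ℝ)+3))) - a u q * A2 + a u q ^ 2 * (A3/2)) * a p v
      + ((a p q - a u q) * (A3 / (2 * ((N:ℝ)+3)))) * csq a v
      + (A3 / (2 * ((N:ℝ)+3))) * (a u v * csq a v)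
      - (A3 / (2 * ((N:ℝ)+3))) * (a p v * csq a v)
      + (A2/2 - a p q * (A3/2)) * a u v ^ 2
      - (A2/2 - a u q * (A3/2)) * a p v ^ 2
      - (A3/6) * a u v ^ 3 + (A3/6) * a p v ^ 3 := by
      intro v
      unfold DD
      field_simp
      ring
    simp_rw [e]
    simp only [Finset.sum_add_distrib, Finset.sum_sub_distrib, ← Finset.mul_sum, hrow, hc, Finset.sum_const, Finset.card_univ, Fintype.card_fin, nsmul_eq_mul]
    have r1 : ∑ v, a u v ^ 2 = rsq a u := rfl
    have r2 : ∑ v, a p v ^ 2 = rsq a p := rfl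
    rw [r1, r2]
    push_cast
    ring
  simp_rw [in_v]
  have e2 : ∀ u, -(((N:ℝ)+3) * a p q - ((N:ℝ)+3) * a u q) * (A1 + A3 / ((N:ℝ)+3))
     + ((((N:ℝ)+3) * a p q - ((N:ℝ)+3) * a u q) * (rsq a p + csq a q + rsq a u)
         + a p q * ((N:ℝ)+2) - a u q * ((N:ℝ)+2) + (∑ v, a u v * csq a v) - (∑ v, a p v * csq a v)) * (A3 / (2 * ((N:ℝ)+3)))
     + (((N:ℝ)+3) * a p q^2 + rsq a u - rsq a p - ((N:ℝ)+3) * a u q ^ 2) * (A2/2)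
     - (((N:ℝ)+3) * a p q ^ 3 + 3 * a p q * rsq a u + (∑ v, a u v ^ 3) - (∑ v, a p v ^ 3) - 3 * rsq a p * a u q
         - ((N:ℝ)+3) * a u q ^ 3) * (A3/6) =
     (-(((N:ℝ)+3) * a p q) * (A1 + A3 / ((N:ℝ)+3)) + ((((N:ℝ)+3) * a p q) * (rsq a p + csq a q)
         + a p q * ((N:ℝ)+2) - (∑ v, a p v * csq a v)) * (A3 / (2 * ((N:ℝ)+3)))
         + (((N:ℝ)+3) * a p q^2 - rsq a p) * (A2/2) - (((N:ℝ)+3) * a p q ^ 3 - (∑ v, a p v ^ 3)) * (A3/6))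
     + (((N:ℝ)+3) * (A1 + A3 / ((N:ℝ)+3)) - (((N:ℝ)+3) * (rsq a p + csq a q) + ((N:ℝ)+2)) * (A3 / (2 * ((N:ℝ)+3))) + 3 * rsq a p * (A3/6)) * a u q
     + (((N:ℝ)+3) * a p q * (A3 / (2 * ((N:ℝ)+3))) + A2/2 - 3 * a p q * (A3/6)) * rsq a u
     - (((N:ℝ)+3) * (A3 / (2 * ((N:ℝ)+3)))) * (a u q * rsq a u)
     + (A3 / (2 * ((N:ℝ)+3))) * (∑ v, a u v * csq a v)
     - (((N:ℝ)+3) * (A2/2)) * a u q ^ 2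
     - (A3/6) * (∑ v, a u v ^ 3)
     + (((N:ℝ)+3) * (A3/6)) * a u q ^ 3 := by
    intro u; ring
  simp_rw [e2]
  have z1 : ∑ u, ∑ v, a u v * csq a v = 0 := by
    rw [Finset.sum_comm]; simp only [← Finset.sum_mul, hcol, zero_mul, Finset.sum_const_zero]
  simp only [Finset.sum_add_distrib, Finset.sum_sub_distrib, ← Finset.mul_sum, hcol, hr, z1, Finset.sum_const, Finset.card_univ, Fintype.card_fin, nsmul_eq_mul]
  have r1 : ∑ u, a u q ^ 2 = csq a q := rfl
  rw [r1]
  push_cast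
  field_simp
  ring

set_option maxHeartbeats 1000000 in
lemma DD_outer (h : Std a b) (A1 A2 A3 : ℝ) :
    ∑ p, ∑ q, a p q * ∑ u, ∑ v, DD a A1 A2 A3 p q u v =
      -(((N:ℝ)+3)^2 * ((N:ℝ)+2)) * A1
      - (((N:ℝ)+3) * ((N:ℝ)+2) - (((N:ℝ)+3)^2 * (∑ p, rsq a p ^ 2 + ∑ q, csq a q ^ 2) + 2 * ((N:ℝ)+3) * ((N:ℝ)+2) ^ 2)
          / (2 * ((N:ℝ)+3))) * A3
      + (((N:ℝ)+3)^2 * ∑ p, ∑ q, a p q ^ 3)/2 * A2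
      - (((N:ℝ)+3)^2 * (∑ p, ∑ q, a p q ^ 4) + 3 * ((N:ℝ)+2) ^ 2)/6 * A3 := by
  have hn : (N:ℝ)+3 ≠ 0 := by positivity
  have hrow := h.row
  have hcol := h.col
  have hs : ∑ p, ∑ q, a p q ^ 2 = (N:ℝ)+2 := by rw [h.sq]; push_cast; ring
  have k1 : ∀ f : Fin (N+3) → ℝ, ∑ p, ∑ q, f p * a p q = 0 := by
    intro f; simp only [← Finset.mul_sum, hrow, mul_zero, Finset.sum_const_zero]
  have k2 : ∀ f : Fin (N+3) → ℝ, ∑ p, ∑ q, f q * a p q = 0 := by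
    intro f; rw [Finset.sum_comm]; simp only [← Finset.mul_sum, hcol, mul_zero, Finset.sum_const_zero]
  have k3 : ∑ p, ∑ q, rsq a p * a p q ^ 2 = ∑ p, rsq a p ^ 2 := by
    refine Finset.sum_congr rfl fun p _ => ?_
    rw [← Finset.mul_sum, sq]; rfl
  have k4 : ∑ p, ∑ q, csq a q * a p q ^ 2 = ∑ q, csq a q ^ 2 := by
    rw [Finset.sum_comm]
    refine Finset.sum_congr rfl fun p _ => ?_
    rw [← Finset.mul_sum, sq]; rfl
  simp_rw [DD_inner h]
  have e : ∀ p q, a p q * (-(((N:ℝ)+3)^2 * a p q) * A1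
      - (((N:ℝ)+3) * a p q - (((N:ℝ)+3)^2 * a p q * (rsq a p + csq a q) + 2 * ((N:ℝ)+3) * ((N:ℝ)+2) * a p q
          - ((N:ℝ)+3) * (∑ u, a u q * rsq a u) - ((N:ℝ)+3) * (∑ v, a p v * csq a v)) / (2 * ((N:ℝ)+3))) * A3
      + (((N:ℝ)+3)^2 * a p q ^ 2 + ((N:ℝ)+2) - ((N:ℝ)+3) * rsq a p - ((N:ℝ)+3) * csq a q)/2 * A2
      - (((N:ℝ)+3)^2 * a p q ^ 3 + 3 * a p q * ((N:ℝ)+2) + (∑ u, ∑ v, a u v ^ 3) - ((N:ℝ)+3) * (∑ v, a p v ^ 3)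
         - ((N:ℝ)+3) * (∑ u, a u q ^ 3))/6 * A3) = 
      (-(((N:ℝ)+3)^2) * A1 - (((N:ℝ)+3) - ((N:ℝ)+2)) * A3 - ((N:ℝ)+2)/2 * A3) * a p q ^ 2
      + (((N:ℝ)+3) / 2 * A3) * (rsq a p * a p q ^ 2) + (((N:ℝ)+3) / 2 * A3) * (csq a q * a p q ^ 2)
      + (-1/2 * A3 * (∑ v, a p v * csq a v) - ((N:ℝ)+3) * rsq a p / 2 * A2 + ((N:ℝ)+3) * (∑ v, a p v ^ 3)/6 * A3) * a p q
      + (-1/2 * A3 * (∑ u, a u q * rsq a u) + ((N:ℝ)+2)/2 * A2 - ((N:ℝ)+3) * csq a q / 2 * A2 + ((N:ℝ)+3) * (∑ u, a u q ^ 3)/6 * A3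
          - (∑ u, ∑ v, a u v ^ 3)/6 * A3) * a p q
      + (((N:ℝ)+3)^2/2 * A2) * a p q ^ 3
      - (((N:ℝ)+3)^2/6 * A3) * a p q ^ 4 := by
    intro p q
    field_simp
    ring
  simp_rw [e]
  simp only [Finset.sum_add_distrib, Finset.sum_sub_distrib]
  rw [k1 (fun p => -1/2 * A3 * (∑ v, a p v * csq a v) - ((N:ℝ)+3) * rsq a p / 2 * A2 + ((N:ℝ)+3) * (∑ v, a p v ^ 3)/6 * A3),
    k2 (fun q => -1/2 * A3 * (∑ u, a u q * rsq a u) + ((N:ℝ)+2)/2 * A2 - ((N:ℝ)+3) * csq a q / 2 * A2 + ((N:ℝ)+3) * (∑ u, a u q ^ 3)/6 * A3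
          - (∑ u, ∑ v, a u v ^ 3)/6 * A3)]
  simp only [← Finset.mul_sum] at k3 ⊢
  simp only [k3, k4, hs]
  field_simp
  ring
end E7

end Part7

section Part8

section E8
variable {N : ℕ} {a b : Fin (N+3) → Fin (N+3) → ℝ}

lemma sum_Zg4 (b : Fin (N+3) → Fin (N+3) → ℝ) (t : ℕ) :
    ∑ p, ∑ q, ∑ u, ∑ v, Zg b t p q u v = 16 * ((N:ℝ)+3)^2 * ∑ u, ∑ v, b u v ^ t := by
  have e := RS_avg_ep (n := N+3) (by omega) b t
  have e' : ∑ v, ∑ u, ep b t u v = 4 * ((N+3 : ℕ):ℝ)^2 * Sm b t := by rw [Finset.sum_comm, e]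
  unfold Zg
  simp only [Finset.sum_add_distrib, Finset.sum_const, Finset.card_univ, Fintype.card_fin, nsmul_eq_mul, e, ← Finset.mul_sum, e']
  unfold Sm
  push_cast
  field_simp
  ring

lemma rsq_sq_le (a : Fin (N+3) → Fin (N+3) → ℝ) : ∑ p, rsq a p ^ 2 ≤ ((N:ℝ)+3) * ∑ p, ∑ q, a p q ^ 4 := by
  rw [Finset.mul_sum]
  refine Finset.sum_le_sum fun p _ => ?_
  have := sq_sum_le_card_mul_sum_sq (s := (Finset.univ : Finset (Fin (N+3)))) (f := fun q => a p q ^ 2)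
  simp only [Finset.card_univ, Fintype.card_fin, ← pow_mul] at this
  push_cast at this
  exact this

lemma csq_sq_le (a : Fin (N+3) → Fin (N+3) → ℝ) : ∑ p, csq a p ^ 2 ≤ ((N:ℝ)+3) * ∑ p, ∑ q, a p q ^ 4 := by
  have := rsq_sq_le (fun i j => a j i)
  rw [Finset.sum_comm (f := fun p q => a p q ^ 4)]
  exact this

lemma E8_real {n S3 S4 RC A1 A2 A3 M2 M3 σ3 σ4 : ℝ} (hn : 100 ≤ n) (h2 : |A2| ≤ M2) (h3 : |A3| ≤ M3)
   (hS3 : |S3| ≤ σ3) (hS4 : S4 ≤ σ4) (hS40 : 0 ≤ S4) (hRC0 : 0 ≤ RC) (hRC : RC ≤ 2 * n * S4) (h1 : 1 ≤ σ4) :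
   |(-(n^2 * (n-1)) * A1 - (n * (n-1) - (n^2 * RC + 2 * n * (n-1)^2) / (2*n)) * A3
      + n^2 * S3 / 2 * A2 - (n^2 * S4 + 3 * (n-1)^2)/6 * A3) / (n^2 * (n-1)) 
      + A1 - (S3/n)/2 * A2 + (S4/n + 3/n - 3/n^2 * RC)/6 * A3| ≤ 
      10 * (M2 * (σ3/n) * (1/n) + M3 * (σ4/n) * (1/n)) := by
  have n0 : 0 < n := by linarith
  have n1 : 0 < n - 1 := by linarith
  have hM2 : 0 ≤ M2 := (abs_nonneg _).trans h2
  have hσ3 : 0 ≤ σ3 := (abs_nonneg _).trans hS3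
  have hM3 : 0 ≤ M3 := (abs_nonneg _).trans h3
  have e : (-(n^2 * (n-1)) * A1 - (n * (n-1) - (n^2 * RC + 2 * n * (n-1)^2) / (2*n)) * A3
      + n^2 * S3 / 2 * A2 - (n^2 * S4 + 3 * (n-1)^2)/6 * A3) / (n^2 * (n-1)) 
      + A1 - (S3/n)/2 * A2 + (S4/n + 3/n - 3/n^2 * RC)/6 * A3 =
      (S3/(2*n*(n-1))) * A2 + (RC/(2*n^2*(n-1)) - S4/(6*n*(n-1)) - 1/(2*n^2)) * A3 := by
    field_simp
    ring
  rw [e]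
  have i1 : 1/(n-1) ≤ 2 / n := by rw [div_le_div_iff₀ n1 n0]; linarith
  have b1 : |S3/(2*n*(n-1))| ≤ (σ3/n) * (1/n) := by
    rw [abs_div, abs_of_pos (by positivity : 0 < 2*n*(n-1))]
    have : |S3| / (2*n*(n-1)) = |S3| / (2*n) * (1/(n-1)) := by field_simp
    rw [this]
    calc |S3| / (2*n) * (1/(n-1)) ≤ σ3 / (2*n) * (2/n) := by gcongr
      _ = _ := by field_simp
  have b2 : |RC/(2*n^2*(n-1)) - S4/(6*n*(n-1)) - 1/(2*n^2)| ≤ 5 * ((σ4/n) * (1/n)) := by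
    have u1 : RC/(2*n^2*(n-1)) ≤ 2 * ((σ4/n) * (1/n)) := by
      have : RC/(2*n^2*(n-1)) = RC/(2*n^2) * (1/(n-1)) := by field_simp
      rw [this]
      calc RC/(2*n^2) * (1/(n-1)) ≤ (2 * n * σ4)/(2*n^2) * (2/n) := by
            gcongr; exact hRC.trans (by gcongr)
        _ = _ := by field_simp
    have u2 : S4/(6*n*(n-1)) ≤ (σ4/n) * (1/n) := by
      have : S4/(6*n*(n-1)) = S4/(6*n) * (1/(n-1)) := by field_simp
      rw [this]
      calc S4/(6*n) * (1/(n-1)) ≤ σ4/(6*n) * (2/n) := by gcongr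
        _ = (1/3) * ((σ4/n) * (1/n)) := by field_simp; norm_num
        _ ≤ _ := by
          have : 0 ≤ (σ4/n) * (1/n) := by positivity
          linarith
    have u3 : 1/(2*n^2) ≤ (σ4/n) * (1/n) := by
      calc 1/(2*n^2) ≤ 1/n^2 := by gcongr; nlinarith
        _ ≤ σ4/n^2 := by gcongr
        _ = _ := by field_simp
    have v1 : 0 ≤ RC/(2*n^2*(n-1)) := by positivity
    have v2 : 0 ≤ S4/(6*n*(n-1)) := by positivity
    have v3 : 0 ≤ 1/(2*n^2) := by positivity
    rw [abs_le]; constructor <;> linarith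
  have p1 : 0 ≤ (σ3/n) * (1/n) := (abs_nonneg _).trans b1
  have p2 : 0 ≤ (σ4/n) * (1/n) := by linarith [(abs_nonneg _).trans b2]
  refine (abs_add_le _ _).trans ?_
  rw [abs_mul, abs_mul]
  have q1 := mul_le_mul b1 h2 (abs_nonneg _) p1
  have q2 := mul_le_mul b2 h3 (abs_nonneg _) (by linarith)
  nlinarith [mul_nonneg hM2 p1, mul_nonneg hM3 p2]

set_option maxHeartbeats 1000000 in
lemma E8 (h : Std a b) {φ0 φ1 φ2 φ3 φ4 : ℝ → ℝ} (h0 : ∀ x, HasDerivAt φ0 (φ1 x) x)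
    (h1 : ∀ x, HasDerivAt φ1 (φ2 x) x) (h2 : ∀ x, HasDerivAt φ2 (φ3 x) x) (h3 : ∀ x, HasDerivAt φ3 (φ4 x) x)
    {τ : ℝ} (hτ : TauB a τ) {M2 M3 M4 : ℝ} (hM2 : Bd a φ2 M2) (hM3 : Bd a φ3 M3) (hM4 : Bd a φ4 M4)
    {s3 s4 s5 : ℝ} (hs3 : (∑ i, ∑ j, b i j ^ 3) / ((N:ℝ)+3) ≤ s3) (hs4 : (∑ i, ∑ j, b i j ^ 4) / ((N:ℝ)+3) ≤ s4)
    (hs5 : (∑ i, ∑ j, b i j ^ 5) / ((N:ℝ)+3) ≤ s5)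
    (X : ℝ) :
    |permExp (fun π : Equiv.Perm (Fin (N+3)) => (∑ i, a i (π i)) * φ0 (X - ∑ i, a i (π i)))
      + GG a φ1 id id X - ((∑ i, ∑ j, a i j ^ 3) / ((N:ℝ)+3))/2 * GG a φ2 id id X
      + ((∑ i, ∑ j, a i j ^ 4) / ((N:ℝ)+3) + 3/((N:ℝ)+3) - 3 / ((N:ℝ)+3)^2 * (∑ p, rsq a p ^ 2 + ∑ q, csq a q ^ 2))/6
         * GG a φ3 id id X|
    ≤ 10 ^ 16 * (M4 * s5 + τ * M3 * s3 + M2 * s3 * (1/((N:ℝ)+3)) + M3 * s4 * (1/((N:ℝ)+3))) := by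
  have hn := h.hn
  have hb := h.hb
  have hab := h.hab
  have hn0 : 0 < N + 3 := by omega
  have hnr : (100:ℝ) ≤ (N:ℝ)+3 := by exact_mod_cast hn
  have sid : StrictMono (id : Fin (N+3) → Fin (N+3)) := strictMono_id
  have a2 := hM2 _ (by omega) _ _ sid sid X
  have a3 := hM3 _ (by omega) _ _ sid sid X
  have m2 : 0 ≤ M2 := (abs_nonneg _).trans a2
  have m3 : 0 ≤ M3 := (abs_nonneg _).trans a3
  have m4 : 0 ≤ M4 := (abs_nonneg _).trans (hM4 _ (by omega) _ _ sid sid X)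
  have τ0 : 0 ≤ τ := (abs_nonneg _).trans (hτ _ (by omega) _ _ sid sid)
  have B0 : ∀ t, 0 ≤ ∑ i, ∑ j, b i j ^ t := fun t =>
    Finset.sum_nonneg fun i _ => Finset.sum_nonneg fun j _ => pow_nonneg (hb i j) t
  -- main term
  have mt := DD_outer h (GG a φ1 id id X) (GG a φ2 id id X) (GG a φ3 id id X)
  have hS3 : |∑ i, ∑ j, a i j ^ 3| ≤ ∑ i, ∑ j, b i j ^ 3 := by
    refine (Finset.abs_sum_le_sum_abs _ _).trans (Finset.sum_le_sum fun i _ => ?_)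
    refine (Finset.abs_sum_le_sum_abs _ _).trans (Finset.sum_le_sum fun j _ => ?_)
    rw [abs_pow]; exact pow_le_pow_left₀ (abs_nonneg _) (hab i j) 3
  have hS4 : ∑ i, ∑ j, a i j ^ 4 ≤ ∑ i, ∑ j, b i j ^ 4 := by
    refine (Finset.sum_le_sum fun i _ => ?_)
    refine (Finset.sum_le_sum fun j _ => ?_)
    have : a i j ^ 4 = |a i j| ^ 4 := by rw [Even.pow_abs ⟨2, rfl⟩]
    rw [this]; exact pow_le_pow_left₀ (abs_nonneg _) (hab i j) 4
  have hB4 : 1 ≤ ∑ i, ∑ j, b i j ^ 4 := by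
    have : ∑ i : Fin (N+3), ∑ j : Fin (N+3), (1/((N:ℝ)+3))^2 ≤ ∑ i, ∑ j, b i j ^ 4 := by
      refine (Finset.sum_le_sum fun i _ => ?_)
      refine (Finset.sum_le_sum fun j _ => ?_)
      have := h.hν i j
      push_cast at this
      calc (1/((N:ℝ)+3))^2 ≤ (b i j ^2)^2 := by gcongr
        _ = _ := by ring
    refine le_trans (le_of_eq ?_) this
    simp
    field_simp
  have hmain := E8_real (n := (N:ℝ)+3) (S3 := ∑ i, ∑ j, a i j ^ 3) (S4 := ∑ i, ∑ j, a i j ^ 4)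
    (RC := ∑ p, rsq a p ^ 2 + ∑ q, csq a q ^ 2) (A1 := GG a φ1 id id X) hnr a2 a3 hS3 hS4
    (Finset.sum_nonneg fun i _ => Finset.sum_nonneg fun j _ => by positivity) (by positivity)
    (by linarith [rsq_sq_le a, csq_sq_le a]) hB4
  have nn : (N:ℝ)+3 - 1 = N+2 := by ring
  rw [nn, ← mt] at hmain
  simp_rw [← DD_ext] at hmain
  -- error term
  rw [E0_id h]
  set D4 := ∑ p, ∑ q, a p q * ∑ k : Fin (N+2), ∑ l : Fin (N+2), DD a (GG a φ1 id id X) (GG a φ2 id id X) (GG a φ3 id id X) p q (p.succAbove k) (q.succAbove l) with hD4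
  set G4 := ∑ p, ∑ q, ∑ k : Fin (N+2), ∑ l : Fin (N+2), a p q *
      (GG a φ0 (p.succAbove ∘ k.succAbove) (q.succAbove ∘ l.succAbove) (X - (a p q + a (p.succAbove k) (q.succAbove l)))
      - GG a φ0 (p.succAbove ∘ k.succAbove) (q.succAbove ∘ l.succAbove) (X - (a p (q.succAbove l) + a (p.succAbove k) q))) with hG4
  set RR : Fin (N+3) → Fin (N+3) → Fin (N+3) → Fin (N+3) → ℝ := fun p q u v =>
    32 * 10 ^ 12 * (M4 * Zg b 5 p q u v + τ * M3 * Zg b 3 p q u v + M2 * Zg b 3 p q u v * (1/((N:ℝ)+3))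
       + M3 * Zg b 4 p q u v * (1/((N:ℝ)+3))) with hRR
  have z := fun t p q u v => Zg_nonneg hb t p q u v
  have RR0 : ∀ p q u v, 0 ≤ RR p q u v := by
    intro p q u v
    have := z 5 p q u v
    have := z 4 p q u v
    have := z 3 p q u v
    simp only [hRR]
    positivity
  have hdiff : |G4 - D4| ≤ ∑ p, ∑ q, ∑ u, ∑ v, RR p q u v := by
    have e : G4 - D4 = ∑ p, ∑ q, ∑ k : Fin (N+2), ∑ l : Fin (N+2), a p q * 
      ((GG a φ0 (p.succAbove ∘ k.succAbove) (q.succAbove ∘ l.succAbove) (X - (a p q + a (p.succAbove k) (q.succAbove l)))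
      - GG a φ0 (p.succAbove ∘ k.succAbove) (q.succAbove ∘ l.succAbove) (X - (a p (q.succAbove l) + a (p.succAbove k) q)))
      - DD a (GG a φ1 id id X) (GG a φ2 id id X) (GG a φ3 id id X) p q (p.succAbove k) (q.succAbove l)) := by
      rw [hG4, hD4]
      simp only [mul_sub, Finset.sum_sub_distrib, Finset.mul_sum]
    rw [e]
    refine (Finset.abs_sum_le_sum_abs _ _).trans (Finset.sum_le_sum fun p _ => ?_)
    refine (Finset.abs_sum_le_sum_abs _ _).trans (Finset.sum_le_sum fun q _ => ?_)
    refine le_trans ?_ (RS_sum_inj2 (ρ := p.succAbove) (γ := q.succAbove) Fin.succAbove_right_injective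
      Fin.succAbove_right_injective (RR0 p q))
    refine (Finset.abs_sum_le_sum_abs _ _).trans (Finset.sum_le_sum fun k _ => ?_)
    refine (Finset.abs_sum_le_sum_abs _ _).trans (Finset.sum_le_sum fun l _ => ?_)
    rw [abs_mul]
    have e1 := E1 h h0 h1 h2 h3 hτ hM2 hM3 hM4 X p q k l _ _ rfl rfl
    have r1 := RS_small_Z hn0 hb hab p q (p.succAbove k) (q.succAbove l)
    have r2 : |a p q| ≤ Zg b 1 p q (p.succAbove k) (q.succAbove l) := by
      have := abs_nonneg (a p (q.succAbove l))
      have := abs_nonneg (a (p.succAbove k) q)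
      have := abs_nonneg (a (p.succAbove k) (q.succAbove l))
      linarith
    have w2 := Zg_mul hn0 hb 1 2 p q (p.succAbove k) (q.succAbove l)
    have w3 := Zg_mul hn0 hb 1 3 p q (p.succAbove k) (q.succAbove l)
    have w4 := Zg_mul hn0 hb 1 4 p q (p.succAbove k) (q.succAbove l)
    refine (mul_le_mul r2 e1 (abs_nonneg _) (z _ _ _ _ _)).trans ?_
    simp only [hRR]
    norm_num only at w2 w3 w4
    generalize Zg b 1 p q (p.succAbove k) (q.succAbove l) = z1 at *
    generalize Zg b 2 p q (p.succAbove k) (q.succAbove l) = z2 at *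
    generalize Zg b 3 p q (p.succAbove k) (q.succAbove l) = z3 at *
    generalize Zg b 4 p q (p.succAbove k) (q.succAbove l) = z4 at *
    generalize Zg b 5 p q (p.succAbove k) (q.succAbove l) = z5 at *
    have i0 : 0 ≤ 1/((N:ℝ)+3) := by positivity
    have g1 := mul_le_mul_of_nonneg_left w4 m4
    have g2 := mul_le_mul_of_nonneg_left w2 (mul_nonneg τ0 m3)
    have g3 := mul_le_mul_of_nonneg_left w2 (mul_nonneg m2 i0)
    have g4 := mul_le_mul_of_nonneg_left w3 (mul_nonneg m3 i0)
    linarith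
  have hsum : ∑ p, ∑ q, ∑ u, ∑ v, RR p q u v = 32 * 10 ^ 12 * (16 * ((N:ℝ)+3)^2) * (M4 * (∑ u, ∑ v, b u v ^ 5) + τ * M3 * (∑ u, ∑ v, b u v ^ 3)
      + M2 * (∑ u, ∑ v, b u v ^ 3) * (1/((N:ℝ)+3)) + M3 * (∑ u, ∑ v, b u v ^ 4) * (1/((N:ℝ)+3))) := by
    simp only [hRR, ← Finset.mul_sum, Finset.sum_add_distrib, ← Finset.sum_mul, sum_Zg4]
    ring
  rw [hsum] at hdiff
  have hdd : |G4 / (((N:ℝ)+3)^2 * ((N:ℝ)+2)) - D4 / (((N:ℝ)+3)^2 * ((N:ℝ)+2))| ≤ 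
     1024 * 10 ^ 12 * (M4 * s5 + τ * M3 * s3 + M2 * s3 * (1/((N:ℝ)+3)) + M3 * s4 * (1/((N:ℝ)+3))) := by
    rw [← sub_div, abs_div, abs_of_pos (by positivity : (0:ℝ) < ((N:ℝ)+3)^2 * ((N:ℝ)+2))]
    rw [div_le_iff₀ (by positivity)]
    refine hdiff.trans ?_
    have f3 := (div_le_iff₀ (by positivity)).1 hs3
    have f4 := (div_le_iff₀ (by positivity)).1 hs4
    have f5 := (div_le_iff₀ (by positivity)).1 hs5
    have t3 : 0 ≤ s3 := le_trans (div_nonneg (B0 3) (by positivity)) hs3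
    have t4 : 0 ≤ s4 := le_trans (div_nonneg (B0 4) (by positivity)) hs4
    have t5 : 0 ≤ s5 := le_trans (div_nonneg (B0 5) (by positivity)) hs5
    calc _ ≤ 32 * 10 ^ 12 * (16 * ((N:ℝ)+3)^2) * (M4 * (s5 * ((N:ℝ)+3)) + τ * M3 * (s3 * ((N:ℝ)+3))
      + M2 * (s3 * ((N:ℝ)+3)) * (1/((N:ℝ)+3)) + M3 * (s4 * ((N:ℝ)+3)) * (1/((N:ℝ)+3))) := by gcongr
      _ = 512 * 10 ^ 12 * (M4 * s5 + τ * M3 * s3 + M2 * s3 * (1/((N:ℝ)+3)) + M3 * s4 * (1/((N:ℝ)+3))) * (((N:ℝ)+3)^2 * ((N:ℝ)+3)) := by ring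
      _ ≤ 512 * 10 ^ 12 * (M4 * s5 + τ * M3 * s3 + M2 * s3 * (1/((N:ℝ)+3)) + M3 * s4 * (1/((N:ℝ)+3))) * (((N:ℝ)+3)^2 * (2 * ((N:ℝ)+2))) := by
        gcongr; linarith
      _ = _ := by ring
  have hmain2 : 10 * (M2 * ((∑ i, ∑ j, b i j ^ 3) / ((N:ℝ)+3)) * (1 / ((N:ℝ)+3)) + M3 * ((∑ i, ∑ j, b i j ^ 4) / ((N:ℝ)+3)) * (1 / ((N:ℝ)+3)))
     ≤ 10 * (M4 * s5 + τ * M3 * s3 + M2 * s3 * (1/((N:ℝ)+3)) + M3 * s4 * (1/((N:ℝ)+3))) := by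
    have t3 : 0 ≤ s3 := le_trans (div_nonneg (B0 3) (by positivity)) hs3
    have t5 : 0 ≤ s5 := le_trans (div_nonneg (B0 5) (by positivity)) hs5
    calc _ ≤ 10 * (M2 * s3 * (1/((N:ℝ)+3)) + M3 * s4 * (1/((N:ℝ)+3))) := by gcongr
      _ ≤ _ := by
        have := mul_nonneg m4 t5
        have := mul_nonneg (mul_nonneg τ0 m3) t3
        linarith
  have hm := hmain.trans hmain2
  clear_value D4 G4
  generalize ((N:ℝ)+3)^2 * ((N:ℝ)+2) = dd at *
  generalize (∑ i, ∑ j, a i j ^ 3) / ((N:ℝ)+3)/2 * GG a φ2 id id X = Y1 at *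
  generalize ((∑ i, ∑ j, a i j ^ 4) / ((N:ℝ)+3) + 3/((N:ℝ)+3) - 3 / ((N:ℝ)+3)^2 * (∑ p, rsq a p ^ 2 + ∑ q, csq a q ^ 2))/6
         * GG a φ3 id id X = Y2 at *
  generalize M4 * s5 + τ * M3 * s3 + M2 * s3 * (1/((N:ℝ)+3)) + M3 * s4 * (1/((N:ℝ)+3)) = Y3 at *
  have := abs_le.1 hm
  have := abs_le.1 hdd
  rw [abs_le]
  constructor <;> linarith
end E8

end Part8

section Part9

/-- The standardized situation. -/
structure Sit {n : ℕ} (a : Fin n → Fin n → ℝ) (E : ℝ) : Prop where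
  row : ∀ i, ∑ j, a i j = 0
  col : ∀ j, ∑ i, a i j = 0
  sq : ∑ i, ∑ j, a i j ^ 2 = (n:ℝ) - 1
  E0 : 0 < E
  eta : ∑ i, ∑ j, |a i j| ^ 5 = n * E ^ 3
  n2 : 2 ≤ n

section Sit
variable {n : ℕ} {a : Fin n → Fin n → ℝ} {E : ℝ}

lemma Sit.n0 (h : Sit a E) : (2:ℝ) ≤ n := by exact_mod_cast h.n2

lemma pw3 {t E : ℝ} (ht : 0 ≤ t) (hE : 0 < E) : t ^ 3 ≤ E * t ^ 2 + t ^ 5 / E ^ 2 := by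
  rcases le_total t E with h | h
  · have : 0 ≤ t ^ 5 / E ^ 2 := by positivity
    have : t ^ 3 ≤ E * t ^ 2 := by
      calc t ^ 3 = t * t ^ 2 := by ring
        _ ≤ _ := by gcongr
    linarith
  · have : 0 ≤ E * t ^ 2 := by positivity
    have : t ^ 3 ≤ t ^ 5 / E ^ 2 := by
      rw [le_div_iff₀ (by positivity)]
      calc t ^ 3 * E ^ 2 ≤ t ^ 3 * t ^ 2 := by gcongr
        _ = _ := by ring
    linarith

lemma pw4 {t E : ℝ} (ht : 0 ≤ t) (hE : 0 < E) : t ^ 4 ≤ E ^ 2 * t ^ 2 + t ^ 5 / E := by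
  rcases le_total t E with h | h
  · have : 0 ≤ t ^ 5 / E := by positivity
    have : t ^ 4 ≤ E ^ 2 * t ^ 2 := by
      calc t ^ 4 = t ^ 2 * t ^ 2 := by ring
        _ ≤ _ := by gcongr
    linarith
  · have : 0 ≤ E ^ 2 * t ^ 2 := by positivity
    have : t ^ 4 ≤ t ^ 5 / E := by
      rw [le_div_iff₀ (by positivity)]
      calc t ^ 4 * E ≤ t ^ 4 * t := by gcongr
        _ = _ := by ring
    linarith

lemma pw2 {t E : ℝ} (ht : 0 ≤ t) (hE : 0 < E) : t ^ 2 ≤ E ^ 2 + t ^ 5 / E ^ 3 := by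
  rcases le_total t E with h | h
  · have : 0 ≤ t ^ 5 / E ^ 3 := by positivity
    have : t ^ 2 ≤ E ^ 2 := by gcongr
    linarith
  · have : 0 ≤ E ^ 2 := by positivity
    have : t ^ 2 ≤ t ^ 5 / E ^ 3 := by
      rw [le_div_iff₀ (by positivity)]
      calc t ^ 2 * E ^ 3 ≤ t ^ 2 * t ^ 3 := by gcongr
        _ = _ := by ring
    linarith

lemma Sit.s3 (h : Sit a E) : ∑ i, ∑ j, |a i j| ^ 3 ≤ 2 * n * E := by
  have hE := h.E0
  have : ∑ i, ∑ j, |a i j| ^ 3 ≤ ∑ i, ∑ j, (E * a i j ^ 2 + |a i j| ^ 5 / E ^ 2) := by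
    refine Finset.sum_le_sum fun i _ => Finset.sum_le_sum fun j _ => ?_
    have := pw3 (abs_nonneg (a i j)) hE
    rwa [sq_abs] at this
  refine this.trans ?_
  simp only [Finset.sum_add_distrib, ← Finset.mul_sum, ← Finset.sum_div, h.sq, h.eta]
  have : (n:ℝ) * E ^ 3 / E ^ 2 = n * E := by field_simp
  rw [this]
  linarith

lemma Sit.s4 (h : Sit a E) : ∑ i, ∑ j, a i j ^ 4 ≤ 2 * n * E ^ 2 := by
  have hE := h.E0
  have : ∑ i, ∑ j, a i j ^ 4 ≤ ∑ i, ∑ j, (E ^ 2 * a i j ^ 2 + |a i j| ^ 5 / E) := by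
    refine Finset.sum_le_sum fun i _ => Finset.sum_le_sum fun j _ => ?_
    have := pw4 (abs_nonneg (a i j)) hE
    rwa [sq_abs, Even.pow_abs ⟨2, rfl⟩] at this
  refine this.trans ?_
  simp only [Finset.sum_add_distrib, ← Finset.mul_sum, ← Finset.sum_div, h.sq, h.eta]
  have : (n:ℝ) * E ^ 3 / E = n * E ^ 2 := by field_simp
  rw [this]
  have : 0 < E ^ 2 := by positivity
  linarith

lemma Sit.inv_n (h : Sit a E) : 1 / (n:ℝ) ≤ 16 * E ^ 2 := by
  have hE := h.E0
  have hn := h.n0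
  by_contra hc
  push Not at hc
  set δ := 1 / (2 * Real.sqrt n) with hδ
  have sn : 0 < Real.sqrt n := Real.sqrt_pos.2 (by linarith)
  have sq : Real.sqrt n ^ 2 = n := Real.sq_sqrt (by linarith)
  have δ0 : 0 < δ := by positivity
  have δ2 : n * δ ^ 2 = 1 / 4 := by
    rw [hδ, div_pow, mul_pow, sq]; field_simp; norm_num
  have hlt : 2 * E < δ := by
    have : (2 * E) ^ 2 < δ ^ 2 := by
      have e : 1 / (n:ℝ) = 4 * δ ^ 2 := by field_simp; linarith
      nlinarith
    exact lt_of_pow_lt_pow_left₀ 2 δ0.le this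
  have : ∑ i, ∑ j, a i j ^ 2 ≤ ∑ i : Fin n, ∑ j : Fin n, (δ ^ 2 + |a i j| ^ 5 / δ ^ 3) := by
    refine Finset.sum_le_sum fun i _ => Finset.sum_le_sum fun j _ => ?_
    have := pw2 (abs_nonneg (a i j)) δ0
    rwa [sq_abs] at this
  simp only [Finset.sum_add_distrib, ← Finset.sum_div, h.sq, h.eta, Finset.sum_const, Finset.card_univ, Fintype.card_fin, nsmul_eq_mul] at this
  have h8 : E ^ 3 / δ ^ 3 ≤ 1 / 8 := by
    rw [div_le_iff₀ (by positivity)]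
    have : (2 * E) ^ 3 ≤ δ ^ 3 := by gcongr
    nlinarith
  have e : (n:ℝ) * E ^ 3 / δ ^ 3 = n * (E ^ 3 / δ ^ 3) := by ring
  rw [e, δ2] at this
  nlinarith

/-- the majorant -/
noncomputable def bb (a : Fin n → Fin n → ℝ) : Fin n → Fin n → ℝ := fun i j => |a i j| + 1 / Real.sqrt n

lemma Sit.nu (h : Sit a E) : 1 / Real.sqrt n ≤ 4 * E ∧ (1 / Real.sqrt n) ^ 2 = 1 / n := by
  have hE := h.E0
  have hn := h.n0
  have sq : Real.sqrt n ^ 2 = n := Real.sq_sqrt (by linarith)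
  have e : (1 / Real.sqrt n) ^ 2 = 1 / n := by rw [div_pow, sq, one_pow]
  refine ⟨?_, e⟩
  refine le_of_sq_le_sq ?_ (by positivity) 
  rw [e, mul_pow]; have := h.inv_n; linarith

lemma Sit.hn100 (h : Sit a E) (hE1 : E ≤ 1/40) : 100 ≤ n := by
  have h1 := h.inv_n
  have h2 := h.n0
  have hE := h.E0
  have : (100:ℝ) ≤ n := by
    rw [div_le_iff₀ (by linarith)] at h1
    have : 16 * E ^ 2 ≤ 1 / 100 := by nlinarith
    nlinarith
  exact_mod_cast this

lemma Sit.std (h : Sit a E) (hE1 : E ≤ 1/40) : Std a (bb a) where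
  row := h.row
  col := h.col
  sq := h.sq
  hb := fun i j => by unfold bb; positivity
  hab := fun i j => by unfold bb; have : 0 ≤ 1 / Real.sqrt n := by positivity
                       linarith
  hν := fun i j => by
    rw [← h.nu.2]; unfold bb
    have : 0 ≤ 1 / Real.sqrt n := by positivity
    have := abs_nonneg (a i j)
    gcongr; linarith
  hn := h.hn100 hE1

lemma Sit.b5 (h : Sit a E) : (∑ i, ∑ j, bb a i j ^ 5) / (n:ℝ) ≤ 1040 * E ^ 3 := by
  have hE := h.E0
  have hn := h.n0
  obtain ⟨h1, h2⟩ := h.nu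
  have n0 : 0 ≤ 1 / Real.sqrt n := by positivity
  rw [div_le_iff₀ (by linarith)]
  have : ∑ i, ∑ j, bb a i j ^ 5 ≤ ∑ i : Fin n, ∑ j : Fin n, (16 * (|a i j| ^ 5) + 16 * (1 / Real.sqrt n) ^ 5) := by
    refine Finset.sum_le_sum fun i _ => Finset.sum_le_sum fun j _ => ?_
    have := add_pow_le (abs_nonneg (a i j)) n0 5
    unfold bb; linarith
  refine this.trans ?_
  simp only [Finset.sum_add_distrib, ← Finset.mul_sum, h.eta, Finset.sum_const, Finset.card_univ, Fintype.card_fin, nsmul_eq_mul]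
  have e : 16 * ((n:ℝ) * (n * (1 / Real.sqrt n) ^ 5)) = 16 * n * (1 / Real.sqrt n) ^ 3 := by
    have : (1 / Real.sqrt n) ^ 5 = (1 / Real.sqrt n) ^ 3 * (1 / n) := by rw [← h2]; ring
    rw [this]; field_simp
  rw [e]
  have : (1 / Real.sqrt n) ^ 3 ≤ (4 * E) ^ 3 := by gcongr
  calc _ ≤ 16 * (n * E ^ 3) + 16 * n * (4 * E) ^ 3 := by gcongr
    _ = _ := by ring

lemma Sit.b4 (h : Sit a E) : (∑ i, ∑ j, bb a i j ^ 4) / (n:ℝ) ≤ 144 * E ^ 2 := by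
  have hE := h.E0
  have hn := h.n0
  obtain ⟨h1, h2⟩ := h.nu
  have h3 := h.s4
  have n0 : 0 ≤ 1 / Real.sqrt n := by positivity
  rw [div_le_iff₀ (by linarith)]
  have : ∑ i, ∑ j, bb a i j ^ 4 ≤ ∑ i : Fin n, ∑ j : Fin n, (8 * (a i j ^ 4) + 8 * (1 / Real.sqrt n) ^ 4) := by
    refine Finset.sum_le_sum fun i _ => Finset.sum_le_sum fun j _ => ?_
    have := add_pow_le (abs_nonneg (a i j)) n0 4
    rw [Even.pow_abs (n := 4) ⟨2, rfl⟩] at this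
    unfold bb; linarith
  refine this.trans ?_
  simp only [Finset.sum_add_distrib, ← Finset.mul_sum, Finset.sum_const, Finset.card_univ, Fintype.card_fin, nsmul_eq_mul]
  have e : 8 * ((n:ℝ) * (n * (1 / Real.sqrt n) ^ 4)) = 8 * n * (1 / Real.sqrt n) ^ 2 := by
    have : (1 / Real.sqrt n) ^ 4 = (1 / Real.sqrt n) ^ 2 * (1 / n) := by rw [← h2]; ring
    rw [this]; field_simp
  rw [e]
  have : (1 / Real.sqrt n) ^ 2 ≤ (4 * E) ^ 2 := by gcongr
  calc _ ≤ 8 * (2 * n * E ^ 2) + 8 * n * (4 * E) ^ 2 := by gcongr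
    _ = _ := by ring

lemma Sit.b3 (h : Sit a E) : (∑ i, ∑ j, bb a i j ^ 3) / (n:ℝ) ≤ 24 * E := by
  have hE := h.E0
  have hn := h.n0
  obtain ⟨h1, h2⟩ := h.nu
  have h3 := h.s3
  have n0 : 0 ≤ 1 / Real.sqrt n := by positivity
  rw [div_le_iff₀ (by linarith)]
  have : ∑ i, ∑ j, bb a i j ^ 3 ≤ ∑ i : Fin n, ∑ j : Fin n, (4 * (|a i j| ^ 3) + 4 * (1 / Real.sqrt n) ^ 3) := by
    refine Finset.sum_le_sum fun i _ => Finset.sum_le_sum fun j _ => ?_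
    have := add_pow_le (abs_nonneg (a i j)) n0 3
    unfold bb; linarith
  refine this.trans ?_
  simp only [Finset.sum_add_distrib, ← Finset.mul_sum, Finset.sum_const, Finset.card_univ, Fintype.card_fin, nsmul_eq_mul]
  have e : 4 * ((n:ℝ) * (n * (1 / Real.sqrt n) ^ 3)) = 4 * n * (1 / Real.sqrt n) := by
    have : (1 / Real.sqrt n) ^ 3 = (1 / Real.sqrt n) * (1 / n) := by rw [← h2]; ring
    rw [this]; field_simp
  rw [e]
  calc _ ≤ 4 * (2 * n * E) + 4 * n * (4 * E) := by gcongr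
    _ = _ := by ring

lemma Sit.amax (h : Sit a E) (i j : Fin n) : |a i j| ≤ 10 * E ^ 2 * n := by
  have hE := h.E0
  have hn := h.n0
  have h1 := h.inv_n
  have h4 : a i j ^ 4 ≤ 2 * n * E ^ 2 := by
    refine le_trans ?_ h.s4
    refine le_trans ?_ (Finset.single_le_sum (f := fun i => ∑ j, a i j ^ 4) (fun i _ => Finset.sum_nonneg fun j _ => by positivity) (Finset.mem_univ i))
    exact (Finset.single_le_sum (f := fun j => a i j ^ 4) (fun j _ => by positivity) (Finset.mem_univ j))
  have : |a i j| ^ 4 ≤ (10 * E ^ 2 * n) ^ 4 := by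
    rw [Even.pow_abs (n := 4) ⟨2, rfl⟩]
    refine h4.trans ?_
    have h2 : 1 ≤ 16 * E ^ 2 * n := by rwa [div_le_iff₀ (by linarith)] at h1
    calc 2 * n * E ^ 2 = 2 * n * E ^ 2 * 1 ^ 3 := by ring
      _ ≤ 2 * n * E ^ 2 * (16 * E ^ 2 * n) ^ 3 := by gcongr
      _ = 8192 * (E ^ 8 * n ^ 4) := by ring
      _ ≤ 10000 * (E ^ 8 * n ^ 4) := by gcongr; norm_num
      _ = _ := by ring
  exact le_of_pow_le_pow_left₀ (by norm_num) (by positivity) this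

lemma Sit.tau (h : Sit a E) (hE1 : E ≤ 1/40) : TauB a (5120 * E ^ 2) := by
  classical
  intro m hm ρ γ hρ hγ
  have hE := h.E0
  have hn := h.n0
  have h100 := h.hn100 hE1
  set R := Finset.univ.image ρ with hR
  set S := Finset.univ.image γ with hS
  have cR : Rᶜ.card ≤ 16 := by
    rw [Finset.card_compl, Finset.card_image_of_injective _ hρ.injective]; simp; omega
  have cS : Sᶜ.card ≤ 16 := by
    rw [Finset.card_compl, Finset.card_image_of_injective _ hγ.injective]; simp; omega
  have e1 : ∑ i, ∑ c, a (ρ i) (γ c) = ∑ u ∈ R, ∑ v ∈ S, a u v := by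
    rw [hR, Finset.sum_image (fun x _ y _ h => hρ.injective h)]
    refine Finset.sum_congr rfl fun i _ => ?_
    rw [hS, Finset.sum_image (fun x _ y _ h => hγ.injective h)]
  have e2 : ∑ u ∈ R, ∑ v ∈ S, a u v = ∑ u ∈ Rᶜ, ∑ v ∈ Sᶜ, a u v := by
    have f1 : ∀ u, ∑ v ∈ S, a u v = - ∑ v ∈ Sᶜ, a u v := by
      intro u
      have := Finset.sum_add_sum_compl S (fun v => a u v)
      rw [h.row] at this; linarith
    simp_rw [f1]
    rw [Finset.sum_neg_distrib]
    have := Finset.sum_add_sum_compl R (fun u => ∑ v ∈ Sᶜ, a u v)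
    rw [Finset.sum_comm (s := Finset.univ)] at this
    simp only [h.col, Finset.sum_const_zero] at this
    linarith
  have b1 : |∑ u ∈ Rᶜ, ∑ v ∈ Sᶜ, a u v| ≤ 256 * (10 * E ^ 2 * n) := by
    have k0 : 0 ≤ 10 * E ^ 2 * n := by positivity
    have k1 : ∀ u, |∑ v ∈ Sᶜ, a u v| ≤ 16 * (10 * E ^ 2 * n) := by
      intro u
      refine (Finset.abs_sum_le_sum_abs _ _).trans ?_
      refine (Finset.sum_le_card_nsmul _ _ _ (fun v _ => h.amax u v)).trans ?_
      rw [nsmul_eq_mul]; gcongr; exact_mod_cast cS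
    refine (Finset.abs_sum_le_sum_abs _ _).trans ?_
    refine (Finset.sum_le_card_nsmul _ _ _ (fun u _ => k1 u)).trans ?_
    rw [nsmul_eq_mul]
    have : (Rᶜ.card : ℝ) ≤ 16 := by exact_mod_cast cR
    nlinarith
  rw [e1, e2, abs_div, Nat.abs_cast]
  have hmr : (n:ℝ) ≤ 2 * m := by
    have : n ≤ 2 * m := by omega
    exact_mod_cast this
  rw [div_le_iff₀ (by linarith)]
  refine b1.trans ?_
  nlinarith [sq_nonneg E]

lemma Sit.l1 (h : Sit a E) : |(∑ i, ∑ j, a i j ^ 3) / (n:ℝ)| ≤ 2 * E := by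
  have hn := h.n0
  rw [abs_div, Nat.abs_cast, div_le_iff₀ (by linarith)]
  have : |∑ i, ∑ j, a i j ^ 3| ≤ ∑ i, ∑ j, |a i j| ^ 3 := by
    refine (Finset.abs_sum_le_sum_abs _ _).trans (Finset.sum_le_sum fun i _ => ?_)
    refine (Finset.abs_sum_le_sum_abs _ _).trans (Finset.sum_le_sum fun j _ => ?_)
    rw [abs_pow]
  linarith [h.s3]

lemma rsq_sq_le' (a : Fin n → Fin n → ℝ) : ∑ p, rsq a p ^ 2 ≤ (n:ℝ) * ∑ p, ∑ q, a p q ^ 4 := by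
  rw [Finset.mul_sum]
  refine Finset.sum_le_sum fun p _ => ?_
  have := sq_sum_le_card_mul_sum_sq (s := (Finset.univ : Finset (Fin n))) (f := fun q => a p q ^ 2)
  simp only [Finset.card_univ, Fintype.card_fin, ← pow_mul] at this
  exact this

lemma Sit.l2 (h : Sit a E) : |(∑ i, ∑ j, a i j ^ 4) / (n:ℝ) + 3/(n:ℝ) - 3 / (n:ℝ)^2 * (∑ p, rsq a p ^ 2 + ∑ q, csq a q ^ 2)| ≤ 60 * E ^ 2 := by
  have hn := h.n0
  have h4 := h.s4
  have h5 : 0 ≤ ∑ i, ∑ j, a i j ^ 4 := Finset.sum_nonneg fun i _ => Finset.sum_nonneg fun j _ => by positivity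
  have h6 := rsq_sq_le' a
  have h7 : ∑ p, csq a p ^ 2 ≤ (n:ℝ) * ∑ p, ∑ q, a p q ^ 4 := by
    have := rsq_sq_le' (fun i j => a j i)
    rw [Finset.sum_comm (f := fun p q => a p q ^ 4)]
    exact this
  have h8 : 0 ≤ ∑ p, rsq a p ^ 2 + ∑ q, csq a q ^ 2 := by positivity
  have h9 : (∑ i, ∑ j, a i j ^ 4) / (n:ℝ) ≤ 2 * E ^ 2 := by rw [div_le_iff₀ (by linarith)]; linarith
  have h10 : 3 / (n:ℝ)^2 * (∑ p, rsq a p ^ 2 + ∑ q, csq a q ^ 2) ≤ 12 * E ^ 2 := by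
    calc _ ≤ 3 / (n:ℝ)^2 * (2 * n * (2 * n * E ^ 2)) := by gcongr; nlinarith
      _ = _ := by field_simp; ring
  have h11 := h.inv_n
  have h12 : 3/(n:ℝ) = 3 * (1/n) := by ring
  have : 0 ≤ 1/(n:ℝ) := by positivity
  have : 0 ≤ (∑ i, ∑ j, a i j ^ 4) / (n:ℝ) := by positivity
  have : 0 ≤ 3 / (n:ℝ)^2 * (∑ p, rsq a p ^ 2 + ∑ q, csq a q ^ 2) := by positivity
  have := sq_nonneg E
  rw [h12, abs_le]; constructor <;> linarith

end Sit

lemma Sit.exp {N : ℕ} {a : Fin (N+3) → Fin (N+3) → ℝ} {E : ℝ} (h : Sit a E) (hE1 : E ≤ 1/40) {φ0 φ1 φ2 φ3 φ4 : ℝ → ℝ} (h0 : ∀ x, HasDerivAt φ0 (φ1 x) x)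
    (h1 : ∀ x, HasDerivAt φ1 (φ2 x) x) (h2 : ∀ x, HasDerivAt φ2 (φ3 x) x) (h3 : ∀ x, HasDerivAt φ3 (φ4 x) x)
    {M2 M3 M4 : ℝ} (hM2 : Bd a φ2 M2) (hM3 : Bd a φ3 M3) (hM4 : Bd a φ4 M4) (X : ℝ) :
    |permExp (fun π : Equiv.Perm (Fin (N+3)) => (∑ i, a i (π i)) * φ0 (X - ∑ i, a i (π i)))
      + GG a φ1 id id X - ((∑ i, ∑ j, a i j ^ 3) / ((N+3:ℕ):ℝ))/2 * GG a φ2 id id X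
      + ((∑ i, ∑ j, a i j ^ 4) / ((N+3:ℕ):ℝ) + 3/((N+3:ℕ):ℝ) - 3 / ((N+3:ℕ):ℝ)^2 * (∑ p, rsq a p ^ 2 + ∑ q, csq a q ^ 2))/6
         * GG a φ3 id id X| ≤ 10 ^ 22 * E ^ 3 * (M2 + M3 + M4) := by
  have b3 := h.b3
  have b4 := h.b4
  have b5 := h.b5
  have hi := h.inv_n
  push_cast at b3 b4 b5 hi ⊢
  have hE := h.E0
  have sid : StrictMono (id : Fin (N+3) → Fin (N+3)) := strictMono_id
  have m2 : 0 ≤ M2 := (abs_nonneg _).trans (hM2 _ (by omega) _ _ sid sid X)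
  have m3 : 0 ≤ M3 := (abs_nonneg _).trans (hM3 _ (by omega) _ _ sid sid X)
  have m4 : 0 ≤ M4 := (abs_nonneg _).trans (hM4 _ (by omega) _ _ sid sid X)
  refine (E8 (h.std hE1) h0 h1 h2 h3 (h.tau hE1) hM2 hM3 hM4 b3 b4 b5 X).trans ?_
  have i0 : 0 ≤ 1 / ((N:ℝ)+3) := by positivity
  calc _ ≤ 10 ^ 16 * (M4 * (1040 * E ^ 3) + 5120 * E ^ 2 * M3 * (24 * E) + M2 * (24 * E) * (16 * E ^ 2) + M3 * (144 * E ^ 2) * (16 * E ^ 2)) := by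
        gcongr
    _ = 10 ^ 16 * (1040 * (M4 * E ^ 3) + 122880 * (M3 * E ^ 3) + 384 * (M2 * E ^ 3) + 2304 * (M3 * E ^ 3) * E) := by ring
    _ ≤ 10 ^ 16 * (1040 * (M4 * E ^ 3) + 122880 * (M3 * E ^ 3) + 384 * (M2 * E ^ 3) + 2304 * (M3 * E ^ 3) * (1/40)) := by gcongr
    _ ≤ _ := by
      have : 0 ≤ M4 * E ^ 3 := by positivity
      have : 0 ≤ M3 * E ^ 3 := by positivity
      have : 0 ≤ M2 * E ^ 3 := by positivity
      linarith

end Part9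

section Part10

/-- smooth version of `y₊²/2` and its derivatives -/
noncomputable def vv (j : ℕ) : ℝ → ℝ := iteratedDeriv j (fun y => y ^ 2 / 2 * Real.smoothTransition y)

lemma vv_smooth : ContDiff ℝ (⊤ : ℕ∞) (fun y => y ^ 2 / 2 * Real.smoothTransition y) := by
  have := Real.smoothTransition.contDiff (n := (⊤ : ℕ∞))
  fun_prop

lemma vv_deriv (j : ℕ) (y : ℝ) : HasDerivAt (vv j) (vv (j+1) y) y := by
  have h : Differentiable ℝ (vv j) := by
    unfold vv
    exact vv_smooth.differentiable_iteratedDeriv j (by exact_mod_cast ENat.natCast_lt_top j)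
  have := (h y).hasDerivAt
  unfold vv at this ⊢
  rwa [iteratedDeriv_succ]

lemma vv_cont (j : ℕ) : Continuous (vv j) := by
  rw [continuous_iff_continuousAt]
  exact fun y => (vv_deriv j y).continuousAt

lemma deriv_zero_of_eqOn_Iic {f g f' g' : ℝ → ℝ} (hf : ∀ y, HasDerivAt f (f' y) y) (hg : ∀ y, HasDerivAt g (g' y) y)
    {c : ℝ} (h : ∀ y ≤ c, f y = g y) : ∀ y ≤ c, f' y = g' y := by
  intro y hy
  have h1 : HasDerivWithinAt f (f' y) (Set.Iic y) y := (hf y).hasDerivWithinAt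
  have h2 : HasDerivWithinAt f (g' y) (Set.Iic y) y :=
    (hg y).hasDerivWithinAt.congr (fun z hz => h z (le_trans hz hy)) (h y hy)
  exact (uniqueDiffWithinAt_Iic y).eq_deriv _ h1 h2

lemma deriv_eq_of_eqOn_Ici {f g f' g' : ℝ → ℝ} (hf : ∀ y, HasDerivAt f (f' y) y) (hg : ∀ y, HasDerivAt g (g' y) y)
    {c : ℝ} (h : ∀ y, c ≤ y → f y = g y) : ∀ y, c ≤ y → f' y = g' y := by
  intro y hy
  have h1 : HasDerivWithinAt f (f' y) (Set.Ici y) y := (hf y).hasDerivWithinAt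
  have h2 : HasDerivWithinAt f (g' y) (Set.Ici y) y :=
    (hg y).hasDerivWithinAt.congr (fun z hz => h z (le_trans hy hz)) (h y hy)
  exact (uniqueDiffWithinAt_Ici y).eq_deriv _ h1 h2

lemma vv_neg (j : ℕ) : ∀ y ≤ 0, vv j y = 0 := by
  induction j with
  | zero =>
    intro y hy
    simp [vv, Real.smoothTransition.zero_of_nonpos hy]
  | succ j ih =>
    exact deriv_zero_of_eqOn_Iic (g := fun _ => 0) (g' := fun _ => 0) (vv_deriv j) (fun y => hasDerivAt_const y 0) ih

lemma vv0_pos : ∀ y, 1 ≤ y → vv 0 y = y ^ 2 / 2 := by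
  intro y hy
  simp [vv, Real.smoothTransition.one_of_one_le hy]

lemma vv1_pos : ∀ y, 1 ≤ y → vv 1 y = y := by
  refine deriv_eq_of_eqOn_Ici (g := fun y => y ^ 2 / 2) (vv_deriv 0) (fun y => ?_) vv0_pos
  have := ((hasDerivAt_id y).pow 2).div_const 2
  refine this.congr_deriv ?_
  simp

lemma vv2_pos : ∀ y, 1 ≤ y → vv 2 y = 1 :=
  deriv_eq_of_eqOn_Ici (g := fun y => y) (g' := fun _ => 1) (vv_deriv 1) (fun y => hasDerivAt_id y) vv1_pos

lemma vv3_pos (j : ℕ) : ∀ y, 1 ≤ y → vv (j+3) y = 0 := by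
  induction j with
  | zero => exact deriv_eq_of_eqOn_Ici (g := fun y => 1) (g' := fun _ => 0) (vv_deriv 2) (fun y => hasDerivAt_const y 1) vv2_pos
  | succ j ih => exact deriv_eq_of_eqOn_Ici (g := fun y => 0) (g' := fun _ => 0) (vv_deriv (j+3)) (fun y => hasDerivAt_const y 0) ih

lemma vv_bdd : ∃ M : ℝ, 1 ≤ M ∧ ∀ j ≤ 8, ∀ y, 0 ≤ y → y ≤ 1 → |vv j y| ≤ M := by
  have h : ∀ j, ∃ M : ℝ, ∀ y ∈ Set.Icc (0:ℝ) 1, |vv j y| ≤ M := by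
    intro j
    obtain ⟨M, hM⟩ := isCompact_Icc.exists_bound_of_continuousOn (vv_cont j).continuousOn (s := Set.Icc (0:ℝ) 1)
    exact ⟨M, hM⟩
  choose M hM using h
  refine ⟨1 + ∑ j ∈ Finset.range 9, |M j|, ?_, ?_⟩
  · have : 0 ≤ ∑ j ∈ Finset.range 9, |M j| := Finset.sum_nonneg fun _ _ => abs_nonneg _
    linarith
  · intro j hj y h0 h1
    have := hM j y ⟨h0, h1⟩
    have h2 : |M j| ≤ ∑ j ∈ Finset.range 9, |M j| :=
      Finset.single_le_sum (f := fun j => |M j|) (fun _ _ => abs_nonneg _) (Finset.mem_range.2 (by omega))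
    have := le_abs_self (M j)
    linarith

/-- scaled kernels -/
noncomputable def VV (E : ℝ) (j : ℕ) (y : ℝ) : ℝ := E ^ 2 / E ^ j * vv j (y / E)

lemma VV_deriv {E : ℝ} (hE : 0 < E) (j : ℕ) (y : ℝ) : HasDerivAt (VV E j) (VV E (j+1) y) y := by
  have h1 : HasDerivAt (fun y : ℝ => y / E) (1 / E) y := (hasDerivAt_id y).div_const E
  have h2 := ((vv_deriv j (y / E)).comp y h1).const_mul (E ^ 2 / E ^ j)
  refine HasDerivAt.congr_deriv h2 ?_
  unfold VV
  field_simp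
  ring

lemma VV_cont {E : ℝ} (hE : 0 < E) (j : ℕ) : Continuous (VV E j) := by
  rw [continuous_iff_continuousAt]
  exact fun y => (VV_deriv hE j y).continuousAt

lemma VV_neg {E : ℝ} (hE : 0 < E) (j : ℕ) {y : ℝ} (hy : y ≤ 0) : VV E j y = 0 := by
  unfold VV
  rw [vv_neg j _ (div_nonpos_of_nonpos_of_nonneg hy hE.le), mul_zero]

lemma VV0_pos {E : ℝ} (hE : 0 < E) {y : ℝ} (hy : E ≤ y) : VV E 0 y = y ^ 2 / 2 := by
  unfold VV
  rw [vv0_pos _ ((one_le_div hE).2 hy)]; field_simp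

lemma VV1_pos {E : ℝ} (hE : 0 < E) {y : ℝ} (hy : E ≤ y) : VV E 1 y = y := by
  unfold VV
  rw [vv1_pos _ ((one_le_div hE).2 hy)]; field_simp

lemma VV2_pos {E : ℝ} (hE : 0 < E) {y : ℝ} (hy : E ≤ y) : VV E 2 y = 1 := by
  unfold VV
  rw [vv2_pos _ ((one_le_div hE).2 hy)]; field_simp

lemma VV3_pos {E : ℝ} (hE : 0 < E) (j : ℕ) {y : ℝ} (hy : E ≤ y) : VV E (j+3) y = 0 := by
  unfold VV
  rw [vv3_pos j _ ((one_le_div hE).2 hy)]; simp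

lemma VV_bd {E M : ℝ} (hE : 0 < E) (hM : ∀ j ≤ 8, ∀ y, 0 ≤ y → y ≤ 1 → |vv j y| ≤ M) {j : ℕ} (hj : j ≤ 8) {y : ℝ}
    (h0 : 0 ≤ y) (h1 : y ≤ E) : |VV E j y| ≤ M * (E ^ 2 / E ^ j) := by
  unfold VV
  rw [abs_mul, abs_of_pos (by positivity), mul_comm]
  gcongr
  exact hM j hj _ (by positivity) ((div_le_one hE).2 h1)

/-- layer-cake formula -/
lemma layer {φ φ' : ℝ → ℝ} {E : ℝ} (hE : 0 < E) (hd : ∀ y, HasDerivAt φ (φ' y) y) (hc : Continuous φ')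
    (h0 : ∀ y ≤ 0, φ y = 0) (h1 : ∀ y, E ≤ y → φ y = φ E) (w : ℝ) :
    IntervalIntegrable (fun s => φ' s * (if s ≤ w then (1:ℝ) else 0)) volume 0 E ∧
    ∫ s in (0:ℝ)..E, φ' s * (if s ≤ w then (1:ℝ) else 0) = φ w := by
  have hi : ∀ p q : ℝ, IntervalIntegrable (fun s => φ' s * (if s ≤ w then (1:ℝ) else 0)) volume p q := by
    intro p q
    have h2 : IntervalIntegrable φ' volume p q := hc.intervalIntegrable _ _
    have : (fun s => φ' s * (if s ≤ w then (1:ℝ) else 0)) = Set.indicator (Set.Iic w) φ' := by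
      funext s; simp [Set.indicator]
    rw [this]
    constructor
    · exact h2.1.indicator measurableSet_Iic
    · exact h2.2.indicator measurableSet_Iic
  refine ⟨hi 0 E, ?_⟩
  have ftc : ∀ p q, ∫ s in p..q, φ' s = φ q - φ p := fun p q =>
    intervalIntegral.integral_eq_sub_of_hasDerivAt (fun x _ => hd x) (hc.intervalIntegrable _ _)
  have z : ∀ p q, w ≤ p → p ≤ q → ∫ s in p..q, φ' s * (if s ≤ w then (1:ℝ) else 0) = 0 := by
    intro p q h hpq
    apply intervalIntegral.integral_zero_ae
    refine Filter.Eventually.of_forall fun s hs => ?_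
    rw [Set.uIoc_of_le hpq] at hs
    rw [if_neg (by have := hs.1; linarith), mul_zero]
  have o : ∀ p q, p ≤ q → q ≤ w → ∫ s in p..q, φ' s * (if s ≤ w then (1:ℝ) else 0) = φ q - φ p := by
    intro p q hpq hq
    rw [← ftc]
    apply intervalIntegral.integral_congr
    intro s hs
    rw [Set.uIcc_of_le hpq] at hs
    simp [hs.2.trans hq]
  rcases le_total w 0 with hw | hw
  · rw [z 0 E hw hE.le, h0 w hw]
  rcases le_total w E with hw' | hw'
  · rw [← intervalIntegral.integral_add_adjacent_intervals (hi 0 w) (hi w E), z w E le_rfl hw', o 0 w hw le_rfl, h0 0 le_rfl]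
    ring
  · rw [o 0 E hE.le hw', h1 w hw', h0 0 le_rfl]; ring

lemma permExp_layer {m : ℕ} (T : Equiv.Perm (Fin m) → ℝ) {φ φ' : ℝ → ℝ} {E : ℝ} (hE : 0 < E) (hd : ∀ y, HasDerivAt φ (φ' y) y) (hc : Continuous φ')
    (h0 : ∀ y ≤ 0, φ y = 0) (h1 : ∀ y, E ≤ y → φ y = φ E) (X : ℝ) :
    IntervalIntegrable (fun s => φ' s * permExp (fun π => if T π ≤ X - s then (1:ℝ) else 0)) volume 0 E ∧
    ∫ s in (0:ℝ)..E, φ' s * permExp (fun π => if T π ≤ X - s then (1:ℝ) else 0) = permExp (fun π => φ (X - T π)) := by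
  have e : (fun s => φ' s * permExp (fun π => if T π ≤ X - s then (1:ℝ) else 0)) = 
    fun s => (∑ π : Equiv.Perm (Fin m), φ' s * (if s ≤ X - T π then (1:ℝ) else 0)) / (Nat.factorial m : ℝ) := by
    funext s
    unfold permExp
    rw [mul_div_assoc', Finset.mul_sum]
    congr 1
    refine Finset.sum_congr rfl fun π _ => ?_
    have : T π ≤ X - s ↔ s ≤ X - T π := by constructor <;> intro h <;> linarith
    simp only [this]
  have hl := fun w => layer hE hd hc h0 h1 w
  rw [e]
  constructor
  · apply IntervalIntegrable.div_const
    have : (fun s => ∑ π : Equiv.Perm (Fin m), φ' s * (if s ≤ X - T π then (1:ℝ) else 0)) = 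
       ∑ π : Equiv.Perm (Fin m), fun s => φ' s * (if s ≤ X - T π then (1:ℝ) else 0) := by
      funext s; simp
    rw [this]
    exact IntervalIntegrable.sum _ fun π _ => (hl _).1
  · rw [intervalIntegral.integral_div, intervalIntegral.integral_finsetSum (fun π _ => (hl _).1)]
    simp only [(hl _).2]
    rfl

/-- integral against quadratics -/
lemma quad_int {E : ℝ} (hE : 0 < E) (i : ℕ) (c0 c1 c2 : ℝ) :
    ∫ s in (0:ℝ)..E, VV E (i+3) s * (c0 + c1 * s + c2 * s ^ 2) =
      VV E (i+2) E * (c0 + c1 * E + c2 * E ^ 2) - VV E (i+1) E * (c1 + 2 * c2 * E) + VV E i E * (2 * c2) := by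
  have : ∀ s ∈ Set.uIcc 0 E, HasDerivAt (fun s => VV E (i+2) s * (c0 + c1 * s + c2 * s ^ 2) - VV E (i+1) s * (c1 + 2 * c2 * s) + VV E i s * (2 * c2))
     (VV E (i+3) s * (c0 + c1 * s + c2 * s ^ 2)) s := by
    intro s _
    have d1 : HasDerivAt (fun s : ℝ => c0 + c1 * s + c2 * s ^ 2) (c1 + 2 * c2 * s) s := by
      have := (((hasDerivAt_id s).const_mul c1).const_add c0).add (((hasDerivAt_id s).pow 2).const_mul c2)
      refine this.congr_deriv ?_
      simp; ring
    have d2 : HasDerivAt (fun s : ℝ => c1 + 2 * c2 * s) (2 * c2) s := by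
      have := ((hasDerivAt_id s).const_mul (2 * c2)).const_add c1
      refine this.congr_deriv ?_; simp
    have := (((VV_deriv hE (i+2) s).mul d1).sub ((VV_deriv hE (i+1) s).mul d2)).add ((VV_deriv hE i s).mul_const (2 * c2))
    refine this.congr_deriv ?_
    ring
  rw [intervalIntegral.integral_eq_sub_of_hasDerivAt this
    (Continuous.intervalIntegrable (by have := VV_cont hE (i+3); fun_prop) _ _)]
  simp only [VV_neg hE _ le_rfl]
  ring

lemma quad_bound {m : ℕ} (T : Equiv.Perm (Fin m) → ℝ) {E M : ℝ} (hE : 0 < E) (hM : ∀ j ≤ 8, ∀ y, 0 ≤ y → y ≤ 1 → |vv j y| ≤ M)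
    (i : ℕ) (hi : i ≤ 5) (X c0 c1 c2 δ : ℝ) (h : ∀ s, 0 ≤ s → s ≤ E → |permExp (fun π => if T π ≤ X - s then (1:ℝ) else 0) - (c0 + c1 * s + c2 * s ^ 2)| ≤ δ) :
    |permExp (fun π => VV E (i+2) (X - T π)) - (VV E (i+2) E * (c0 + c1 * E + c2 * E ^ 2) - VV E (i+1) E * (c1 + 2 * c2 * E) + VV E i E * (2 * c2))| ≤
      M * (E ^ 2 / E ^ (i+3)) * δ * E := by
  have h1 : ∀ y, E ≤ y → VV E (i+2) y = VV E (i+2) E := by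
    intro y hy
    rcases i with _ | i
    · rw [VV2_pos hE hy, VV2_pos hE le_rfl]
    · rw [VV3_pos hE i hy, VV3_pos hE i le_rfl]
  obtain ⟨a1, a2⟩ := permExp_layer T hE (VV_deriv hE (i+2)) (VV_cont hE (i+3)) (fun y => VV_neg hE (i+2)) h1 X
  rw [← a2, ← quad_int hE i, ← intervalIntegral.integral_sub a1 
    (Continuous.intervalIntegrable (by have := VV_cont hE (i+3); fun_prop) _ _)]
  have := intervalIntegral.norm_integral_le_of_norm_le_const (a := 0) (b := E) (C := M * (E ^ 2 / E ^ (i+3)) * δ)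
     (f := fun s => VV E (i+3) s * permExp (fun π => if T π ≤ X - s then (1:ℝ) else 0) - VV E (i+3) s * (c0 + c1 * s + c2 * s ^ 2)) ?_
  · rw [sub_zero, abs_of_pos hE] at this
    exact this
  · intro s hs
    rw [Set.uIoc_of_le hE.le] at hs
    rw [← mul_sub, Real.norm_eq_abs, abs_mul]
    exact mul_le_mul (VV_bd hE hM (by omega) hs.1.le hs.2) (h s hs.1.le hs.2) (abs_nonneg _)
      ((abs_nonneg _).trans (VV_bd hE hM (by omega) hs.1.le hs.2))

end Part10

section Part11

lemma interp_quad {E : ℝ} (hE : 0 < E) (F : ℝ → ℝ) (X : ℝ) : ∃ c1 c2 : ℝ, ∀ s,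
    interp E 2 (X - E) F (X - s) = F X + c1 * s + c2 * s ^ 2 := by
  refine ⟨-(Δiter E 1 F (X - E)) / E - (Δiter E 2 F (X - E)) / (2 * E), (Δiter E 2 F (X - E)) / (2 * E ^ 2), fun s => ?_⟩
  have h1 : F X = F (X - E) + Δiter E 1 F (X - E) := by
    simp [Δiter]
  rw [h1]
  unfold interp
  have e1 : Finset.Icc 1 2 = {1, 2} := by decide
  have e2 : Finset.Icc 1 1 = {1} := by decide
  rw [e1, Finset.sum_pair (by norm_num), e1, e2, Finset.prod_pair (by norm_num), Finset.prod_singleton]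
  push_cast
  generalize Δiter E 1 F (X - E) = d1
  generalize Δiter E 2 F (X - E) = d2
  field_simp
  ring

/-- hypothesis (i) -/
def Hyp {n : ℕ} (a : Fin n → Fin n → ℝ) (E C2 : ℝ) : Prop :=
  ∀ m : ℕ, n ≤ m + 16 → ∀ ρ γ : Fin m → Fin n, StrictMono ρ → StrictMono γ → ∀ z x : ℝ, z ≤ x → x ≤ z + 3 * E →
    |Fr (fun i j => a (ρ i) (γ j)) x - interp E 2 z (Fr (fun i j => a (ρ i) (γ j))) x| ≤ C2 * (E ^ 3 + (x - z) ^ 3)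

section H
variable {n : ℕ} {a : Fin n → Fin n → ℝ} {E C2 M : ℝ}

lemma Hyp.quad (h : Hyp a E C2) (hE : 0 < E) (hC : 0 ≤ C2) {m : ℕ} (hm : n ≤ m + 16) {ρ γ : Fin m → Fin n} (hρ : StrictMono ρ)
    (hγ : StrictMono γ) (X : ℝ) : ∃ c1 c2 : ℝ, ∀ s, 0 ≤ s → s ≤ E → 
      |permExp (fun π => if rankT (fun i j => a (ρ i) (γ j)) π ≤ X - s then (1:ℝ) else 0) - (Fr (fun i j => a (ρ i) (γ j)) X + c1 * s + c2 * s ^ 2)| ≤ 2 * C2 * E ^ 3 := by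
  obtain ⟨c1, c2, hc⟩ := interp_quad hE (Fr (fun i j => a (ρ i) (γ j))) X
  refine ⟨c1, c2, fun s h0 h1 => ?_⟩
  have := h m hm ρ γ hρ hγ (X - E) (X - s) (by linarith) (by linarith)
  rw [hc] at this
  refine le_trans this ?_
  have : (X - s - (X - E)) ^ 3 ≤ E ^ 3 := by
    apply pow_le_pow_left₀ <;> linarith
  nlinarith

lemma Hyp.V2 (h : Hyp a E C2) (hE : 0 < E) (hC : 0 ≤ C2) (hM : ∀ j ≤ 8, ∀ y, 0 ≤ y → y ≤ 1 → |vv j y| ≤ M)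
    {m : ℕ} (hm : n ≤ m + 16) {ρ γ : Fin m → Fin n} (hρ : StrictMono ρ)
    (hγ : StrictMono γ) (X : ℝ) : |GG a (VV E 2) ρ γ X - Fr (fun i j => a (ρ i) (γ j)) X| ≤ 2 * M * C2 * E ^ 3 := by
  obtain ⟨c1, c2, hc⟩ := h.quad hE hC hm hρ hγ X
  have := quad_bound (rankT (fun i j => a (ρ i) (γ j))) hE hM 0 (by norm_num) X _ c1 c2 _ hc
  rw [VV2_pos hE le_rfl, VV1_pos hE le_rfl, VV0_pos hE le_rfl] at this
  have e : 1 * (Fr (fun i j => a (ρ i) (γ j)) X + c1 * E + c2 * E ^ 2) - E * (c1 + 2 * c2 * E) + E ^ 2 / 2 * (2 * c2) = Fr (fun i j => a (ρ i) (γ j)) X := by ring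
  rw [e] at this
  refine le_trans this (le_of_eq ?_)
  field_simp

lemma Hyp.V5 (h : Hyp a E C2) (hE : 0 < E) (hC : 0 ≤ C2) (hM : ∀ j ≤ 8, ∀ y, 0 ≤ y → y ≤ 1 → |vv j y| ≤ M) {j : ℕ} (hj : j ≤ 2) :
    Bd a (VV E (j+5)) (2 * M * C2 / E ^ j) := by
  intro m hm ρ γ hρ hγ X
  obtain ⟨c1, c2, hc⟩ := h.quad hE hC hm hρ hγ X
  have := quad_bound (rankT (fun i j => a (ρ i) (γ j))) hE hM (j+3) (by omega) X _ c1 c2 _ hc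
  rw [VV3_pos hE j le_rfl, VV3_pos hE (j+1) le_rfl, VV3_pos hE (j+2) le_rfl] at this
  simp only [zero_mul, sub_zero, add_zero] at this
  refine le_trans this (le_of_eq ?_)
  field_simp
  ring

lemma GG_bound {φ : ℝ → ℝ} (h : ∀ y, |φ y| ≤ M) {m : ℕ} (ρ γ : Fin m → Fin n) (x : ℝ) : |GG a φ ρ γ x| ≤ M := by
  unfold GG permExp
  rw [abs_div, Nat.abs_cast, div_le_iff₀ (by positivity)]
  refine (Finset.abs_sum_le_sum_abs _ _).trans ?_
  refine (Finset.sum_le_card_nsmul _ _ _ (fun π _ => h _)).trans ?_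
  rw [nsmul_eq_mul, Finset.card_univ, Fintype.card_perm, Fintype.card_fin, mul_comm]

lemma VV2_bd (hE : 0 < E) (hM1 : 1 ≤ M) (hM : ∀ j ≤ 8, ∀ y, 0 ≤ y → y ≤ 1 → |vv j y| ≤ M) (y : ℝ) : |VV E 2 y| ≤ M := by
  rcases le_total y 0 with h | h
  · rw [VV_neg hE 2 h, abs_zero]; linarith
  rcases le_total y E with h' | h'
  · have := VV_bd hE hM (j := 2) (by norm_num) h h'
    rwa [div_self (by positivity), mul_one] at this
  · rw [VV2_pos hE h', abs_one]; exact hM1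

/-- Landau type bound -/
lemma landau {u0 u1 u2 u3 : ℝ → ℝ} (h0 : ∀ x, HasDerivAt u0 (u1 x) x) (h1 : ∀ x, HasDerivAt u1 (u2 x) x)
    (h2 : ∀ x, HasDerivAt u2 (u3 x) x) {A B : ℝ} (hA : ∀ x, |u0 x| ≤ A) (hB : ∀ x, |u3 x| ≤ B) (x : ℝ) :
    |u1 x| ≤ A + B ∧ |u2 x| ≤ 4 * A + 2 * B := by
  have t1 := RS_T3 h0 h1 h2 hB x 1
  have t2 := RS_T3 h0 h1 h2 hB x (-1)
  have a0 := abs_le.1 (hA x)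
  have a1 := abs_le.1 (hA (x - 1))
  have a2 := abs_le.1 (hA (x - -1))
  norm_num at t1 t2
  norm_num at a2
  have t1 := abs_le.1 t1
  have t2 := abs_le.1 t2
  constructor
  · rw [abs_le]; constructor <;> linarith
  · rw [abs_le]; constructor <;> linarith
end H

end Part11

section Part12

section ODE
open Filter Topology

lemma maxp_le {Y w w' : ℝ → ℝ} (h0 : ∀ x, HasDerivAt Y (w x) x) (h1 : ∀ x, HasDerivAt w (w' x) x)
    {c q : ℝ} (hc : 0 < c) (hq : 0 ≤ q) (hQ : ∀ x, |w' x + x * w x - c * Y x| ≤ q)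
    (ht : Tendsto Y (cocompact ℝ) (𝓝 0)) (x : ℝ) : Y x ≤ q / c := by
  by_contra hx
  push Not at hx
  have hpos : 0 < Y x := lt_of_le_of_lt (by positivity) hx
  have hcont : Continuous Y := continuous_iff_continuousAt.2 (fun x => (h0 x).continuousAt)
  obtain ⟨x1, hx1⟩ := hcont.exists_forall_ge' x (by
    filter_upwards [ht.eventually (gt_mem_nhds hpos)] with y hy using hy.le)
  have hm : IsLocalMax Y x1 := Filter.Eventually.of_forall hx1
  have hw0 : w x1 = 0 := hm.hasDerivAt_eq_zero (h0 x1)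
  have hd : deriv Y = w := funext fun x => (h0 x).deriv
  have hq1 := (abs_le.1 (hQ x1)).1
  rw [hw0] at hq1
  have hY : q < c * Y x1 := by
    have := lt_of_lt_of_le hx (hx1 x)
    rw [div_lt_iff₀ hc] at this
    linarith
  have hw' : 0 < w' x1 := by linarith
  have hmin : IsLocalMin Y x1 := by
    apply isLocalMin_of_deriv_deriv_pos
    · rw [hd, (h1 x1).deriv]; exact hw'
    · rw [hd]; exact hw0
    · exact hcont.continuousAt
  have hconst : Y =ᶠ[𝓝 x1] fun _ => Y x1 := by
    filter_upwards [hm, hmin] with y a b using le_antisymm a b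
  have h2 := hconst.deriv
  rw [hd] at h2
  have h3 := h2.deriv_eq
  rw [(h1 x1).deriv] at h3
  simp at h3
  linarith

lemma maxp {Y w w' : ℝ → ℝ} (h0 : ∀ x, HasDerivAt Y (w x) x) (h1 : ∀ x, HasDerivAt w (w' x) x)
    {c q : ℝ} (hc : 0 < c) (hq : 0 ≤ q) (hQ : ∀ x, |w' x + x * w x - c * Y x| ≤ q)
    (ht : Tendsto Y (cocompact ℝ) (𝓝 0)) (x : ℝ) : |Y x| ≤ q / c := by
  rw [abs_le']
  refine ⟨maxp_le h0 h1 hc hq hQ ht x, ?_⟩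
  refine maxp_le (Y := fun x => - Y x) (w := fun x => - w x) (w' := fun x => - w' x) (fun x => (h0 x).neg) (fun x => (h1 x).neg) hc hq ?_ ?_ x
  · intro x
    rw [← abs_neg]
    refine le_trans (le_of_eq ?_) (hQ x)
    congr 1; ring
  · simpa using ht.neg

lemma exp_drv (x : ℝ) : HasDerivAt (fun x : ℝ => Real.exp (x ^ 2 / 2)) (x * Real.exp (x ^ 2 / 2)) x := by
  have h : HasDerivAt (fun x : ℝ => x ^ 2 / 2) x x := by
    have := (hasDerivAt_pow 2 x).div_const 2
    refine this.congr_deriv ?_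
    norm_num
  refine h.exp.congr_deriv ?_
  ring

lemma drift_pos {w w' : ℝ → ℝ} (h1 : ∀ x, HasDerivAt w (w' x) x) {s : ℝ} (hs : ∀ x, |w' x + x * w x| ≤ s) {x : ℝ} (hx : 0 ≤ x) :
    Real.exp (x ^ 2 / 2) * w x ≤ w 0 + Real.exp (x ^ 2 / 2) * (s * (2 * x / (1 + x ^ 2))) := by
  have hs0 : 0 ≤ s := (abs_nonneg _).trans (hs 0)
  have hb : ∀ x : ℝ, HasDerivAt (fun x : ℝ => 2 * x / (1 + x ^ 2)) ((2 * (1 + x ^ 2) - 2 * x * (2 * x)) / (1 + x ^ 2) ^ 2) x := by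
    intro x
    have n : HasDerivAt (fun x : ℝ => 2 * x) 2 x := by
      simpa using (hasDerivAt_id x).const_mul 2
    have d : HasDerivAt (fun x : ℝ => 1 + x ^ 2) (2 * x) x := by
      simpa using (hasDerivAt_pow 2 x).const_add 1
    exact n.div d (by positivity)
  let f := fun x : ℝ => Real.exp (x ^ 2 / 2) * (s * (2 * x / (1 + x ^ 2)) - w x)
  have hf : ∀ x, HasDerivAt f (x * Real.exp (x ^ 2 / 2) * (s * (2 * x / (1 + x ^ 2)) - w x) + Real.exp (x ^ 2 / 2) * (s * ((2 * (1 + x ^ 2) - 2 * x * (2 * x)) / (1 + x ^ 2) ^ 2) - w' x)) x :=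
    fun x => (exp_drv x).mul (((hb x).const_mul s).sub (h1 x))
  have hmono : MonotoneOn f (Set.Ici 0) := by
    apply monotoneOn_of_deriv_nonneg (convex_Ici 0)
    · exact fun x _ => (hf x).continuousAt.continuousWithinAt
    · exact fun x _ => (hf x).differentiableAt.differentiableWithinAt
    · intro x hx
      rw [interior_Ici] at hx
      have hx : 0 < x := hx
      rw [(hf x).deriv]
      have e1 : x * (2 * x / (1 + x ^ 2)) + (2 * (1 + x ^ 2) - 2 * x * (2 * x)) / (1 + x ^ 2) ^ 2 = 1 + (x^4+1 - 2 * x ^ 2 ) / (1 + x ^ 2) ^ 2 := by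
        field_simp; ring
      have e2 : 0 ≤ (x^4+1 - 2 * x ^ 2 ) / (1 + x ^ 2) ^ 2 := by
        apply div_nonneg _ (by positivity)
        nlinarith [sq_nonneg (x ^ 2 - 1)]
      have e3 := mul_nonneg hs0 e2
      have e4 := (abs_le.1 (hs x)).2
      have : x * Real.exp (x ^ 2 / 2) * (s * (2 * x / (1 + x ^ 2)) - w x) + Real.exp (x ^ 2 / 2) * (s * ((2 * (1 + x ^ 2) - 2 * x * (2 * x)) / (1 + x ^ 2) ^ 2) - w' x) = 
        Real.exp (x ^ 2 / 2) * (s * (x * (2 * x / (1 + x ^ 2)) + (2 * (1 + x ^ 2) - 2 * x * (2 * x)) / (1 + x ^ 2) ^ 2) - (w' x + x * w x)) := by ring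
      rw [this, e1]
      apply mul_nonneg (Real.exp_pos _).le
      linarith
  have := hmono (Set.mem_Ici.2 le_rfl) (Set.mem_Ici.2 hx) hx
  simp only [f] at this
  norm_num at this
  linarith

lemma drift_abs_pos {w w' : ℝ → ℝ} (h1 : ∀ x, HasDerivAt w (w' x) x) {s : ℝ} (hs : ∀ x, |w' x + x * w x| ≤ s) {x : ℝ} (hx : 0 ≤ x) :
    |w x| ≤ |w 0| * Real.exp (-(x ^ 2 / 2)) + s * (2 * x / (1 + x ^ 2)) := by
  have a := drift_pos h1 hs hx
  have b := drift_pos (w := fun x => - w x) (w' := fun x => - w' x) (fun x => (h1 x).neg) (s := s) (fun x => by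
    rw [← abs_neg]
    refine le_trans (le_of_eq ?_) (hs x)
    congr 1; ring) hx
  have hp := Real.exp_pos (x ^ 2 / 2)
  have : Real.exp (x ^ 2 / 2) * |w x| ≤ |w 0| + Real.exp (x ^ 2 / 2) * (s * (2 * x / (1 + x ^ 2))) := by
    rcases abs_cases (w x) with ⟨e, _⟩ | ⟨e, _⟩ <;> rw [e]
    · linarith [le_abs_self (w 0)]
    · linarith [neg_abs_le (w 0)]
  rw [Real.exp_neg]
  have h2 : |w x| = (Real.exp (x ^ 2 / 2))⁻¹ * (Real.exp (x ^ 2 / 2) * |w x|) := by field_simp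
  rw [h2]
  refine (mul_le_mul_of_nonneg_left this (by positivity)).trans (le_of_eq ?_)
  field_simp

lemma drift_abs {w w' : ℝ → ℝ} (h1 : ∀ x, HasDerivAt w (w' x) x) {s : ℝ} (hs : ∀ x, |w' x + x * w x| ≤ s) (x : ℝ) :
    |w x| ≤ |w 0| * Real.exp (-(x ^ 2 / 2)) + s * (2 * |x| / (1 + x ^ 2)) := by
  rcases le_total 0 x with h | h
  · rw [abs_of_nonneg h]; exact drift_abs_pos h1 hs h
  · have := drift_abs_pos (w := fun x => w (-x)) (w' := fun x => - w' (-x)) (s := s) (fun x => by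
      have := (h1 (-x)).comp x (hasDerivAt_neg x)
      refine this.congr_deriv ?_
      ring) (fun x => by
        rw [← abs_neg]
        refine le_trans (le_of_eq ?_) (hs (-x))
        congr 1; ring) (x := -x) (by linarith)
    simp only [neg_neg, neg_zero, neg_sq] at this
    rw [abs_of_nonpos h]
    exact this

lemma drift0 {Y w w' : ℝ → ℝ} (h0 : ∀ x, HasDerivAt Y (w x) x) (h1 : ∀ x, HasDerivAt w (w' x) x) {s y0 : ℝ} (hs : ∀ x, |w' x + x * w x| ≤ s)
    (hy : ∀ x, |Y x| ≤ y0) : |w 0| ≤ 2 * s + 4 * y0 := by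
  have hs0 : 0 ≤ s := (abs_nonneg _).trans (hs 0)
  have hy0 : 0 ≤ y0 := (abs_nonneg _).trans (hy 0)
  obtain ⟨ξ, hξ, e⟩ := exists_hasDerivAt_eq_slope Y w (zero_lt_one) (fun x _ => (h0 x).continuousAt.continuousWithinAt) (fun x _ => h0 x)
  have hf : ∀ x, HasDerivAt (fun x => Real.exp (x ^ 2 / 2) * w x) (x * Real.exp (x ^ 2 / 2) * w x + Real.exp (x ^ 2 / 2) * w' x) x :=
    fun x => (exp_drv x).mul (h1 x)
  obtain ⟨ζ, hζ, e'⟩ := exists_hasDerivAt_eq_slope _ _ hξ.1 (fun x _ => (hf x).continuousAt.continuousWithinAt) (fun x _ => hf x)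
  have hexp : ∀ x : ℝ, 0 ≤ x → x ≤ 1 → Real.exp (x ^ 2 / 2) ≤ 2 := by
    intro x a b
    have : x ^ 2 / 2 ≤ 1 / 2 := by nlinarith
    refine (Real.exp_le_exp.2 this).trans ?_
    have h4 : Real.exp (1/2) ^ 2 ≤ 2 ^ 2 := by
      rw [← Real.exp_nat_mul]; norm_num
      exact Real.exp_one_lt_d9.le.trans (by norm_num)
    exact (pow_le_pow_iff_left₀ (Real.exp_pos _).le (by norm_num) (by norm_num)).1 h4
  have w1 : |w ξ| ≤ 2 * y0 := by
    rw [e]; norm_num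
    rw [abs_le]
    have a := abs_le.1 (hy 1)
    have b := abs_le.1 (hy 0)
    constructor <;> linarith
  have hξ1 := hξ.2
  have hξ0 := hξ.1
  have e2 : w 0 = Real.exp (ξ ^ 2 / 2) * w ξ - ξ * (Real.exp (ζ ^ 2 / 2) * (w' ζ + ζ * w ζ)) := by
    rw [eq_div_iff (by linarith)] at e'
    norm_num at e'
    linear_combination e'
  have b1 : |Real.exp (ξ ^ 2 / 2) * w ξ| ≤ 2 * (2 * y0) := by
    rw [abs_mul, abs_of_pos (Real.exp_pos _)]
    exact mul_le_mul (hexp ξ hξ.1.le hξ.2.le) w1 (abs_nonneg _) (by norm_num)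
  have b2 : |ξ * (Real.exp (ζ ^ 2 / 2) * (w' ζ + ζ * w ζ))| ≤ 1 * (2 * s) := by
    rw [abs_mul, abs_mul, abs_of_pos (Real.exp_pos _), abs_of_pos hξ0]
    refine mul_le_mul hξ1.le ?_ (by positivity) (by norm_num)
    exact mul_le_mul (hexp ζ hζ.1.le (by linarith [hζ.2])) (hs ζ) (abs_nonneg _) (by norm_num)
  rw [e2]
  refine (abs_sub _ _).trans ?_
  linarith

lemma drift {Y w w' : ℝ → ℝ} (h0 : ∀ x, HasDerivAt Y (w x) x) (h1 : ∀ x, HasDerivAt w (w' x) x) {s y0 : ℝ} (hs : ∀ x, |w' x + x * w x| ≤ s)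
    (hy : ∀ x, |Y x| ≤ y0) (x : ℝ) : |w x| ≤ 3 * s + 4 * y0 ∧ |w' x| ≤ 5 * s + 4 * y0 := by
  have hs0 : 0 ≤ s := (abs_nonneg _).trans (hs 0)
  have a := drift_abs h1 hs x
  have b := drift0 h0 h1 hs hy
  have hx0 := abs_nonneg x
  have e1 : 2 * |x| / (1 + x ^ 2) ≤ 1 := by
    rw [div_le_one (by positivity), ← sq_abs]
    nlinarith [sq_nonneg (|x| - 1)]
  have e2 : |x| * (2 * |x| / (1 + x ^ 2)) ≤ 2 := by
    rw [← mul_div_assoc, div_le_iff₀ (by positivity), ← sq_abs]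
    nlinarith [sq_nonneg (|x| - 1)]
  have e3 : Real.exp (-(x ^ 2 / 2)) ≤ 1 := by
    rw [Real.exp_le_one_iff]; nlinarith [sq_nonneg x]
  have e4 : |x| * Real.exp (-(x ^ 2 / 2)) ≤ 1 := by
    rw [Real.exp_neg, ← div_eq_mul_inv, div_le_one (Real.exp_pos _)]
    refine le_trans ?_ (Real.add_one_le_exp _)
    rw [← sq_abs]
    nlinarith [sq_nonneg (|x| - 1)]
  constructor
  · have := mul_le_mul_of_nonneg_left e3 (abs_nonneg (w 0))
    have := mul_le_mul_of_nonneg_left e1 hs0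
    linarith
  · have k1 := mul_le_mul_of_nonneg_left e4 (abs_nonneg (w 0))
    have k2 := mul_le_mul_of_nonneg_left e2 hs0
    have k3 := mul_le_mul_of_nonneg_left a hx0
    have k4 : |x * w x| ≤ |w 0| + 2 * s := by
      rw [abs_mul]; linarith
    have k5 := abs_le.1 (hs x)
    have k6 := abs_le.1 k4
    rw [abs_le]
    constructor <;> linarith

lemma ode_chain {W0 W1 W2 W3 W4 W5 W6 : ℝ → ℝ} (h0 : ∀ x, HasDerivAt W0 (W1 x) x) (h1 : ∀ x, HasDerivAt W1 (W2 x) x)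
    (h2 : ∀ x, HasDerivAt W2 (W3 x) x) (h3 : ∀ x, HasDerivAt W3 (W4 x) x)
    {E K l1 l2 : ℝ} (hE : 0 < E) (hE1 : E ≤ 1) (hl1 : |l1| ≤ 2 * E) (hl2 : |l2| ≤ 60 * E ^ 2)
    (hW4 : ∀ x, |W4 x| ≤ K) (hW5 : ∀ x, |W5 x| ≤ K) (hW6 : ∀ x, |W6 x| ≤ K / E)
    (ht0 : Tendsto W0 (cocompact ℝ) (𝓝 0)) (ht1 : Tendsto W1 (cocompact ℝ) (𝓝 0))
    (O1 : ∀ x, |W2 x + x * W1 x - 2 * W0 x - l1 / 2 * W3 x + l2 / 6 * W4 x| ≤ K * E ^ 3)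
    (O2 : ∀ x, |W3 x + x * W2 x - W1 x - l1 / 2 * W4 x + l2 / 6 * W5 x| ≤ K * E ^ 2)
    (O3 : ∀ x, |W4 x + x * W3 x - l1 / 2 * W5 x + l2 / 6 * W6 x| ≤ K * E) (x : ℝ) :
    |W2 x| ≤ 200000 * K * E ^ 3 := by
  have hK : 0 ≤ K := (abs_nonneg _).trans (hW4 0)
  have m1 : ∀ {u B : ℝ}, |u| ≤ B → |l1 / 2 * u| ≤ E * B := by
    intro u B hu
    rw [abs_mul, abs_div]
    norm_num
    exact mul_le_mul (by linarith) hu (abs_nonneg _) hE.le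
  have m2 : ∀ {u B : ℝ}, |u| ≤ B → |l2 / 6 * u| ≤ 10 * E ^ 2 * B := by
    intro u B hu
    rw [abs_mul, abs_div]
    norm_num
    exact mul_le_mul (by linarith) hu (abs_nonneg _) (by positivity)
  have p1 : K * E ^ 2 ≤ K * E := mul_le_mul_of_nonneg_left (by nlinarith) hK
  have p0 : 0 ≤ K * E := by positivity
  have p2 : 0 ≤ K * E ^ 2 := by positivity
  have p3 : 0 ≤ K * E ^ 3 := by positivity
  -- step a
  have a1 : ∀ x, |W3 x + x * W2 x - 1 * W1 x| ≤ 12 * (K * E) := by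
    intro x
    have k1 := abs_le.1 (O2 x)
    have k2 := abs_le.1 (m1 (hW4 x))
    have k3 := abs_le.1 (m2 (hW5 x))
    rw [abs_le]; constructor <;> linarith
  have a2 := maxp h1 h2 one_pos (by positivity) a1 ht1
  have a3 : ∀ x, |W3 x + x * W2 x| ≤ 24 * (K * E) := by
    intro x
    have k1 := abs_le.1 (a1 x)
    have k2 := abs_le.1 (a2 x)
    rw [abs_le]; constructor <;> linarith
  have a4 := drift h1 h2 a3 (fun x => (a2 x).trans (le_of_eq (div_one _)))
  -- step b
  have b1 : ∀ x, |W4 x + x * W3 x| ≤ 12 * (K * E) := by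
    intro x
    have k1 := abs_le.1 (O3 x)
    have k2 := abs_le.1 (m1 (hW5 x))
    have k3 := m2 (hW6 x)
    have : 10 * E ^ 2 * (K / E) = 10 * (K * E) := by field_simp
    rw [this] at k3
    have k3 := abs_le.1 k3
    rw [abs_le]; constructor <;> linarith
  have b2 := drift h2 h3 b1 (fun x => (a4 x).1)
  -- step c
  have c1 : ∀ x, |W3 x + x * W2 x - 1 * W1 x| ≤ 551 * (K * E ^ 2) := by
    intro x
    have k1 := abs_le.1 (O2 x)
    have k2 := abs_le.1 (m1 (b2 x).2)
    have k3 := abs_le.1 (m2 (hW5 x))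
    rw [abs_le]; constructor <;> linarith
  have c2 := maxp h1 h2 one_pos (by positivity) c1 ht1
  have c3 : ∀ x, |W3 x + x * W2 x| ≤ 1102 * (K * E ^ 2) := by
    intro x
    have k1 := abs_le.1 (c1 x)
    have k2 := abs_le.1 (c2 x)
    rw [abs_le]; constructor <;> linarith
  have c4 := drift h1 h2 c3 (fun x => (c2 x).trans (le_of_eq (div_one _)))
  -- step d
  have d1 : ∀ x, |W2 x + x * W1 x - 2 * W0 x| ≤ 13115 * (K * E ^ 3) := by
    intro x
    have k1 := abs_le.1 (O1 x)
    have k2 := abs_le.1 (m1 (c4 x).2)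
    have k3 := abs_le.1 (m2 (b2 x).2)
    rw [abs_le]; constructor <;> linarith
  have d2 := maxp h0 h1 two_pos (by positivity) d1 ht0
  have d3 : ∀ x, |W2 x + x * W1 x| ≤ 26230 * (K * E ^ 3) := by
    intro x
    have k1 := abs_le.1 (d1 x)
    have k2 := abs_le.1 (d2 x)
    rw [abs_le]; constructor <;> linarith
  have d4 := (drift h0 h1 d3 d2 x).2
  linarith
end ODE

end Part12

section Part13

lemma permExp_mono {m : ℕ} {f g : Equiv.Perm (Fin m) → ℝ} (h : ∀ π, f π ≤ g π) : permExp f ≤ permExp g := by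
  unfold permExp
  gcongr
  exact h _

lemma permExp_abs_le {m : ℕ} {f g : Equiv.Perm (Fin m) → ℝ} (h : ∀ π, |f π| ≤ g π) : |permExp f| ≤ permExp g := by
  refine le_trans ?_ (permExp_mono h)
  unfold permExp
  rw [abs_div, Nat.abs_cast]
  gcongr
  exact Finset.abs_sum_le_sum_abs _ _

lemma permExp_sub {m : ℕ} (f g : Equiv.Perm (Fin m) → ℝ) : permExp (fun π => f π - g π) = permExp f - permExp g := by
  unfold permExp; rw [Finset.sum_sub_distrib, sub_div]

lemma permExp_add {m : ℕ} (f g : Equiv.Perm (Fin m) → ℝ) : permExp (fun π => f π + g π) = permExp f + permExp g := by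
  unfold permExp; rw [Finset.sum_add_distrib, add_div]

lemma permExp_smul {m : ℕ} (c : ℝ) (f : Equiv.Perm (Fin m) → ℝ) : permExp (fun π => c * f π) = c * permExp f := by
  unfold permExp; rw [← Finset.mul_sum, mul_div_assoc]

section V
variable {n : ℕ} {a : Fin n → Fin n → ℝ} {E C2 M : ℝ}

lemma Hyp.B34 (h : Hyp a E C2) (hE : 0 < E) (hC : 0 ≤ C2) (hM1 : 1 ≤ M) (hM : ∀ j ≤ 8, ∀ y, 0 ≤ y → y ≤ 1 → |vv j y| ≤ M) :
    Bd a (VV E 3) (4 * M * (1 + C2)) ∧ Bd a (VV E 4) (4 * M * (1 + C2)) := by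
  have key : ∀ m, n ≤ m + 16 → ∀ ρ γ : Fin m → Fin n, StrictMono ρ → StrictMono γ → ∀ x, |GG a (VV E 3) ρ γ x| ≤ M + 2 * M * C2 ∧ |GG a (VV E 4) ρ γ x| ≤ 4 * M + 2 * (2 * M * C2) := by
    intro m hm ρ γ hρ hγ x
    refine landau (u0 := GG a (VV E 2) ρ γ) (u3 := GG a (VV E 5) ρ γ) (fun x => GG_hasDerivAt a (VV_deriv hE 2) ρ γ x)
      (fun x => GG_hasDerivAt a (VV_deriv hE 3) ρ γ x) (fun x => GG_hasDerivAt a (VV_deriv hE 4) ρ γ x) ?_ ?_ x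
    · exact fun x => GG_bound (VV2_bd hE hM1 hM) ρ γ x
    · intro x
      have := h.V5 hE hC hM (j := 0) (by norm_num) m hm ρ γ hρ hγ x
      simpa using this
  have hMC : 0 ≤ M * C2 := by positivity
  constructor
  · intro m hm ρ γ hρ hγ x
    refine (key m hm ρ γ hρ hγ x).1.trans ?_
    linarith
  · intro m hm ρ γ hρ hγ x
    refine (key m hm ρ γ hρ hγ x).2.trans ?_
    linarith

lemma Hyp.B567 (h : Hyp a E C2) (hE : 0 < E) (hC : 0 ≤ C2) (hM1 : 1 ≤ M) (hM : ∀ j ≤ 8, ∀ y, 0 ≤ y → y ≤ 1 → |vv j y| ≤ M) {j : ℕ} (hj : j ≤ 2) :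
    Bd a (VV E (j+5)) (4 * M * (1 + C2) / E ^ j) := by
  intro m hm ρ γ hρ hγ x
  refine (h.V5 hE hC hM hj m hm ρ γ hρ hγ x).trans ?_
  have hMC : 0 ≤ M * C2 := by positivity
  gcongr <;> linarith

lemma Hyp.conc (h : Hyp a E C2) (hE : 0 < E) (hE1 : E ≤ 1) (hC : 0 ≤ C2) (hM1 : 1 ≤ M) (hM : ∀ j ≤ 8, ∀ y, 0 ≤ y → y ≤ 1 → |vv j y| ≤ M)
    (X : ℝ) : Fr a X - Fr a (X - E) ≤ 2 * (4 * M * (1 + C2)) * E := by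
  have t := RS_T1 (fun x => GG_hasDerivAt a (VV_deriv hE 2) id id x) (fun x => (h.B34 hE hC hM1 hM).1 n (by omega) id id strictMono_id strictMono_id x) X E
  have v1 := abs_le.1 (h.V2 hE hC hM (m := n) (by omega) strictMono_id strictMono_id X)
  have v2 := abs_le.1 (h.V2 hE hC hM (m := n) (by omega) strictMono_id strictMono_id (X - E))
  simp only [id] at v1 v2
  have t := abs_le.1 t
  rw [abs_of_pos hE] at t
  have hMC : 0 ≤ M * C2 := by positivity
  have e3 : E ^ 3 ≤ E := by nlinarith [sq_nonneg E]
  have := mul_le_mul_of_nonneg_left e3 hMC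
  have : 0 ≤ M * E := by positivity
  have h1 : Fr (fun i j => a i j) X = Fr a X := rfl
  linarith

lemma Hyp.kbd (h : Hyp a E C2) (hE : 0 < E) (hE1 : E ≤ 1) (hC : 0 ≤ C2) (hM1 : 1 ≤ M) (hM : ∀ j ≤ 8, ∀ y, 0 ≤ y → y ≤ 1 → |vv j y| ≤ M)
    {κ : ℝ → ℝ} {B : ℝ} (k0 : ∀ y ≤ 0, κ y = 0) (k1 : ∀ y, E ≤ y → κ y = 0) (k2 : ∀ y, 0 ≤ y → y ≤ E → |κ y| ≤ B) (X : ℝ) :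
    |GG a κ id id X| ≤ B * (2 * (4 * M * (1 + C2)) * E) := by
  have hB : 0 ≤ B := (abs_nonneg _).trans (k2 0 le_rfl hE.le)
  refine le_trans ?_ (mul_le_mul_of_nonneg_left (h.conc hE hE1 hC hM1 hM X) hB)
  unfold Fr
  rw [← permExp_sub, ← permExp_smul]
  apply permExp_abs_le
  intro π
  unfold rankT
  simp only [id]
  generalize ∑ i, a i (π i) = T
  rcases le_or_gt (X - T) 0 with c | c
  · rw [k0 _ c, abs_zero]
    split_ifs <;> linarith
  rcases le_or_gt E (X - T) with c' | c'
  · rw [k1 _ c', abs_zero]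
    split_ifs <;> linarith
  · rw [if_pos (by linarith), if_neg (by linarith)]
    simpa using k2 _ c.le c'.le

lemma GG_T {φ ψ κ : ℝ → ℝ} {c : ℝ} (h : ∀ y, y * φ y = c * ψ y + κ y) (X : ℝ) :
    permExp (fun π : Equiv.Perm (Fin n) => (∑ i, a i (π i)) * φ (X - ∑ i, a i (π i))) = X * GG a φ id id X - c * GG a ψ id id X - GG a κ id id X := by
  unfold GG
  rw [← permExp_smul, ← permExp_smul, ← permExp_sub, ← permExp_sub]
  congr 1
  funext π
  simp only [id]
  have := h (X - ∑ i, a i (π i))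
  linear_combination -this
end V

section V3
variable {N : ℕ} {a : Fin (N+3) → Fin (N+3) → ℝ} {E C2 M : ℝ}

lemma Hyp.odeV (h : Hyp a E C2) (hs : Sit a E) (hE1 : E ≤ 1/40) (hC : 0 ≤ C2) (hM1 : 1 ≤ M) (hM : ∀ j ≤ 8, ∀ y, 0 ≤ y → y ≤ 1 → |vv j y| ≤ M)
    {l1 l2 : ℝ} (hl1 : l1 = (∑ i, ∑ j, a i j ^ 3) / ((N+3 : ℕ) : ℝ)) (hl2 : l2 = (∑ i, ∑ j, a i j ^ 4) / ((N+3 : ℕ) : ℝ) + 3 / ((N+3 : ℕ) : ℝ) - 3 / ((N+3 : ℕ) : ℝ) ^ 2 * (∑ p, rsq a p ^ 2 + ∑ q, csq a q ^ 2))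
    {V : ℕ → ℝ → ℝ} (hV : ∀ j, V j = GG a (VV E j) id id) {K : ℝ} (hK : K = (3 * 10 ^ 22 + 6 * M) * (4 * M * (1 + C2))) (x : ℝ) :
    |V 2 x + x * V 1 x - 2 * V 0 x - l1 / 2 * V 3 x + l2 / 6 * V 4 x| ≤ K * E ^ 3 ∧
    |V 3 x + x * V 2 x - V 1 x - l1 / 2 * V 4 x + l2 / 6 * V 5 x| ≤ K * E ^ 2 ∧
    |V 4 x + x * V 3 x - l1 / 2 * V 5 x + l2 / 6 * V 6 x| ≤ K * E := by
  have hE := hs.E0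
  obtain ⟨B3, B4⟩ := h.B34 hE hC hM1 hM
  have B5 := h.B567 hE hC hM1 hM (j := 0) (by norm_num)
  have B6 := h.B567 hE hC hM1 hM (j := 1) (by norm_num)
  have B7 := h.B567 hE hC hM1 hM (j := 2) (by norm_num)
  norm_num at B5 B6 B7
  have hK0 : 0 < 4 * M * (1 + C2) := by positivity
  set K0 := 4 * M * (1 + C2) with hK0d
  have hEE : 0 < E := hE
  have hE2 : E ≤ 1 := by linarith
  refine ⟨?_, ?_, ?_⟩
  · have e := hs.exp hE1 (VV_deriv hE 1) (VV_deriv hE 2) (VV_deriv hE 3) (VV_deriv hE 4) B3 B4 B5 x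
    rw [GG_T (ψ := VV E 0) (κ := fun y => y * VV E 1 y - 2 * VV E 0 y) (c := 2) (fun y => by ring) x] at e
    have k := h.kbd hE hE2 hC hM1 hM (κ := fun y => y * VV E 1 y - 2 * VV E 0 y) (B := 3 * M * E ^ 2)
      (fun y hy => by simp [VV_neg hE _ hy]) (fun y hy => by rw [VV1_pos hE hy, VV0_pos hE hy]; ring)
      (fun y h0 h1 => by
        have b0 := abs_le.1 (VV_bd hE hM (j := 0) (by norm_num) h0 h1)
        have b1 := VV_bd hE hM (j := 1) (by norm_num) h0 h1
        have e0 : M * (E ^ 2 / E ^ 0) = M * E ^ 2 := by simp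
        have e1 : M * (E ^ 2 / E ^ 1) = M * E := by field_simp
        rw [e0] at b0; rw [e1] at b1
        have b2 : |y * VV E 1 y| ≤ E * (M * E) := by
          rw [abs_mul, abs_of_nonneg h0]
          exact mul_le_mul h1 b1 (abs_nonneg _) hE.le
        have b2 := abs_le.1 b2
        rw [abs_le]; constructor <;> linarith) x
    rw [← hl1, ← hl2] at e
    simp only [hV]
    have e := abs_le.1 e
    have k := abs_le.1 k
    have t : K * E ^ 3 = 10 ^ 22 * E ^ 3 * (K0 + K0 + K0) + 3 * M * E ^ 2 * (2 * K0 * E) := by rw [hK]; ring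
    rw [t, abs_le]; constructor <;> linarith
  · have e := hs.exp hE1 (VV_deriv hE 2) (VV_deriv hE 3) (VV_deriv hE 4) (VV_deriv hE 5) B4 B5 B6 x
    rw [GG_T (ψ := VV E 1) (κ := fun y => y * VV E 2 y - 1 * VV E 1 y) (c := 1) (fun y => by ring) x] at e
    have k := h.kbd hE hE2 hC hM1 hM (κ := fun y => y * VV E 2 y - 1 * VV E 1 y) (B := 3 * M * E)
      (fun y hy => by simp [VV_neg hE _ hy]) (fun y hy => by rw [VV1_pos hE hy, VV2_pos hE hy]; ring)
      (fun y h0 h1 => by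
        have b0 := abs_le.1 (VV_bd hE hM (j := 1) (by norm_num) h0 h1)
        have b1 := VV_bd hE hM (j := 2) (by norm_num) h0 h1
        have e0 : M * (E ^ 2 / E ^ 1) = M * E := by field_simp
        have e1 : M * (E ^ 2 / E ^ 2) = M := by field_simp
        rw [e0] at b0; rw [e1] at b1
        have b2 : |y * VV E 2 y| ≤ E * M := by
          rw [abs_mul, abs_of_nonneg h0]
          exact mul_le_mul h1 b1 (abs_nonneg _) hE.le
        have b2 := abs_le.1 b2
        have : 0 ≤ M * E := by positivity
        rw [abs_le]; constructor <;> linarith) x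
    rw [← hl1, ← hl2] at e
    simp only [hV]
    have e := abs_le.1 e
    have k := abs_le.1 k
    have t1 : 10 ^ 22 * E ^ 3 * (K0 + K0 + K0 / E) ≤ 10 ^ 22 * (3 * K0 * E ^ 2) := by
      have : 10 ^ 22 * E ^ 3 * (K0 + K0 + K0 / E) = 10 ^ 22 * (K0 * (2 * E ^ 3 + E ^ 2)) := by field_simp; ring
      rw [this]
      have : E ^ 3 ≤ E ^ 2 := by nlinarith [sq_nonneg E]
      have : K0 * (2 * E ^ 3 + E ^ 2) ≤ K0 * (3 * E ^ 2) := mul_le_mul_of_nonneg_left (by linarith) hK0.le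
      linarith
    have t : K * E ^ 2 = 10 ^ 22 * (3 * K0 * E ^ 2) + 3 * M * E * (2 * K0 * E) := by rw [hK]; ring
    rw [t, abs_le]; constructor <;> linarith
  · have e := hs.exp hE1 (VV_deriv hE 3) (VV_deriv hE 4) (VV_deriv hE 5) (VV_deriv hE 6) B5 B6 B7 x
    rw [GG_T (ψ := VV E 1) (κ := fun y => y * VV E 3 y) (c := 0) (fun y => by ring) x] at e
    have k := h.kbd hE hE2 hC hM1 hM (κ := fun y => y * VV E 3 y) (B := 3 * M)
      (fun y hy => by simp [VV_neg hE _ hy]) (fun y hy => by rw [VV3_pos hE 0 hy]; ring)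
      (fun y h0 h1 => by
        have b1 := VV_bd hE hM (j := 3) (by norm_num) h0 h1
        have e1 : M * (E ^ 2 / E ^ 3) = M / E := by field_simp
        rw [e1] at b1
        have b2 : |y * VV E 3 y| ≤ E * (M / E) := by
          rw [abs_mul, abs_of_nonneg h0]
          exact mul_le_mul h1 b1 (abs_nonneg _) hE.le
        have e2 : E * (M / E) = M := by field_simp
        rw [e2] at b2
        linarith) x
    rw [← hl1, ← hl2] at e
    simp only [hV]
    have e := abs_le.1 e
    have k := abs_le.1 k
    have t1 : 10 ^ 22 * E ^ 3 * (K0 + K0 / E + K0 / E ^ 2) ≤ 10 ^ 22 * (3 * K0 * E) := by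
      have : 10 ^ 22 * E ^ 3 * (K0 + K0 / E + K0 / E ^ 2) = 10 ^ 22 * (K0 * (E ^ 3 + E ^ 2 + E)) := by field_simp
      rw [this]
      have : E ^ 3 ≤ E ^ 2 := by nlinarith [sq_nonneg E]
      have : E ^ 2 ≤ E := by nlinarith [sq_nonneg E]
      have : K0 * (E ^ 3 + E ^ 2 + E) ≤ K0 * (3 * E) := mul_le_mul_of_nonneg_left (by linarith) hK0.le
      linarith
    have t : K * E = 10 ^ 22 * (3 * K0 * E) + 3 * M * (2 * K0 * E) := by rw [hK]; ring
    rw [t, abs_le]; constructor <;> linarith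
end V3

end Part13

section Part14

section Gauss
open Filter Topology

lemma gaussD_pos (x : ℝ) : 0 < gaussD x := by
  unfold gaussD
  have := Real.pi_pos
  positivity

lemma gaussD_deriv (x : ℝ) : HasDerivAt gaussD (-x * gaussD x) x := by
  have h : HasDerivAt (fun x : ℝ => -(x ^ 2) / 2) (-x) x := by
    have := (hasDerivAt_pow 2 x).neg.div_const 2
    refine this.congr_deriv ?_
    norm_num
    ring
  have := h.exp.const_mul ((Real.sqrt (2 * Real.pi))⁻¹)
  refine this.congr_deriv ?_
  unfold gaussD
  ring

lemma gaussD_cont : Continuous gaussD := continuous_iff_continuousAt.2 fun x => (gaussD_deriv x).continuousAt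

lemma gaussD_eq : gaussD = ProbabilityTheory.gaussianPDFReal 0 1 := by
  rw [ProbabilityTheory.gaussianPDFReal_def]
  funext x
  unfold gaussD
  simp

lemma gaussD_int : Integrable gaussD := by
  rw [gaussD_eq]; exact ProbabilityTheory.integrable_gaussianPDFReal 0 1

lemma gaussCDF_deriv (x : ℝ) : HasDerivAt gaussCDF (gaussD x) x := by
  have h : gaussCDF = fun x => gaussCDF 0 + ∫ t in (0:ℝ)..x, gaussD t := by
    funext x
    have := intervalIntegral.integral_Iic_sub_Iic (a := 0) (b := x) gaussD_int.integrableOn gaussD_int.integrableOn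
    unfold gaussCDF
    linarith
  rw [h]
  exact (gaussD_cont.integral_hasStrictDerivAt 0 x).hasDerivAt.const_add _

lemma gaussCDF_nonneg (x : ℝ) : 0 ≤ gaussCDF x :=
  integral_nonneg fun t => (gaussD_pos t).le

lemma gaussCDF_cdf : gaussCDF = ProbabilityTheory.cdf (ProbabilityTheory.gaussianReal 0 1) := by
  funext x
  rw [ProbabilityTheory.cdf_eq_real, Measure.real, ProbabilityTheory.gaussianReal_apply_eq_integral _ one_ne_zero,
    ← gaussD_eq]
  exact (ENNReal.toReal_ofReal (gaussCDF_nonneg x)).symm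

lemma gaussCDF_bot : Tendsto gaussCDF atBot (𝓝 0) := by
  rw [gaussCDF_cdf]; exact ProbabilityTheory.tendsto_cdf_atBot _

lemma gaussCDF_top : Tendsto gaussCDF atTop (𝓝 1) := by
  rw [gaussCDF_cdf]; exact ProbabilityTheory.tendsto_cdf_atTop _

lemma gaussCDF_le_one (x : ℝ) : gaussCDF x ≤ 1 := by
  rw [gaussCDF_cdf]; exact ProbabilityTheory.cdf_le_one _ _

lemma gaussD_decay (k : ℕ) : Tendsto (fun x => x ^ k * gaussD x) (cocompact ℝ) (𝓝 0) := by
  have h := tendsto_rpow_abs_mul_exp_neg_mul_sq_cocompact (a := 1/2) (by norm_num) k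
  have h2 := h.const_mul ((Real.sqrt (2 * Real.pi))⁻¹)
  rw [mul_zero] at h2
  rw [tendsto_zero_iff_abs_tendsto_zero]
  refine h2.congr fun x => ?_
  simp only [Function.comp, abs_mul, abs_pow, abs_of_pos (gaussD_pos x), Real.rpow_natCast]
  unfold gaussD
  have : -(1/2) * x ^ 2 = -(x ^ 2) / 2 := by ring
  rw [this]
  ring

lemma mills_bot {x : ℝ} (hx : x ≤ -1) : gaussCDF x ≤ gaussD x := by
  have hd : ∀ x, HasDerivAt (fun x => gaussD x - gaussCDF x) (-x * gaussD x - gaussD x) x := fun x => (gaussD_deriv x).sub (gaussCDF_deriv x)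
  have hm : MonotoneOn (fun x => gaussD x - gaussCDF x) (Set.Iic (-1)) := by
    apply monotoneOn_of_deriv_nonneg (convex_Iic _)
    · exact fun x _ => (hd x).continuousAt.continuousWithinAt
    · exact fun x _ => (hd x).differentiableAt.differentiableWithinAt
    · intro x hx
      rw [interior_Iic] at hx
      have hx : x < -1 := hx
      rw [(hd x).deriv]
      nlinarith [gaussD_pos x]
  have ht : Tendsto (fun x => gaussD x - gaussCDF x) atBot (𝓝 0) := by
    have h1 := (gaussD_decay 0).mono_left (by rw [cocompact_eq_atBot_atTop]; exact le_sup_left : (atBot : Filter ℝ) ≤ cocompact ℝ)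
    simp only [pow_zero, one_mul] at h1
    simpa using h1.sub gaussCDF_bot
  have := le_of_tendsto ht (b := gaussD x - gaussCDF x) (by
    filter_upwards [eventually_le_atBot x] with y hy
    exact hm (by simp only [Set.mem_Iic]; linarith) hx hy)
  linarith

lemma mills_top {x : ℝ} (hx : 1 ≤ x) : 1 - gaussCDF x ≤ gaussD x := by
  have hd : ∀ x, HasDerivAt (fun x => gaussD x + gaussCDF x) (-x * gaussD x + gaussD x) x := fun x => (gaussD_deriv x).add (gaussCDF_deriv x)
  have hm : AntitoneOn (fun x => gaussD x + gaussCDF x) (Set.Ici 1) := by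
    apply antitoneOn_of_deriv_nonpos (convex_Ici _)
    · exact fun x _ => (hd x).continuousAt.continuousWithinAt
    · exact fun x _ => (hd x).differentiableAt.differentiableWithinAt
    · intro x hx
      rw [interior_Ici] at hx
      have hx : 1 < x := hx
      rw [(hd x).deriv]
      nlinarith [gaussD_pos x]
  have ht : Tendsto (fun x => gaussD x + gaussCDF x) atTop (𝓝 1) := by
    have h1 := (gaussD_decay 0).mono_left (by rw [cocompact_eq_atBot_atTop]; exact le_sup_right : (atTop : Filter ℝ) ≤ cocompact ℝ)
    simp only [pow_zero, one_mul] at h1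
    simpa using h1.add gaussCDF_top
  have := le_of_tendsto ht (b := gaussD x + gaussCDF x) (by
    filter_upwards [eventually_ge_atTop x] with y hy
    exact hm hx (by simp only [Set.mem_Ici]; linarith) hy)
  linarith

noncomputable def Gd : ℕ → ℝ → ℝ
  | 0 => fun x => ((x ^ 2 + 1) * gaussCDF x + x * gaussD x) / 2
  | 1 => fun x => x * gaussCDF x + gaussD x
  | (j+2) => fun x => -(x * Gd (j+1) x + ((j:ℝ) - 2) * Gd j x)

lemma Gd_rec (j : ℕ) (x : ℝ) : Gd (j+2) x = -(x * Gd (j+1) x + ((j:ℝ) - 2) * Gd j x) := by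
  simp only [Gd]

lemma Gd0 (x : ℝ) : Gd 0 x = ((x ^ 2 + 1) * gaussCDF x + x * gaussD x) / 2 := by simp only [Gd]
lemma Gd1 (x : ℝ) : Gd 1 x = x * gaussCDF x + gaussD x := by simp only [Gd]
lemma Gd2 (x : ℝ) : Gd 2 x = gaussCDF x := by
  rw [Gd_rec, Gd1, Gd0]; push_cast; ring
lemma Gd3 (x : ℝ) : Gd 3 x = gaussD x := by
  rw [Gd_rec, Gd2, Gd1]; push_cast; ring

lemma Gd_deriv : ∀ (j : ℕ) (x : ℝ), HasDerivAt (Gd j) (Gd (j+1) x) x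
  | 0, x => by
    have h : HasDerivAt (fun x : ℝ => x ^ 2 + 1) (2 * x) x := by
      simpa using (hasDerivAt_pow 2 x).add_const 1
    have := ((h.mul (gaussCDF_deriv x)).add ((hasDerivAt_id x).mul (gaussD_deriv x))).div_const 2
    have e : Gd 0 = fun x => ((x ^ 2 + 1) * gaussCDF x + x * gaussD x) / 2 := funext Gd0
    rw [e, Gd1]
    refine this.congr_deriv ?_
    simp only [id]
    ring
  | 1, x => by
    have := (((hasDerivAt_id x).mul (gaussCDF_deriv x)).add (gaussD_deriv x))
    have e : Gd 1 = fun x => x * gaussCDF x + gaussD x := funext Gd1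
    rw [e, Gd2]
    refine this.congr_deriv ?_
    simp only [id]
    ring
  | (j+2), x => by
    have h1 := Gd_deriv (j+1) x
    have h0 := Gd_deriv j x
    have := (((hasDerivAt_id x).mul h1).add (h0.const_mul ((j:ℝ) - 2))).neg
    have e : Gd (j+2) = fun x => -(x * Gd (j+1) x + ((j:ℝ) - 2) * Gd j x) := funext (Gd_rec j)
    rw [e]
    refine this.congr_deriv ?_
    rw [Gd_rec (j+1)]
    simp only [id]
    push_cast
    ring

lemma Gd4 (x : ℝ) : Gd 4 x = - x * gaussD x := by
  rw [Gd_rec, Gd3, Gd2]; push_cast; ring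

lemma Gd_decay : ∀ (j k : ℕ), Tendsto (fun x => x ^ k * Gd (j+3) x) (cocompact ℝ) (𝓝 0)
  | 0, k => by simpa only [zero_add, Gd3] using gaussD_decay k
  | 1, k => by
    have := (gaussD_decay (k+1)).neg
    rw [neg_zero] at this
    refine this.congr fun x => ?_
    show _ = x ^ k * Gd 4 x
    rw [Gd4]; ring
  | (j+2), k => by
    have h1 := Gd_decay (j+1) (k+1)
    have h0 := (Gd_decay j k).const_mul (((j+3 : ℕ):ℝ) - 2)
    have := (h1.add h0).neg
    simp only [mul_zero, add_zero, neg_zero] at this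
    refine this.congr fun x => ?_
    show _ = x ^ k * Gd ((j+3)+2) x
    rw [Gd_rec (j+3)]
    ring_nf

lemma bdd_of_decay {f : ℝ → ℝ} (hf : Continuous f) (h : Tendsto f (cocompact ℝ) (𝓝 0)) : ∃ C, ∀ x, |f x| ≤ C := by
  have h1 : ∀ᶠ x in cocompact ℝ, |f x| ≤ 1 := by
    have := (tendsto_zero_iff_abs_tendsto_zero _).1 h
    filter_upwards [this.eventually (gt_mem_nhds one_pos)] with x hx using hx.le
  rw [Filter.eventually_iff, Filter.mem_cocompact] at h1
  obtain ⟨t, ht, hs⟩ := h1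
  obtain ⟨C, hC⟩ := ht.exists_bound_of_continuousOn hf.continuousOn
  refine ⟨max C 1, fun x => ?_⟩
  by_cases hx : x ∈ t
  · exact (hC x hx).trans (le_max_left _ _)
  · exact (hs hx).trans (le_max_right _ _)

lemma Gd_bdd : ∃ C : ℝ, 1 ≤ C ∧ ∀ j, 2 ≤ j → j ≤ 12 → ∀ x, |Gd j x| ≤ C := by
  have h : ∀ j : ℕ, ∃ C, ∀ x, |Gd (j+2) x| ≤ C := by
    intro j
    rcases j with _ | j
    · refine ⟨1, fun x => ?_⟩
      rw [zero_add, Gd2, abs_of_nonneg (gaussCDF_nonneg x)]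
      exact gaussCDF_le_one x
    · apply bdd_of_decay
      · exact continuous_iff_continuousAt.2 fun x => (Gd_deriv (j+1+2) x).continuousAt
      · simpa using Gd_decay j 0
  choose c hc using h
  refine ⟨1 + ∑ j ∈ range 11, |c j|, ?_, ?_⟩
  · have : 0 ≤ ∑ j ∈ range 11, |c j| := Finset.sum_nonneg fun _ _ => abs_nonneg _
    linarith
  · intro j h2 h12 x
    obtain ⟨i, rfl⟩ : ∃ i, j = i + 2 := ⟨j - 2, by omega⟩
    have := Finset.single_le_sum (f := fun j => |c j|) (s := range 11) (fun _ _ => abs_nonneg _) (Finset.mem_range.2 (by omega : i < 11))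
    have h3 := hc i x
    have := le_abs_self (c i)
    linarith

lemma Gd0_bot : Tendsto (Gd 0) atBot (𝓝 0) ∧ Tendsto (Gd 1) atBot (𝓝 0) := by
  have hle : (atBot : Filter ℝ) ≤ cocompact ℝ := by rw [cocompact_eq_atBot_atTop]; exact le_sup_left
  have b : Tendsto (fun x => 2 * (x ^ 2 * gaussD x) + 2 * (x ^ 0 * gaussD x)) atBot (𝓝 0) := by
    have := (((gaussD_decay 2).const_mul 2).add ((gaussD_decay 0).const_mul 2)).mono_left hle
    simpa using this
  constructor
  all_goals
    apply squeeze_zero_norm' _ b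
    filter_upwards [eventually_le_atBot (-1)] with x hx
    have m1 := mills_bot hx
    have m0 := gaussCDF_nonneg x
    have g0 := gaussD_pos x
    rw [Real.norm_eq_abs, abs_le, pow_zero, one_mul]
  · rw [Gd0]
    have h1 : (x ^ 2 + 1) * gaussCDF x ≤ (x ^ 2 + 1) * gaussD x := mul_le_mul_of_nonneg_left m1 (by positivity)
    have h2 : 0 ≤ (x ^ 2 + 1) * gaussCDF x := by positivity
    have h3 : x * gaussD x ≤ 0 := by nlinarith
    have h4 : -(x ^ 2 * gaussD x) ≤ x * gaussD x := by nlinarith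
    constructor <;> nlinarith
  · rw [Gd1]
    have h1 : x * gaussCDF x ≤ 0 := by nlinarith
    have h2 : x * gaussD x ≤ x * gaussCDF x := by nlinarith
    have h4 : -(x ^ 2 * gaussD x) ≤ x * gaussD x := by nlinarith
    have h5 : 0 ≤ x ^ 2 * gaussD x := by positivity
    constructor <;> nlinarith

lemma Gd0_top : Tendsto (fun x => (x ^ 2 + 1) / 2 - Gd 0 x) atTop (𝓝 0) ∧ Tendsto (fun x => x - Gd 1 x) atTop (𝓝 0) := by
  have hle : (atTop : Filter ℝ) ≤ cocompact ℝ := by rw [cocompact_eq_atBot_atTop]; exact le_sup_right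
  have b : Tendsto (fun x => 2 * (x ^ 2 * gaussD x) + 2 * (x ^ 0 * gaussD x)) atTop (𝓝 0) := by
    have := (((gaussD_decay 2).const_mul 2).add ((gaussD_decay 0).const_mul 2)).mono_left hle
    simpa using this
  constructor
  all_goals
    apply squeeze_zero_norm' _ b
    filter_upwards [eventually_ge_atTop 1] with x hx
    have m1 := mills_top hx
    have m0 := gaussCDF_le_one x
    have g0 := gaussD_pos x
    rw [Real.norm_eq_abs, abs_le, pow_zero, one_mul]
  · rw [Gd0]
    have h1 : (x ^ 2 + 1) * (1 - gaussCDF x) ≤ (x ^ 2 + 1) * gaussD x := mul_le_mul_of_nonneg_left m1 (by positivity)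
    have h2 : 0 ≤ (x ^ 2 + 1) * (1 - gaussCDF x) := mul_nonneg (by positivity) (by linarith)
    have h3 : 0 ≤ x * gaussD x := by positivity
    have h4 : x * gaussD x ≤ x ^ 2 * gaussD x := by nlinarith
    constructor <;> nlinarith
  · rw [Gd1]
    have h1 : 0 ≤ x * (1 - gaussCDF x) := mul_nonneg (by linarith) (by linarith)
    have h2 : x * (1 - gaussCDF x) ≤ x * gaussD x := mul_le_mul_of_nonneg_left m1 (by linarith)
    have h4 : x * gaussD x ≤ x ^ 2 * gaussD x := by nlinarith
    constructor <;> nlinarith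

/-- reference expansion -/
noncomputable def UU (l1 l2 : ℝ) (j : ℕ) (x : ℝ) : ℝ :=
  Gd j x - l1 / 6 * Gd (j+3) x + l2 / 24 * Gd (j+4) x + l1 ^ 2 / 72 * Gd (j+6) x

lemma UU_deriv (l1 l2 : ℝ) (j : ℕ) (x : ℝ) : HasDerivAt (UU l1 l2 j) (UU l1 l2 (j+1) x) x := by
  have := (((Gd_deriv j x).sub ((Gd_deriv (j+3) x).const_mul (l1/6))).add ((Gd_deriv (j+4) x).const_mul (l2/24))).add ((Gd_deriv (j+6) x).const_mul (l1^2/72))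
  refine this.congr_deriv ?_
  unfold UU
  have e1 : j + 1 + 3 = j + 3 + 1 := by ring
  have e2 : j + 1 + 4 = j + 4 + 1 := by ring
  have e3 : j + 1 + 6 = j + 6 + 1 := by ring
  rw [e1, e2, e3]

lemma UU2 (l1 l2 x : ℝ) : UU l1 l2 2 x = gaussCDF x - gaussD x * (l1 / 6 * (x ^ 2 - 1) + l2 / 24 * (x ^ 3 - 3 * x)
      + l1 ^ 2 / 72 * (x ^ 5 - 10 * x ^ 3 + 15 * x)) := by
  unfold UU
  have e5 : Gd 5 x = (x ^ 2 - 1) * gaussD x := by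
    rw [Gd_rec, Gd4, Gd3]; push_cast; ring
  have e6 : Gd 6 x = -(x ^ 3 - 3 * x) * gaussD x := by
    rw [Gd_rec, e5, Gd4]; push_cast; ring
  have e7 : Gd 7 x = (x ^ 4 - 6 * x ^ 2 + 3) * gaussD x := by
    rw [Gd_rec, e6, e5]; push_cast; ring
  have e8 : Gd 8 x = -(x ^ 5 - 10 * x ^ 3 + 15 * x) * gaussD x := by
    rw [Gd_rec, e7, e6]; push_cast; ring
  norm_num
  rw [e5, e6, e8, Gd2]
  ring

variable {l1 l2 E C : ℝ}

lemma mul_abs_le {a b A B : ℝ} (ha : |a| ≤ A) (hb : |b| ≤ B) : |a * b| ≤ A * B := by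
  rw [abs_mul]; exact mul_le_mul ha hb (abs_nonneg _) ((abs_nonneg _).trans ha)

lemma UU_bd (hE : 0 < E) (hl1 : |l1| ≤ 2 * E) (hl2 : |l2| ≤ 60 * E ^ 2) (hC : ∀ j, 2 ≤ j → j ≤ 12 → ∀ x, |Gd j x| ≤ C)
    {j : ℕ} (h2 : 2 ≤ j) (h6 : j ≤ 6) (x : ℝ) : |UU l1 l2 j x| ≤ C * (1 + E + 3 * E ^ 2) := by
  have hC0 : 0 ≤ C := (abs_nonneg _).trans (hC 2 le_rfl (by norm_num) 0)
  have a1 := mul_abs_le hl1 (hC (j+3) (by omega) (by omega) x)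
  have a2 := mul_abs_le hl2 (hC (j+4) (by omega) (by omega) x)
  have a3 := mul_abs_le (mul_abs_le hl1 hl1) (hC (j+6) (by omega) (by omega) x)
  have a0 := hC j h2 (by omega) x
  unfold UU
  rw [abs_le] at *
  have : 0 ≤ C * E := by positivity
  have : 0 ≤ C * E ^ 2 := by positivity
  constructor <;> nlinarith

lemma UU_res (hE : 0 < E) (hE1 : E ≤ 1) (hl1 : |l1| ≤ 2 * E) (hl2 : |l2| ≤ 60 * E ^ 2) (hC : ∀ j, 2 ≤ j → j ≤ 12 → ∀ x, |Gd j x| ≤ C)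
    {j : ℕ} (h6 : j ≤ 2) (x : ℝ) : |UU l1 l2 (j+2) x + x * UU l1 l2 (j+1) x + ((j:ℝ) - 2) * UU l1 l2 j x - l1 / 2 * UU l1 l2 (j+3) x + l2 / 6 * UU l1 l2 (j+4) x| ≤ 40 * C * E ^ 3 := by
  have hC0 : 0 ≤ C := (abs_nonneg _).trans (hC 2 le_rfl (by norm_num) 0)
  have r0 := Gd_rec j x
  have r3 := Gd_rec (j+3) x
  have r4 := Gd_rec (j+4) x
  have r6 := Gd_rec (j+6) x
  have e : UU l1 l2 (j+2) x + x * UU l1 l2 (j+1) x + ((j:ℝ) - 2) * UU l1 l2 j x - l1 / 2 * UU l1 l2 (j+3) x + l2 / 6 * UU l1 l2 (j+4) x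
     = -(l1 * l2 * Gd (j+7) x) * (7 / 144) - l1 * l1 * l1 * Gd (j+9) x / 144 + l2 * l2 * Gd (j+8) x / 144 + l2 * (l1 * l1) * Gd (j+10) x / 432 := by
    unfold UU
    simp only [Nat.add_assoc, Nat.reduceAdd] at *
    push_cast at *
    rw [r0]
    linear_combination (-l1/6) * r3 + (l2/24) * r4 + (l1^2/72) * r6
  rw [e]
  have a1 := mul_abs_le (mul_abs_le hl1 hl2) (hC (j+7) (by omega) (by omega) x)
  have a2 := mul_abs_le (mul_abs_le (mul_abs_le hl1 hl1) hl1) (hC (j+9) (by omega) (by omega) x)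
  have a3 := mul_abs_le (mul_abs_le hl2 hl2) (hC (j+8) (by omega) (by omega) x)
  have a4 := mul_abs_le (mul_abs_le hl2 (mul_abs_le hl1 hl1)) (hC (j+10) (by omega) (by omega) x)
  have q : C * E ^ 4 ≤ C * E ^ 3 := mul_le_mul_of_nonneg_left (pow_le_pow_of_le_one hE.le hE1 (by norm_num)) hC0
  have p3 : 0 ≤ C * E ^ 3 := by positivity
  have t1 : 2 * E * (60 * E ^ 2) * C = 120 * (C * E ^ 3) := by ring
  have t2 : 2 * E * (2 * E) * (2 * E) * C = 8 * (C * E ^ 3) := by ring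
  have t3 : 60 * E ^ 2 * (60 * E ^ 2) * C = 3600 * (C * E ^ 4) := by ring
  have t4 : 60 * E ^ 2 * (2 * E * (2 * E)) * C = 240 * (C * E ^ 4) := by ring
  rw [t1] at a1; rw [t2] at a2; rw [t3] at a3; rw [t4] at a4
  rw [abs_le] at *
  constructor <;> linarith
end Gauss

end Part14

section Part15

lemma permExp_const {m : ℕ} (c : ℝ) : permExp (fun _ : Equiv.Perm (Fin m) => c) = c := by
  unfold permExp
  rw [Finset.sum_const, Finset.card_univ, Fintype.card_perm, Fintype.card_fin, nsmul_eq_mul]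
  field_simp

lemma mean_T {m : ℕ} (b : Fin (m+1) → Fin (m+1) → ℝ) :
    permExp (fun π : Equiv.Perm (Fin (m+1)) => ∑ i, b i (π i)) = (∑ p, ∑ q, b p q) / (m+1) := by
  have := GG_Tweighted b (fun _ => 1) 0
  simp only [mul_one] at this
  rw [this]
  unfold GG
  simp only [permExp_const, mul_one]

section T
open Filter Topology
variable {N : ℕ} {a : Fin (N+3) → Fin (N+3) → ℝ} {E : ℝ}

lemma Sit.m1 (h : Sit a E) : permExp (fun π : Equiv.Perm (Fin (N+3)) => ∑ i, a i (π i)) = 0 := by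
  rw [mean_T (m := N+2) a]
  simp [h.row]

lemma sum_sub_del (h : Sit a E) (p q : Fin (N+3)) : ∑ i, ∑ j, a (p.succAbove i) (q.succAbove j) = a p q := by
  have r : ∀ i, ∑ j, a i (q.succAbove j) = - a i q := by
    intro i
    have := h.row i
    rw [Fin.sum_univ_succAbove _ q] at this
    linarith
  simp_rw [r]
  have := h.col q
  rw [Fin.sum_univ_succAbove _ p] at this
  rw [Finset.sum_neg_distrib]
  linarith

lemma Sit.m2 (h : Sit a E) : permExp (fun π : Equiv.Perm (Fin (N+3)) => (∑ i, a i (π i)) ^ 2) = 1 := by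
  have := GG_Tweighted a (fun y => -y) 0
  have e : (fun π : Equiv.Perm (Fin (N+3)) => (∑ i, a i (π i)) ^ 2) = fun π => (∑ i, a i (π i)) * -(0 - ∑ i, a i (π i)) := by
    funext π; ring
  rw [e, this]
  have g : ∀ p q, GG a (fun y => -y) p.succAbove q.succAbove (0 - a p q) = a p q * (((N:ℝ) + 3) / (N + 2)) := by
    intro p q
    unfold GG
    have e1 : (fun π : Equiv.Perm (Fin (N+2)) => -(0 - a p q - ∑ i, a (p.succAbove i) (q.succAbove (π i)))) = fun π => a p q + ∑ i, a (p.succAbove i) (q.succAbove (π i)) := by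
      funext π; ring
    rw [e1, permExp_add, permExp_const, mean_T (m := N+1) (fun i j => a (p.succAbove i) (q.succAbove j)), sum_sub_del h]
    push_cast
    have : (N:ℝ) + 1 + 1 ≠ 0 := by positivity
    have : (N:ℝ) + 2 ≠ 0 := by positivity
    field_simp
    ring
  simp_rw [g]
  have e2 : ∑ p, ∑ q, a p q * (a p q * (((N:ℝ) + 3) / (N + 2))) = (((N+3:ℕ):ℝ) - 1) * (((N:ℝ) + 3) / (N + 2)) := by
    rw [← h.sq]
    simp_rw [Finset.sum_mul]
    refine Finset.sum_congr rfl fun p _ => Finset.sum_congr rfl fun q _ => by ring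
  rw [e2]
  push_cast
  have : (N:ℝ) + 2 ≠ 0 := by positivity
  have : (N:ℝ) + 2 + 1 ≠ 0 := by positivity
  field_simp
  ring

lemma T_le (a : Fin (N+3) → Fin (N+3) → ℝ) (π : Equiv.Perm (Fin (N+3))) : |∑ i, a i (π i)| ≤ ∑ i, ∑ j, |a i j| := by
  refine (Finset.abs_sum_le_sum_abs _ _).trans (Finset.sum_le_sum fun i _ => ?_)
  exact Finset.single_le_sum (f := fun j => |a i j|) (fun _ _ => abs_nonneg _) (Finset.mem_univ (π i))

lemma V_bot (hE : 0 < E) (j : ℕ) {x : ℝ} (hx : x ≤ -∑ i, ∑ j, |a i j|) : GG a (VV E j) id id x = 0 := by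
  unfold GG
  have : (fun π : Equiv.Perm (Fin (N+3)) => VV E j (x - ∑ i, a (id i) (id (π i)))) = fun _ => 0 := by
    funext π
    apply VV_neg hE
    have := abs_le.1 (T_le a π)
    simp only [id]
    linarith
  rw [this, permExp_const]

lemma V0_top (h : Sit a E) {x : ℝ} (hx : E + ∑ i, ∑ j, |a i j| ≤ x) : GG a (VV E 0) id id x = (x ^ 2 + 1) / 2 := by
  unfold GG
  have : (fun π : Equiv.Perm (Fin (N+3)) => VV E 0 (x - ∑ i, a (id i) (id (π i)))) = fun π => (x ^ 2 / 2 + (-x) * ∑ i, a i (π i)) + 1 / 2 * (∑ i, a i (π i)) ^ 2 := by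
    funext π
    have := abs_le.1 (T_le a π)
    simp only [id]
    rw [VV0_pos h.E0 (by linarith)]
    ring
  rw [this, permExp_add, permExp_add, permExp_smul, permExp_smul, permExp_const, h.m1, h.m2]
  ring

lemma V1_top (h : Sit a E) {x : ℝ} (hx : E + ∑ i, ∑ j, |a i j| ≤ x) : GG a (VV E 1) id id x = x := by
  unfold GG
  have : (fun π : Equiv.Perm (Fin (N+3)) => VV E 1 (x - ∑ i, a (id i) (id (π i)))) = fun π => x - ∑ i, a i (π i) := by
    funext π
    have := abs_le.1 (T_le a π)
    simp only [id]
    rw [VV1_pos h.E0 (by linarith)]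
  rw [this, permExp_sub, permExp_const, h.m1]
  ring

lemma tail_gen {V U P : ℝ → ℝ} {B : ℝ} (h1 : ∀ x, x ≤ -B → V x = 0) (h2 : ∀ x, B ≤ x → V x = P x)
    (hb : Tendsto U atBot (𝓝 0)) (ht : Tendsto (fun x => P x - U x) atTop (𝓝 0)) :
    Tendsto (fun x => V x - U x) (cocompact ℝ) (𝓝 0) := by
  rw [cocompact_eq_atBot_atTop, tendsto_sup]
  constructor
  · have := hb.neg
    rw [neg_zero] at this
    refine this.congr' ?_
    filter_upwards [eventually_le_atBot (-B)] with x hx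
    rw [h1 x hx]; ring
  · refine ht.congr' ?_
    filter_upwards [eventually_ge_atTop B] with x hx
    rw [h2 x hx]

lemma UU_tail (l1 l2 : ℝ) (j : ℕ) : Tendsto (fun x => UU l1 l2 j x - Gd j x) (cocompact ℝ) (𝓝 0) := by
  have h1 := (Gd_decay j 0).const_mul (-(l1/6))
  have h2 := (Gd_decay (j+1) 0).const_mul (l2/24)
  have h3 := (Gd_decay (j+3) 0).const_mul (l1^2/72)
  have := (h1.add h2).add h3
  simp only [mul_zero, add_zero] at this
  refine this.congr fun x => ?_
  unfold UU
  simp only [pow_zero, one_mul, Nat.add_assoc, Nat.reduceAdd]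
  ring

lemma W_tail (h : Sit a E) (l1 l2 : ℝ) : Tendsto (fun x => GG a (VV E 0) id id x - UU l1 l2 0 x) (cocompact ℝ) (𝓝 0) ∧
    Tendsto (fun x => GG a (VV E 1) id id x - UU l1 l2 1 x) (cocompact ℝ) (𝓝 0) := by
  have hE := h.E0
  constructor
  · have t := tail_gen (V := GG a (VV E 0) id id) (U := Gd 0) (P := fun x => (x ^ 2 + 1) / 2) (B := E + ∑ i, ∑ j, |a i j|) 
      (fun x hx => V_bot hE 0 (by linarith)) (fun x hx => V0_top h hx) Gd0_bot.1 Gd0_top.1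
    have := t.sub (UU_tail l1 l2 0)
    rw [sub_zero] at this
    refine this.congr fun x => ?_
    ring
  · have t := tail_gen (V := GG a (VV E 1) id id) (U := Gd 1) (P := fun x => x) (B := E + ∑ i, ∑ j, |a i j|) 
      (fun x hx => V_bot hE 1 (by linarith)) (fun x hx => V1_top h hx) Gd0_bot.2 Gd0_top.2
    have := t.sub (UU_tail l1 l2 1)
    rw [sub_zero] at this
    refine this.congr fun x => ?_
    ring

lemma main_small {C2 M C : ℝ} (h : Hyp a E C2) (hs : Sit a E) (hE1 : E ≤ 1/40) (hC : 0 ≤ C2) (hM1 : 1 ≤ M) (hM : ∀ j ≤ 8, ∀ y, 0 ≤ y → y ≤ 1 → |vv j y| ≤ M)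
    (hC1 : 1 ≤ C) (hCb : ∀ j, 2 ≤ j → j ≤ 12 → ∀ x, |Gd j x| ≤ C)
    {l1 l2 : ℝ} (hl1 : l1 = (∑ i, ∑ j, a i j ^ 3) / ((N+3 : ℕ) : ℝ)) (hl2 : l2 = (∑ i, ∑ j, a i j ^ 4) / ((N+3 : ℕ) : ℝ) + 3 / ((N+3 : ℕ) : ℝ) - 3 / ((N+3 : ℕ) : ℝ) ^ 2 * (∑ p, rsq a p ^ 2 + ∑ q, csq a q ^ 2)) (x : ℝ) :
    |Fr a x - UU l1 l2 2 x| ≤ (2 * M * C2 + 200000 * ((3 * 10 ^ 22 + 6 * M) * (4 * M * (1 + C2)) + 40 * C)) * E ^ 3 := by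
  have hE := hs.E0
  have b1 : |l1| ≤ 2 * E := by rw [hl1]; exact hs.l1
  have b2 : |l2| ≤ 60 * E ^ 2 := by rw [hl2]; exact hs.l2
  have hE2 : E ≤ 1 := by linarith
  obtain ⟨K, hK⟩ : ∃ K, K = (3 * 10 ^ 22 + 6 * M) * (4 * M * (1 + C2)) := ⟨_, rfl⟩
  have ov := h.odeV hs hE1 hC hM1 hM hl1 hl2 (V := fun j => GG a (VV E j) id id) (fun _ => rfl) hK
  have ou : ∀ j ≤ 2, ∀ x, _ := fun j hj x => UU_res (j := j) hE hE2 b1 b2 hCb hj x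
  have hK0 : 4 * M * (1 + C2) ≤ K := by
    rw [hK]
    have : 0 ≤ 4 * M * (1 + C2) := by positivity
    nlinarith
  have hKp : 0 < K := lt_of_lt_of_le (by positivity) hK0
  obtain ⟨wt0, wt1⟩ := W_tail hs l1 l2
  have ub : ∀ j, 2 ≤ j → j ≤ 6 → ∀ x, |UU l1 l2 j x| ≤ 5 * C := by
    intro j h2 h6 x
    refine (UU_bd hE b1 b2 hCb h2 h6 x).trans ?_
    have e2 : E ^ 2 ≤ 1 := by nlinarith
    have := mul_le_mul_of_nonneg_left (show 1 + E + 3 * E ^ 2 ≤ 5 by linarith) (show 0 ≤ C by linarith)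
    linarith
  have hp3 : 0 ≤ C * E ^ 3 := by positivity
  have hp32 : C * E ^ 3 ≤ C * E ^ 2 := mul_le_mul_of_nonneg_left (pow_le_pow_of_le_one hE.le hE2 (by norm_num)) (by linarith)
  have hp31 : C * E ^ 3 ≤ C * E := mul_le_mul_of_nonneg_left (by nlinarith [sq_nonneg E]) (by linarith)
  obtain ⟨B3, B4⟩ := h.B34 hE hC hM1 hM
  have B5 := h.B567 hE hC hM1 hM (j := 0) (by norm_num)
  have B6 := h.B567 hE hC hM1 hM (j := 1) (by norm_num)
  norm_num at B5 B6
  have hW := ode_chain (W0 := fun x => GG a (VV E 0) id id x - UU l1 l2 0 x) (W1 := fun x => GG a (VV E 1) id id x - UU l1 l2 1 x)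
    (W2 := fun x => GG a (VV E 2) id id x - UU l1 l2 2 x) (W3 := fun x => GG a (VV E 3) id id x - UU l1 l2 3 x)
    (W4 := fun x => GG a (VV E 4) id id x - UU l1 l2 4 x) (W5 := fun x => GG a (VV E 5) id id x - UU l1 l2 5 x)
    (W6 := fun x => GG a (VV E 6) id id x - UU l1 l2 6 x) (E := E) (K := K + 40 * C) (l1 := l1) (l2 := l2)
    (fun x => (GG_hasDerivAt a (VV_deriv hE 0) id id x).sub (UU_deriv l1 l2 0 x))
    (fun x => (GG_hasDerivAt a (VV_deriv hE 1) id id x).sub (UU_deriv l1 l2 1 x))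
    (fun x => (GG_hasDerivAt a (VV_deriv hE 2) id id x).sub (UU_deriv l1 l2 2 x))
    (fun x => (GG_hasDerivAt a (VV_deriv hE 3) id id x).sub (UU_deriv l1 l2 3 x))
    hE hE2 b1 b2 ?_ ?_ ?_ wt0 wt1 ?_ ?_ ?_ x
  · have v := h.V2 hE hC hM (m := N+3) (by omega) strictMono_id strictMono_id x
    simp only [id] at v
    rw [← hK]
    have v := abs_le.1 v
    have w := abs_le.1 hW
    have : Fr (fun i j => a i j) x = Fr a x := rfl
    rw [this] at v
    rw [abs_le]; constructor <;> linarith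
  · intro x
    have v := abs_le.1 (B4 (N+3) (by omega) id id strictMono_id strictMono_id x)
    have u := abs_le.1 (ub 4 (by norm_num) (by norm_num) x)
    rw [abs_le]; constructor <;> linarith
  · intro x
    have v := abs_le.1 (B5 (N+3) (by omega) id id strictMono_id strictMono_id x)
    have u := abs_le.1 (ub 5 (by norm_num) (by norm_num) x)
    rw [abs_le]; constructor <;> linarith
  · intro x
    have v := abs_le.1 (B6 (N+3) (by omega) id id strictMono_id strictMono_id x)
    have u := abs_le.1 (ub 6 (by norm_num) (by norm_num) x)
    have e1 : 4 * M * (1 + C2) / E ≤ K / E := by gcongr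
    have e2 : 40 * C ≤ 40 * C / E := by
      rw [le_div_iff₀ hE]; nlinarith
    rw [add_div, abs_le]; constructor <;> linarith
  · intro x
    have v := abs_le.1 (ov x).1
    have u := ou 0 (by norm_num) x
    norm_num at u
    have u := abs_le.1 u
    rw [abs_le]; constructor <;> linarith
  · intro x
    have v := abs_le.1 (ov x).2.1
    have u := ou 1 (by norm_num) x
    norm_num at u
    have u := abs_le.1 u
    rw [abs_le]; constructor <;> linarith
  · intro x
    have v := abs_le.1 (ov x).2.2
    have u := ou 2 (by norm_num) x
    norm_num at u
    have u := abs_le.1 u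
    rw [abs_le]; constructor <;> linarith
end T

end Part15

section Part16

section Fin
variable {n : ℕ} (A : Matrix (Fin n) (Fin n) ℝ)

lemma ctr_row (hn : 2 ≤ n) (i : Fin n) : ∑ j, ctr A i j = 0 := by
  have hn0 : (n:ℝ) ≠ 0 := by positivity
  unfold ctr
  rw [Finset.sum_add_distrib, Finset.sum_sub_distrib, Finset.sum_sub_distrib]
  simp only [Finset.sum_const, Finset.card_univ, Fintype.card_fin, nsmul_eq_mul, rowMean, colMean, totMean, ← Finset.sum_div]
  rw [Finset.sum_comm (f := fun j i => A i j)]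
  field_simp
  ring

lemma ctr_col (hn : 2 ≤ n) (j : Fin n) : ∑ i, ctr A i j = 0 := by
  have hn0 : (n:ℝ) ≠ 0 := by positivity
  unfold ctr
  rw [Finset.sum_add_distrib, Finset.sum_sub_distrib, Finset.sum_sub_distrib]
  simp only [Finset.sum_const, Finset.card_univ, Fintype.card_fin, nsmul_eq_mul, rowMean, colMean, totMean, ← Finset.sum_div]
  field_simp
  ring

lemma hat_T (hn : 2 ≤ n) (π : Equiv.Perm (Fin n)) : rankTstd A π = rankT (hatM A) π := by
  have hn0 : (n:ℝ) ≠ 0 := by positivity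
  unfold rankTstd rankT hatM
  rw [← Finset.sum_div]
  congr 1
  unfold ctr
  rw [Finset.sum_add_distrib, Finset.sum_sub_distrib, Finset.sum_sub_distrib, Equiv.sum_comp π (colMean A)]
  simp only [Finset.sum_const, Finset.card_univ, Fintype.card_fin, nsmul_eq_mul, rowMean, colMean, totMean, muM, ← Finset.sum_div]
  rw [Finset.sum_comm (f := fun j i => A i j)]
  field_simp
  ring

lemma Fstd_eq (hn : 2 ≤ n) (z : ℝ) : Fstd A z = Fr (hatM A) z := by
  unfold Fstd Fr
  simp only [hat_T A hn]

lemma hat_sit (hn : 2 ≤ n) (hs : 0 < sdev A) : Sit (hatM A) (EM A) := by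
  have hn2 : (2:ℝ) ≤ n := by exact_mod_cast hn
  have row : ∀ i, ∑ j, hatM A i j = 0 := by
    intro i; unfold hatM; rw [← Finset.sum_div, ctr_row A hn, zero_div]
  have col : ∀ j, ∑ i, hatM A i j = 0 := by
    intro i; unfold hatM; rw [← Finset.sum_div, ctr_col A hn, zero_div]
  have s2 : sdev A ^ 2 = sigma2 A := by
    unfold sdev
    rw [Real.sq_sqrt]
    by_contra h
    push Not at h
    rw [sdev, Real.sqrt_eq_zero_of_nonpos h.le] at hs
    exact lt_irrefl _ hs
  have sq : ∑ i, ∑ j, hatM A i j ^ 2 = (n:ℝ) - 1 := by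
    unfold hatM
    simp only [div_pow, ← Finset.sum_div]
    rw [div_eq_iff (by positivity), s2, sigma2, mul_div_cancel₀]
    linarith
  have eta0 : 0 ≤ etaM A := Finset.sum_nonneg fun i _ => Finset.sum_nonneg fun j _ => by positivity
  have eta1 : 0 < etaM A := by
    rcases eta0.lt_or_eq with h | h
    · exact h
    exfalso
    have z : ∀ i j, hatM A i j = 0 := by
      intro i j
      have h1 := (Finset.sum_eq_zero_iff_of_nonneg (fun i _ => Finset.sum_nonneg fun j _ => by positivity)).1 h.symm i (Finset.mem_univ _)
      have h2 := (Finset.sum_eq_zero_iff_of_nonneg (fun j _ => by positivity)).1 h1 j (Finset.mem_univ _)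
      have h3 := pow_eq_zero_iff (by norm_num) |>.1 h2
      exact abs_eq_zero.1 h3
    simp [z] at sq
    linarith
  have hq : 0 < etaM A / n := by positivity
  refine ⟨row, col, sq, ?_, ?_, hn⟩
  · unfold EM; positivity
  · have : EM A ^ 3 = etaM A / n := by
      unfold EM
      rw [← Real.rpow_natCast, ← Real.rpow_mul hq.le]
      norm_num
    rw [this]
    have hn0 : (n:ℝ) ≠ 0 := by positivity
    rw [mul_div_cancel₀ _ hn0]
    rfl

lemma lam2_eq : lam2 A = (∑ i, ∑ j, hatM A i j ^ 4) / (n:ℝ) + 3 / (n:ℝ) - 3 / (n:ℝ) ^ 2 * (∑ p, rsq (hatM A) p ^ 2 + ∑ q, csq (hatM A) q ^ 2) := by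
  unfold lam2
  have h1 : ∀ p, rsq (hatM A) p ^ 2 = ∑ j, ∑ k, hatM A p j ^ 2 * hatM A p k ^ 2 := by
    intro p
    show (∑ v, hatM A p v ^ 2) ^ 2 = _
    rw [pow_two, Finset.sum_mul_sum]
  have h2 : ∀ q, csq (hatM A) q ^ 2 = ∑ i, ∑ k, hatM A i q ^ 2 * hatM A k q ^ 2 := by
    intro q
    show (∑ u, hatM A u q ^ 2) ^ 2 = _
    rw [pow_two, Finset.sum_mul_sum]
  simp only [h1, h2, Finset.sum_add_distrib]
  rw [Finset.sum_comm (f := fun q i => ∑ k, hatM A i q ^ 2 * hatM A k q ^ 2)]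

lemma Fr_mem {m : ℕ} (B : Matrix (Fin m) (Fin m) ℝ) (z : ℝ) : 0 ≤ Fr B z ∧ Fr B z ≤ 1 := by
  have h0 := permExp_mono (m := m) (f := fun _ => 0) (g := fun π => if rankT B π ≤ z then (1:ℝ) else 0)
    (fun π => by split_ifs <;> norm_num)
  have h1 := permExp_mono (m := m) (f := fun π => if rankT B π ≤ z then (1:ℝ) else 0) (g := fun _ => 1)
    (fun π => by split_ifs <;> norm_num)
  rw [permExp_const] at h0 h1
  exact ⟨h0, h1⟩

lemma edge2_eq (z : ℝ) : edge2 A z = UU (lam1 A) (lam2 A) 2 z := by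
  rw [UU2]; rfl

end Fin

end Part16

/-- second-order Edgeworth expansion for linear rank statistics.  The
submatrices `B ∈ N(16, Â)` are parametrized by the number `r ≤ min 16 (n−1)` of deleted
rows/columns and strictly monotone maps selecting the kept rows and columns. -/
theorem rank_statistic_second_order_edgeworth :
    ∃ K4 : ℝ, 0 < K4 ∧ ∃ K5 : ℝ, 0 < K5 ∧ ∃ K6 : ℝ, 0 < K6 ∧
      ∀ (n : ℕ), 2 ≤ n → ∀ A : Matrix (Fin n) (Fin n) ℝ, 0 < sdev A →
        ∀ C2 C3 : ℝ, 0 < C2 → 0 < C3 →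
          (∀ r : ℕ, r ≤ min 16 (n - 1) →
            ∀ ρ γ : Fin (n - r) → Fin n, StrictMono ρ → StrictMono γ →
              ∀ z x : ℝ, z ≤ x → x ≤ z + 3 * EM A →
                |Fr (fun i j => hatM A (ρ i) (γ j)) x -
                    interp (EM A) 2 z (Fr (fun i j => hatM A (ρ i) (γ j))) x| ≤
                  C2 * (EM A ^ 3 + (x - z) ^ 3)) →
          (∀ r : ℕ, r ≤ min 16 (n - 1) →
            ∀ ρ γ : Fin (n - r) → Fin n, StrictMono ρ → StrictMono γ →
              ∀ z y : ℝ, 0 ≤ y → y ≤ EM A →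
                (|z| + 1) * |Δiter y 2 (Fr (fun i j => hatM A (ρ i) (γ j))) z| ≤
                  C3 * (EM A ^ 2 + y ^ 2)) →
          ∀ z : ℝ, |Fstd A z - edge2 A z| ≤ (K4 * C2 + K5 * C3 + K6) * EM A ^ 3 := by
  obtain ⟨M, hM1, hM⟩ := vv_bdd
  obtain ⟨C, hC1, hCb⟩ := Gd_bdd
  refine ⟨2 * M + 200000 * ((3 * 10 ^ 22 + 6 * M) * (4 * M)), by positivity, 1, one_pos,
    200000 * ((3 * 10 ^ 22 + 6 * M) * (4 * M) + 40 * C) + 130000 * C, by positivity, ?_⟩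
  intro n hn A hs C2 C3 hC2 hC3 hyp _ z
  have S := hat_sit A hn hs
  have hE := S.E0
  have hp : 0 < EM A ^ 3 := by positivity
  rw [Fstd_eq A hn, edge2_eq]
  rcases le_or_gt (EM A) (1/40) with hE1 | hE1
  · have h100 := S.hn100 hE1
    have H : Hyp (hatM A) (EM A) C2 := by
      intro m hm ρ γ hρ hγ
      have hmn : m ≤ n := by simpa using Fintype.card_le_of_injective ρ hρ.injective
      obtain ⟨r, hr, rfl⟩ : ∃ r, r ≤ min 16 (n - 1) ∧ m = n - r := ⟨n - m, by omega, by omega⟩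
      exact hyp r hr ρ γ hρ hγ
    have key : |Fr (hatM A) z - UU (lam1 A) (lam2 A) 2 z| ≤ (2 * M * C2 + 200000 * ((3 * 10 ^ 22 + 6 * M) * (4 * M * (1 + C2)) + 40 * C)) * EM A ^ 3 := by
      have l1 : lam1 A = (∑ i, ∑ j, hatM A i j ^ 3) / (n:ℝ) := rfl
      have l2 := lam2_eq A
      generalize EM A = E at *
      generalize lam1 A = a1 at *
      generalize lam2 A = a2 at *
      generalize (hatM A : Fin n → Fin n → ℝ) = a at *
      obtain ⟨N, rfl⟩ : ∃ N, n = N + 3 := ⟨n - 3, by omega⟩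
      exact main_small H S hE1 hC2.le hM1 hM hC1 hCb l1 l2 z
    refine key.trans (mul_le_mul_of_nonneg_right ?_ hp.le)
    linarith
  · have b1 : |lam1 A| ≤ 2 * EM A := S.l1
    have b2 : |lam2 A| ≤ 60 * EM A ^ 2 := by rw [lam2_eq]; exact S.l2
    have u := abs_le.1 (UU_bd hE b1 b2 hCb (j := 2) le_rfl (by norm_num) z)
    have f := Fr_mem (hatM A) z
    have e1 : EM A ≤ 1600 * EM A ^ 3 := by nlinarith
    have e2 : EM A ^ 2 ≤ 40 * EM A ^ 3 := by nlinarith [sq_nonneg (EM A)]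
    have e3 : 1 + C * (1 + EM A + 3 * EM A ^ 2) ≤ 130000 * C * EM A ^ 3 := by
      have : 1 + EM A + 3 * EM A ^ 2 + 1 ≤ 130000 * EM A ^ 3 := by linarith
      have := mul_le_mul_of_nonneg_left this (show 0 ≤ C by linarith)
      linarith
    have e4 : 130000 * C * EM A ^ 3 ≤ ((2 * M + 200000 * ((3 * 10 ^ 22 + 6 * M) * (4 * M))) * C2 + 1 * C3 + (200000 * ((3 * 10 ^ 22 + 6 * M) * (4 * M) + 40 * C) + 130000 * C)) * EM A ^ 3 := by
      apply mul_le_mul_of_nonneg_right _ hp.le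
      have : 0 ≤ (2 * M + 200000 * ((3 * 10 ^ 22 + 6 * M) * (4 * M))) * C2 := by positivity
      have : 0 ≤ (3 * 10 ^ 22 + 6 * M) * (4 * M) := by positivity
      linarith
    refine le_trans ?_ (e3.trans e4)
    rw [abs_le]; constructor <;> linarith
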